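/- Let N ≥ 1, m ≥ 1 and p > N with p ≥ 2, and let f ∈ X_T and g ∈ X_T be the mild solutions of the Fermi-Dirac-Fokker-Planck equation on [0,T] with respective initial data f₀ ∈ Υ and g₀ ∈ Υ. Then ‖f(t) − g(t)‖_{L¹(ℝ^N)} ≤ ‖f₀ − g₀‖_{L¹(ℝ^N)} for all t ∈ (0,T]. -/

import Mathlib

open MeasureTheory Real Filter
open scoped ENNReal NNReal Topology

noncomputable section


/-- ℝ^N as a Euclidean space. -/
abbrev Evec (N : ℕ) := EuclideanSpace ℝ (Fin N)

/-- The weighted norm `‖(1+|v|^m) f‖_{L^p(ℝ^N)}` (as an extended nonnegative real). -/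
noncomputable def wLpNorm (N : ℕ) (p : ℝ≥0∞) (m : ℝ) (f : Evec N → ℝ) : ℝ≥0∞ :=
  eLpNorm (fun v => (1 + ‖v‖ ^ m) * f v) p volume

/-- The weighted norm `‖(1+|v|^m) G‖_{L^p(ℝ^N)}` of a vector field `G`. -/
noncomputable def wLpNormV (N : ℕ) (p : ℝ≥0∞) (m : ℝ) (G : Evec N → Evec N) : ℝ≥0∞ :=
  eLpNorm (fun v => (1 + ‖v‖ ^ m) * ‖G v‖) p volume

/-- Membership in `Υ = L^∞ ∩ L¹₁ ∩ L^p_m`. -/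
def MemUpsilon (N : ℕ) (p m : ℝ) (f : Evec N → ℝ) : Prop :=
  AEStronglyMeasurable f volume ∧ eLpNorm f ⊤ volume < ⊤ ∧
    wLpNorm N 1 1 f < ⊤ ∧ wLpNorm N (ENNReal.ofReal p) m f < ⊤

/-- The norm of `Υ`: `max {‖f‖_∞, ‖f‖_{L¹₁}, ‖f‖_{L^p_m}}`. -/
noncomputable def UpsilonNorm (N : ℕ) (p m : ℝ) (f : Evec N → ℝ) : ℝ≥0∞ :=
  max (eLpNorm f ⊤ volume) (max (wLpNorm N 1 1 f) (wLpNorm N (ENNReal.ofReal p) m f))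

/-- The fundamental solution `𝓕(t,v,w)` of the linear Fokker-Planck equation
`∂_t f = Δ_v f + div_v(vf)`. -/
noncomputable def FPkernel (N : ℕ) (t : ℝ) (v w : Evec N) : ℝ :=
  exp ((N : ℝ) * t) * (2 * π * (exp (2 * t) - 1)) ^ (-(N : ℝ) / 2) *
    exp (-‖exp t • v - w‖ ^ 2 / (2 * (exp (2 * t) - 1)))

/-- Continuity of `t ↦ f(t)` from `[0,T]` into `Υ` (w.r.t. the `Υ` norm). -/
def ContinuousInUpsilon (N : ℕ) (p m T : ℝ) (f : ℝ → Evec N → ℝ) : Prop :=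
  ∀ t₀ ∈ Set.Icc (0 : ℝ) T, ∀ ε : ℝ, 0 < ε → ∃ δ : ℝ, 0 < δ ∧
    ∀ t ∈ Set.Icc (0 : ℝ) T, |t - t₀| < δ →
      UpsilonNorm N p m (fun v => f t v - f t₀ v) < ENNReal.ofReal ε

/-- A mild solution on `[0,T]` of the Fermi-Dirac-Fokker-Planck equation
`∂_t f = Δ_v f + div_v(v f (1-f))` with initial datum `f₀`:
a function `f ∈ C([0,T]; Υ)` with `f(0) = f₀` satisfying the Duhamel formula
`f(t,v) = ∫ 𝓕(t,v,w) f₀(w) dw + ∫₀ᵗ e^{-(t-s)} ∫ (∇_v𝓕(t-s,v,w)·w) f(s,w)² dw ds`. -/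
def IsMildSolution (N : ℕ) (p m T : ℝ) (f₀ : Evec N → ℝ) (f : ℝ → Evec N → ℝ) : Prop :=
  (∀ t ∈ Set.Icc (0 : ℝ) T, MemUpsilon N p m (f t)) ∧
  ContinuousInUpsilon N p m T f ∧
  f 0 =ᵐ[volume] f₀ ∧
  ∀ t ∈ Set.Ioc (0 : ℝ) T, ∀ᵐ v : Evec N ∂volume,
    f t v = (∫ w : Evec N, FPkernel N t v w * f₀ w) +
      ∫ s in Set.Ioc (0 : ℝ) t, exp (-(t - s)) *
        ∫ w : Evec N,
          (@inner ℝ _ _ (gradient (fun u => FPkernel N (t - s) u w) v) w) * (f s w) ^ 2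

/-- Membership in `X_T`: a mild solution on `[0,T]` with
`sup_{0<t<T} ν(t)^{1/2} (‖∇_v f(t)‖_{L^p_m} + ‖∇_v f(t)‖_{L¹₁}) < ∞`, `ν(t) = e^{2t}-1`. -/
def MemXT (N : ℕ) (p m T : ℝ) (f₀ : Evec N → ℝ) (f : ℝ → Evec N → ℝ) : Prop :=
  IsMildSolution N p m T f₀ f ∧
  ∃ C : ℝ≥0∞, C ≠ ⊤ ∧ ∀ t ∈ Set.Ioo (0 : ℝ) T,
    ENNReal.ofReal (Real.sqrt (exp (2 * t) - 1)) *
      (wLpNormV N (ENNReal.ofReal p) m (fun v => gradient (f t) v) +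
        wLpNormV N 1 1 (fun v => gradient (f t) v)) ≤ C

/-- A global mild solution: the restriction to `[0,T]` belongs to `X_T` for every `T > 0`. -/
def IsGlobalSolution (N : ℕ) (p m : ℝ) (f₀ : Evec N → ℝ) (f : ℝ → Evec N → ℝ) : Prop :=
  ∀ T : ℝ, 0 < T → MemXT N p m T f₀ f



def bt (δ s : ℝ) : ℝ := √(s ^ 2 + δ ^ 2) - δ
def bt1 (δ s : ℝ) : ℝ := s / √(s ^ 2 + δ ^ 2)
def bt2 (δ s : ℝ) : ℝ := δ ^ 2 / √(s ^ 2 + δ ^ 2) ^ 3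

lemma bt_pos_aux {δ : ℝ} (hδ : 0 < δ) (s : ℝ) : 0 < √(s ^ 2 + δ ^ 2) :=
  Real.sqrt_pos.2 (by positivity)

lemma bt_nonneg {δ : ℝ} (hδ : 0 < δ) (s : ℝ) : 0 ≤ bt δ s := by
  unfold bt
  have : δ ≤ √(s ^ 2 + δ ^ 2) := Real.le_sqrt_of_sq_le (by nlinarith [sq_nonneg s])
  linarith

lemma bt_le {δ : ℝ} (hδ : 0 < δ) (s : ℝ) : bt δ s ≤ |s| := by
  unfold bt
  have : √(s ^ 2 + δ ^ 2) ≤ |s| + δ := by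
    apply Real.sqrt_le_iff.2
    refine ⟨by positivity, ?_⟩
    nlinarith [abs_nonneg s, sq_abs s]
  linarith

lemma le_bt {δ : ℝ} (s : ℝ) : |s| - δ ≤ bt δ s := by
  unfold bt
  have : |s| ≤ √(s ^ 2 + δ ^ 2) := Real.abs_le_sqrt (by nlinarith [sq_nonneg δ])
  linarith

lemma hasDerivAt_sq_aux {δ : ℝ} (hδ : 0 < δ) (s : ℝ) :
    HasDerivAt (fun s => √(s ^ 2 + δ ^ 2)) (bt1 δ s) s := by
  have h : HasDerivAt (fun s : ℝ => s ^ 2 + δ ^ 2) (2 * s) s := by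
    simpa using (hasDerivAt_pow 2 s).add_const (δ ^ 2)
  have := h.sqrt (by positivity)
  convert this using 1
  unfold bt1
  have := (bt_pos_aux hδ s).ne'
  field_simp

lemma hasDerivAt_bt {δ : ℝ} (hδ : 0 < δ) (s : ℝ) : HasDerivAt (bt δ) (bt1 δ s) s :=
  (hasDerivAt_sq_aux hδ s).sub_const δ

lemma hasDerivAt_bt1 {δ : ℝ} (hδ : 0 < δ) (s : ℝ) : HasDerivAt (bt1 δ) (bt2 δ s) s := by
  have := (hasDerivAt_id s).div (hasDerivAt_sq_aux hδ s) (bt_pos_aux hδ s).ne'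
  refine this.congr_deriv ?_
  unfold bt1 bt2
  have h := (bt_pos_aux hδ s)
  have h2 : √(s ^ 2 + δ ^ 2) ^ 2 = s ^ 2 + δ ^ 2 := Real.sq_sqrt (by positivity)
  simp only [id]
  field_simp
  rw [h2]; ring

lemma abs_bt1_le {δ : ℝ} (hδ : 0 < δ) (s : ℝ) : |bt1 δ s| ≤ 1 := by
  unfold bt1
  rw [abs_div, abs_of_pos (bt_pos_aux hδ s), div_le_one (bt_pos_aux hδ s)]
  exact Real.abs_le_sqrt (by nlinarith [sq_nonneg δ])

lemma bt2_nonneg (δ s : ℝ) : 0 ≤ bt2 δ s := by unfold bt2; positivity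

lemma bt2_le {δ : ℝ} (hδ : 0 < δ) (s : ℝ) : bt2 δ s ≤ 1 / δ := by
  unfold bt2
  have h : δ ≤ √(s ^ 2 + δ ^ 2) := Real.le_sqrt_of_sq_le (by nlinarith [sq_nonneg s])
  rw [div_le_div_iff₀ (by have := bt_pos_aux hδ s; positivity) hδ]
  have := pow_le_pow_left₀ hδ.le h 3
  nlinarith

lemma bt2_mul_sq_le {δ : ℝ} (hδ : 0 < δ) (s : ℝ) : bt2 δ s * s ^ 2 ≤ |s| := by
  unfold bt2
  have h1 : δ ≤ √(s ^ 2 + δ ^ 2) := Real.le_sqrt_of_sq_le (by nlinarith [sq_nonneg s])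
  have h2 : |s| ≤ √(s ^ 2 + δ ^ 2) := Real.abs_le_sqrt (by nlinarith [sq_nonneg δ])
  have h0 := bt_pos_aux hδ s
  rw [div_mul_eq_mul_div, div_le_iff₀ (by positivity)]
  generalize √(s ^ 2 + δ ^ 2) = a at *
  rw [← sq_abs s]
  have h3 : δ ^ 2 ≤ a ^ 2 := pow_le_pow_left₀ hδ.le h1 2
  have : δ ^ 2 * |s| ≤ a ^ 2 * a := mul_le_mul h3 h2 (abs_nonneg _) (by positivity)
  nlinarith [abs_nonneg s]

lemma continuous_bt (δ : ℝ) : Continuous (bt δ) := by unfold bt; fun_prop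
lemma continuous_bt1 {δ : ℝ} (hδ : 0 < δ) : Continuous (bt1 δ) := by
  unfold bt1
  exact continuous_id.div (by fun_prop) (fun s => (bt_pos_aux hδ s).ne')
lemma continuous_bt2 {δ : ℝ} (hδ : 0 < δ) : Continuous (bt2 δ) := by
  unfold bt2
  exact continuous_const.div (by fun_prop) (fun s => by have := (bt_pos_aux hδ s); positivity)

lemma bt2_tendsto (s : ℝ) (hs : s ≠ 0) : Tendsto (fun δ => bt2 δ s) (𝓝 0) (𝓝 0) := by
  unfold bt2
  have : ContinuousAt (fun δ => δ ^ 2 / √(s ^ 2 + δ ^ 2) ^ 3) 0 := by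
    apply ContinuousAt.div (by fun_prop) (by fun_prop)
    have : 0 < √(s ^ 2 + (0:ℝ) ^ 2) := Real.sqrt_pos.2 (by positivity)
    positivity
  simpa [ContinuousAt] using this

/-- chain rule -/
lemma chain_bt {δ : ℝ} (hδ : 0 < δ) {T : ℝ} (hT : 0 < T) (U Q : ℝ → ℝ) (C : ℝ)
    (hQm : Measurable Q) (hQ : ∀ t ∈ Set.Icc 0 T, |Q t| ≤ C)
    (hU : ∀ t ∈ Set.Icc 0 T, U t = U 0 + ∫ s in (0:ℝ)..t, Q s) :
    bt δ (U T) - bt δ (U 0) = ∫ s in (0:ℝ)..T, bt1 δ (U s) * Q s := by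
  have hC : 0 ≤ C := (abs_nonneg _).trans (hQ 0 ⟨le_rfl, hT.le⟩)
  have hQi : IntervalIntegrable Q volume 0 T := by
    rw [intervalIntegrable_iff_integrableOn_Ioc_of_le hT.le]
    refine Measure.integrableOn_of_bounded (M := C) (by simp) hQm.aestronglyMeasurable ?_
    filter_upwards [ae_restrict_mem measurableSet_Ioc] with s hs
    exact hQ s ⟨hs.1.le, hs.2⟩
  set V : ℝ → ℝ := fun t => U 0 + ∫ s in (0:ℝ)..t, Q s with hV
  have hV0 : V 0 = U 0 := by simp [hV]
  have hlip : LipschitzOnWith (Real.toNNReal C) V (Set.uIcc 0 T) := by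
    rw [Set.uIcc_of_le hT.le]
    apply LipschitzOnWith.of_dist_le_mul
    intro x hx y hy
    have hx' : IntervalIntegrable Q volume 0 x := hQi.mono_set (by
      rw [Set.uIcc_of_le hT.le, Set.uIcc_of_le hx.1]; exact Set.Icc_subset_Icc_right hx.2)
    have hy' : IntervalIntegrable Q volume 0 y := hQi.mono_set (by
      rw [Set.uIcc_of_le hT.le, Set.uIcc_of_le hy.1]; exact Set.Icc_subset_Icc_right hy.2)
    simp only [hV, Real.dist_eq, add_sub_add_left_eq_sub]
    rw [intervalIntegral.integral_interval_sub_left hx' hy', Real.coe_toNNReal _ hC]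
    refine intervalIntegral.norm_integral_le_of_norm_le_const (C := C) (f := Q) ?_
    intro s hs
    apply hQ
    have := Set.uIoc_subset_uIcc hs
    exact Set.uIcc_subset_Icc hy hx this
  have hbl : LipschitzWith 1 (bt δ) := by
    apply lipschitzWith_of_nnnorm_deriv_le (fun s => (hasDerivAt_bt hδ s).differentiableAt)
    intro s
    rw [(hasDerivAt_bt hδ s).deriv, ← NNReal.coe_le_coe]
    simpa using abs_bt1_le hδ s
  have hac := (hbl.comp_lipschitzOnWith hlip).absolutelyContinuousOnInterval
  have h1 := hac.integral_deriv_eq_sub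
  have e1 : bt δ (U T) - bt δ (U 0) = (bt δ ∘ V) T - (bt δ ∘ V) 0 := by
    simp only [Function.comp, hV0]; rw [hU T ⟨hT.le, le_rfl⟩]
  rw [e1, ← h1]
  apply intervalIntegral.integral_congr_ae
  filter_upwards [hQi.ae_hasDerivAt_integral] with x hx hx2
  have hx3 := Set.uIoc_subset_uIcc hx2
  have h4 := (hx hx3 0 (by simp)).const_add (U 0)
  have h5 := (hasDerivAt_bt hδ (V x)).comp x h4
  have h6 : V x = U x := by
    rw [hU x (by rwa [Set.uIcc_of_le hT.le] at hx3)]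
  rw [h5.deriv, h6]

/-- jointly measurable, uniformly bounded and uniformly integrable on `[0,T]`. -/
def Nice {N : ℕ} (T : ℝ) (V : ℝ → Evec N → ℝ) : Prop :=
  Measurable (Function.uncurry V) ∧ ∃ C : ℝ, 0 ≤ C ∧ ∀ t ∈ Set.Icc 0 T,
    (∀ y, |V t y| ≤ C) ∧ Integrable (V t) ∧ ∫ y, |V t y| ≤ C

lemma Nice.add {N : ℕ} {T : ℝ} {V W : ℝ → Evec N → ℝ} (hV : Nice T V) (hW : Nice T W) :
    Nice T (fun t y => V t y + W t y) := by
  obtain ⟨hm, C, hC0, hC⟩ := hV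
  obtain ⟨hm', C', hC0', hC'⟩ := hW
  refine ⟨hm.add hm', C + C', by positivity, fun t ht => ?_⟩
  obtain ⟨a1, a2, a3⟩ := hC t ht
  obtain ⟨b1, b2, b3⟩ := hC' t ht
  refine ⟨fun y => (abs_add_le _ _).trans (add_le_add (a1 y) (b1 y)), a2.add b2, ?_⟩
  calc ∫ y, |V t y + W t y| ≤ ∫ y, (|V t y| + |W t y|) :=
        integral_mono (a2.add b2).abs (a2.abs.add b2.abs) (fun y => abs_add_le _ _)
    _ = _ := integral_add a2.abs b2.abs
    _ ≤ _ := add_le_add a3 b3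

/-- multiply by a bounded measurable function -/
lemma Nice.mul_left {N : ℕ} {T : ℝ} {V b : ℝ → Evec N → ℝ} (hV : Nice T V)
    (hb : Measurable (Function.uncurry b)) {B : ℝ} (hB0 : 0 ≤ B)
    (hB : ∀ t ∈ Set.Icc 0 T, ∀ y, |b t y| ≤ B) :
    Nice T (fun t y => b t y * V t y) := by
  obtain ⟨hm, C, hC0, hC⟩ := hV
  refine ⟨hb.mul hm, B * C, by positivity, fun t ht => ?_⟩
  obtain ⟨a1, a2, a3⟩ := hC t ht
  have h1 : ∀ y, |b t y * V t y| ≤ B * |V t y| := fun y => by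
    rw [abs_mul]; exact mul_le_mul_of_nonneg_right (hB t ht y) (abs_nonneg _)
  have h2 : Integrable (fun y => b t y * V t y) :=
    (a2.abs.const_mul B).mono' ((hb.comp measurable_prodMk_left).mul (hm.comp measurable_prodMk_left)).aestronglyMeasurable
      (ae_of_all _ h1)
  refine ⟨fun y => (h1 y).trans (mul_le_mul_of_nonneg_left (a1 y) hB0), h2, ?_⟩
  calc ∫ y, |b t y * V t y| ≤ ∫ y, B * |V t y| := integral_mono h2.abs (a2.abs.const_mul B) h1
    _ = B * ∫ y, |V t y| := integral_const_mul _ _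
    _ ≤ _ := mul_le_mul_of_nonneg_left a3 hB0

lemma Nice.sum {N : ℕ} {T : ℝ} {ι : Type*} (S : Finset ι) {V : ι → ℝ → Evec N → ℝ}
    (hV : ∀ i, Nice T (V i)) : Nice T (fun t y => ∑ i ∈ S, V i t y) := by
  classical
  induction S using Finset.induction_on with
  | empty =>
    refine ⟨by simpa [Function.uncurry_def] using measurable_const, 0, le_rfl, fun t _ => ?_⟩
    simp
  | insert a S ha ih =>
    simp only [Finset.sum_insert ha]
    exact (hV a).add ih

lemma Nice.integrable {N : ℕ} {T : ℝ} {V : ℝ → Evec N → ℝ} (hV : Nice T V) :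
    Integrable (Function.uncurry V) ((volume.restrict (Set.Ioc 0 T)).prod volume) := by
  obtain ⟨hm, C, hC0, hC⟩ := hV
  rw [integrable_prod_iff hm.aestronglyMeasurable]
  constructor
  · filter_upwards [ae_restrict_mem measurableSet_Ioc] with s hs
    exact (hC s ⟨hs.1.le, hs.2⟩).2.1
  · refine Measure.integrableOn_of_bounded (M := C) (by simp) ?_ ?_
    · exact (hm.norm.stronglyMeasurable.integral_prod_right (ν := volume)).aestronglyMeasurable
    · filter_upwards [ae_restrict_mem measurableSet_Ioc] with s hs
      rw [Real.norm_of_nonneg (integral_nonneg fun y => norm_nonneg _)]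
      exact (hC s ⟨hs.1.le, hs.2⟩).2.2

lemma ibp_aux {N : ℕ} {f f' g g' : Evec N → ℝ} (v : Evec N)
    (h1 : Integrable (fun x => f' x * g x)) (h2 : Integrable (fun x => f x * g' x))
    (h3 : Integrable (fun x => f x * g x))
    (hf : ∀ x, HasLineDerivAt ℝ f (f' x) x v) (hg : ∀ x, HasLineDerivAt ℝ g (g' x) x v) :
    ∫ x, f x * g' x = - ∫ x, f' x * g x :=
  integral_bilinear_hasLineDerivAt_right_eq_neg_left_of_integrable
    (B := ContinuousLinearMap.mul ℝ ℝ) h1 h2 h3 (fun x _ => hf x) (fun x _ => hg x)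

lemma energy {N : ℕ} {T δ : ℝ} (hT : 0 < T) (hδ : 0 < δ)
    (U : ℝ → Evec N → ℝ) (W Wd F Fd : Fin N → ℝ → Evec N → ℝ)
    (hU : Nice T U) (hW : ∀ i, Nice T (W i)) (hWd : ∀ i, Nice T (Wd i))
    (hF : ∀ i, Nice T (F i)) (hFd : ∀ i, Nice T (Fd i))
    (hUW : ∀ i, ∀ t ∈ Set.Icc 0 T, ∀ y, HasLineDerivAt ℝ (U t) (W i t y) y (EuclideanSpace.single i 1))
    (hWWd : ∀ i, ∀ t ∈ Set.Icc 0 T, ∀ y, HasLineDerivAt ℝ (W i t) (Wd i t y) y (EuclideanSpace.single i 1))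
    (hFFd : ∀ i, ∀ t ∈ Set.Icc 0 T, ∀ y, HasLineDerivAt ℝ (F i t) (Fd i t y) y (EuclideanSpace.single i 1))
    (hev : ∀ t ∈ Set.Icc 0 T, ∀ y, U t y = U 0 y +
      ∫ s in (0:ℝ)..t, ∑ i, (exp (2 * s) * Wd i s y + Fd i s y)) :
    ∫ y, bt δ (U T y) ≤ (∫ y, bt δ (U 0 y)) +
      ∫ s in Set.Ioc 0 T, ∫ y, bt2 δ (U s y) * ((∑ i, F i s y ^ 2) / 4) := by
  have hexpm : Measurable (Function.uncurry (fun (s:ℝ) (_:Evec N) => exp (2 * s))) := by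
    simp only [Function.uncurry_def]; fun_prop
  have hexpb : ∀ t ∈ Set.Icc 0 T, ∀ _y : Evec N, |exp (2 * t)| ≤ exp (2 * T) := fun t ht y => by
    rw [abs_of_pos (exp_pos _)]; exact exp_le_exp.2 (by linarith [ht.2])
  have hGd : ∀ i, Nice T (fun s y => exp (2 * s) * Wd i s y + Fd i s y) := fun i =>
    ((hWd i).mul_left hexpm (exp_pos _).le hexpb).add (hFd i)
  have hG : ∀ i, Nice T (fun s y => exp (2 * s) * W i s y + F i s y) := fun i =>
    ((hW i).mul_left hexpm (exp_pos _).le hexpb).add (hF i)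
  set Q : ℝ → Evec N → ℝ := fun s y => ∑ i, (exp (2 * s) * Wd i s y + Fd i s y) with hQ
  have hQn : Nice T Q := Nice.sum _ hGd
  have hb1m : Measurable (Function.uncurry (fun s y => bt1 δ (U s y))) :=
    (continuous_bt1 hδ).measurable.comp hU.1
  have hb2m : Measurable (Function.uncurry (fun s y => bt2 δ (U s y))) :=
    (continuous_bt2 hδ).measurable.comp hU.1
  have hb1 : ∀ {V : ℝ → Evec N → ℝ}, Nice T V → Nice T (fun s y => bt1 δ (U s y) * V s y) :=
    fun hV => hV.mul_left hb1m zero_le_one (fun t _ y => abs_bt1_le hδ _)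
  have hb2 : ∀ {V : ℝ → Evec N → ℝ}, Nice T V → Nice T (fun s y => bt2 δ (U s y) * V s y) :=
    fun hV => hV.mul_left hb2m (by positivity : (0:ℝ) ≤ 1 / δ)
      (fun t _ y => by rw [abs_of_nonneg (bt2_nonneg _ _)]; exact bt2_le hδ _)
  have hmulN : ∀ {V V' : ℝ → Evec N → ℝ}, Nice T V → Nice T V' →
      Nice T (fun s y => V s y * V' s y) := fun hV hV' => by
    obtain ⟨hm, C, hC0, hC⟩ := hV
    exact hV'.mul_left hm hC0 (fun t ht => (hC t ht).1)
  -- chain rule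
  have hch : ∀ y, bt δ (U T y) - bt δ (U 0 y) = ∫ s in Set.Ioc 0 T, bt1 δ (U s y) * Q s y := by
    intro y
    obtain ⟨hm, C, hC0, hC⟩ := hQn
    rw [← intervalIntegral.integral_of_le hT.le]
    exact chain_bt hδ hT (fun s => U s y) (fun s => Q s y) C
      (hm.comp measurable_prodMk_right) (fun t ht => (hC t ht).1 y) (fun t ht => hev t ht y)
  have hbint : ∀ t ∈ Set.Icc 0 T, Integrable (fun y => bt δ (U t y)) := fun t ht => by
    obtain ⟨hm, C, hC0, hC⟩ := hU
    refine (hC t ht).2.1.abs.mono' ((continuous_bt δ).measurable.comp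
      (hm.comp measurable_prodMk_left)).aestronglyMeasurable (ae_of_all _ fun y => ?_)
    rw [Real.norm_of_nonneg (bt_nonneg hδ _)]; exact bt_le hδ _
  have e1 : (∫ y, bt δ (U T y)) - ∫ y, bt δ (U 0 y) =
      ∫ s in Set.Ioc 0 T, ∫ y, bt1 δ (U s y) * Q s y := by
    rw [← integral_sub (hbint T ⟨hT.le, le_rfl⟩) (hbint 0 ⟨le_rfl, hT.le⟩)]
    simp_rw [hch]
    exact (integral_integral_swap (hb1 hQn).integrable).symm
  have hsq : Nice T (fun s y => bt2 δ (U s y) * ((∑ i, F i s y ^ 2) / 4)) := by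
    apply hb2
    have : Nice T (fun s y => (1/4 : ℝ) * ∑ i, F i s y * F i s y) :=
      (Nice.sum _ (fun i => hmulN (hF i) (hF i))).mul_left
        (b := fun _ _ => (1/4 : ℝ)) (by simpa [Function.uncurry_def] using measurable_const) (B := 1/4) (by norm_num) (fun _ _ _ => by norm_num)
    convert this using 4
    simp only [pow_two]; ring
  have key : (∫ s in Set.Ioc 0 T, ∫ y, bt1 δ (U s y) * Q s y) ≤
      ∫ s in Set.Ioc 0 T, ∫ y, bt2 δ (U s y) * ((∑ i, F i s y ^ 2) / 4) := by
    refine setIntegral_mono_on (hb1 hQn).integrable.integral_prod_left hsq.integrable.integral_prod_left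
      measurableSet_Ioc ?_
    intro s hs
    have hs' : s ∈ Set.Icc 0 T := ⟨hs.1.le, hs.2⟩
    have hin : ∀ {V : ℝ → Evec N → ℝ}, Nice T V → Integrable (V s) := fun hV => by
      obtain ⟨hm, C, hC0, hC⟩ := hV
      exact (hC s hs').2.1
    have e2 : ∀ i, ∫ y, bt1 δ (U s y) * (exp (2 * s) * Wd i s y + Fd i s y) =
        - ∫ y, (bt2 δ (U s y) * W i s y) * (exp (2 * s) * W i s y + F i s y) := by
      intro i
      apply ibp_aux (EuclideanSpace.single i 1)
      · exact hin (hmulN (hb2 (hW i)) (hG i))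
      · exact hin (hb1 (hGd i))
      · exact hin (hb1 (hG i))
      · intro x
        have h := hUW i s hs' x
        unfold HasLineDerivAt at h ⊢
        have h2 := HasDerivAt.comp (h₂ := bt1 δ) (0:ℝ) (hasDerivAt_bt1 hδ _) h
        simpa [Function.comp_def] using h2
      · intro x
        have h := hWWd i s hs' x
        have h' := hFFd i s hs' x
        unfold HasLineDerivAt at h h' ⊢
        exact (h.const_mul _).add h'
    have e3 : ∫ y, bt1 δ (U s y) * Q s y =
        ∫ y, -∑ i, (bt2 δ (U s y) * W i s y) * (exp (2 * s) * W i s y + F i s y) := by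
      simp only [hQ, Finset.mul_sum]
      rw [integral_finset_sum _ (fun i _ => hin (hb1 (hGd i))), integral_neg,
        integral_finset_sum _ (fun i _ => hin (hmulN (hb2 (hW i)) (hG i))), ← Finset.sum_neg_distrib]
      exact Finset.sum_congr rfl (fun i _ => e2 i)
    rw [e3]
    refine integral_mono (hin (Nice.sum _ (fun i => hmulN (hb2 (hW i)) (hG i)))).neg (hin hsq) ?_
    intro y
    simp only [Finset.mul_sum, Finset.sum_div]
    rw [← Finset.sum_neg_distrib]
    refine Finset.sum_le_sum fun i _ => ?_
    have h2 := bt2_nonneg δ (U s y)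
    have h1 : 1 ≤ exp (2 * s) := one_le_exp (by linarith [hs.1])
    have : - (W i s y * (exp (2 * s) * W i s y + F i s y)) ≤ F i s y ^ 2 / 4 := by
      nlinarith [sq_nonneg (W i s y + F i s y / 2), mul_le_mul_of_nonneg_right h1 (sq_nonneg (W i s y))]
    nlinarith [mul_le_mul_of_nonneg_left this h2]
  linarith

def Gk {N : ℕ} (r : ℝ) (x : Evec N) : ℝ :=
  (2 * π * r) ^ (-(N : ℝ) / 2) * exp (-‖x‖ ^ 2 / (2 * r))
def dlt {N : ℕ} (i j : Fin N) : ℝ := if i = j then 1 else 0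
def G1 {N : ℕ} (i : Fin N) (r : ℝ) (x : Evec N) : ℝ := -(x i / r) * Gk r x
def G2 {N : ℕ} (i j : Fin N) (r : ℝ) (x : Evec N) : ℝ :=
  (x i * x j / r ^ 2 - dlt i j / r) * Gk r x
def G3 {N : ℕ} (i j : Fin N) (r : ℝ) (x : Evec N) : ℝ :=
  ((x j + 2 * dlt i j * x i) / r ^ 2 - x i ^ 2 * x j / r ^ 3) * Gk r x

lemma abs_dlt_le {N : ℕ} (i j : Fin N) : |dlt i j| ≤ 1 := by
  unfold dlt; split_ifs <;> simp

lemma Gk_nonneg {N : ℕ} {r : ℝ} (hr : 0 ≤ r) (x : Evec N) : 0 ≤ Gk r x := by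
  unfold Gk; positivity

lemma norm_line_sq {N : ℕ} (x : Evec N) (i : Fin N) (t : ℝ) :
    ‖x + t • (EuclideanSpace.single i (1:ℝ) : Evec N)‖ ^ 2 = ‖x‖ ^ 2 + 2 * t * x i + t ^ 2 := by
  rw [norm_add_sq_real, inner_smul_right, norm_smul]
  simp [EuclideanSpace.inner_single_right]
  ring

lemma coord_line {N : ℕ} (x : Evec N) (i j : Fin N) (t : ℝ) :
    (x + t • (EuclideanSpace.single i (1:ℝ) : Evec N)) j = x j + t * dlt i j := by
  simp [dlt, eq_comm]

lemma Gk_line {N : ℕ} (i : Fin N) {r : ℝ} (x : Evec N) :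
    HasLineDerivAt ℝ (Gk r) (G1 i r x) x (EuclideanSpace.single i 1) := by
  unfold HasLineDerivAt Gk G1
  simp only [norm_line_sq]
  have h : HasDerivAt (fun t : ℝ => -(‖x‖ ^ 2 + 2 * t * x i + t ^ 2) / (2 * r)) (-(x i / r)) 0 := by
    have h1 : HasDerivAt (fun t : ℝ => ‖x‖ ^ 2 + 2 * t * x i + t ^ 2) (2 * x i) 0 := by
      have := ((((hasDerivAt_id (0:ℝ)).const_mul 2).mul_const (x i)).const_add (‖x‖^2)).add
        (hasDerivAt_pow 2 (0:ℝ))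
      exact this.congr_deriv (by simp)
    refine (h1.neg.div_const (2 * r)).congr_deriv ?_
    by_cases hr : r = 0
    · simp [hr]
    · field_simp
  refine (h.exp.const_mul _).congr_deriv ?_
  unfold Gk
  simp
  ring

lemma G1_line {N : ℕ} (i j : Fin N) {r : ℝ} (x : Evec N) :
    HasLineDerivAt ℝ (G1 j r) (G2 i j r x) x (EuclideanSpace.single i 1) := by
  have h0 := Gk_line i (r := r) x
  unfold HasLineDerivAt at h0 ⊢
  have h1 : HasDerivAt (fun t : ℝ => -((x + t • (EuclideanSpace.single i (1:ℝ) : Evec N)) j / r)) (-(dlt i j / r)) 0 := by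
    simp only [coord_line]
    have := ((((hasDerivAt_id (0:ℝ)).mul_const (dlt i j)).const_add (x j)).div_const r).neg
    exact this.congr_deriv (by simp)
  refine (h1.mul h0).congr_deriv ?_
  simp only [G1, G2, zero_smul, add_zero]
  ring

lemma G2_line {N : ℕ} (i j : Fin N) {r : ℝ} (x : Evec N) :
    HasLineDerivAt ℝ (G2 i j r) (G3 i j r x) x (EuclideanSpace.single i 1) := by
  have h0 := Gk_line i (r := r) x
  unfold HasLineDerivAt at h0 ⊢
  have h1 : HasDerivAt (fun t : ℝ => (x + t • (EuclideanSpace.single i (1:ℝ) : Evec N)) i *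
      (x + t • (EuclideanSpace.single i (1:ℝ) : Evec N)) j / r ^ 2 - dlt i j / r)
      ((x j + dlt i j * x i) / r ^ 2) 0 := by
    simp only [coord_line]
    have a := (((hasDerivAt_id (0:ℝ)).mul_const (dlt i i)).const_add (x i))
    have b := (((hasDerivAt_id (0:ℝ)).mul_const (dlt i j)).const_add (x j))
    refine (((a.mul b).div_const (r^2)).sub_const (dlt i j / r)).congr_deriv ?_
    simp [dlt]
  refine (h1.mul h0).congr_deriv ?_
  simp only [G1, G3, zero_smul, add_zero]
  by_cases hr : r = 0
  · simp [hr]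
  · field_simp; ring

lemma sum_sq_coord {N : ℕ} (x : Evec N) : ∑ i, x i ^ 2 = ‖x‖ ^ 2 := by
  rw [EuclideanSpace.norm_sq_eq]; simp

lemma Gk_r {N : ℕ} {r : ℝ} (hr : 0 < r) (x : Evec N) :
    HasDerivAt (fun r => Gk r x) ((1 / 2) * ∑ i, G2 i i r x) r := by
  have h1 : HasDerivAt (fun r : ℝ => (2 * π * r) ^ (-(N : ℝ) / 2))
      ((-(N:ℝ) / 2) / r * (2 * π * r) ^ (-(N : ℝ) / 2)) r := by
    have h := ((hasDerivAt_id r).const_mul (2 * π)).rpow_const (p := -(N : ℝ) / 2)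
      (Or.inl (by simp only [id]; positivity))
    refine h.congr_deriv ?_
    simp only [id]
    rw [Real.rpow_sub_one (by positivity)]
    field_simp
  have h2 : HasDerivAt (fun r : ℝ => exp (-‖x‖ ^ 2 / (2 * r)))
      (‖x‖ ^ 2 / (2 * r ^ 2) * exp (-‖x‖ ^ 2 / (2 * r))) r := by
    have h := (((hasDerivAt_const r (-‖x‖ ^ 2)).div ((hasDerivAt_id r).const_mul 2)
      (by simp only [id]; positivity))).exp
    refine h.congr_deriv ?_
    simp only [id, Pi.div_apply]
    field_simp
    ring
  refine (h1.mul h2).congr_deriv ?_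
  have : ∑ i, G2 i i r x = (‖x‖ ^ 2 / r ^ 2 - N / r) * Gk r x := by
    simp only [G2, ← Finset.sum_mul, Finset.sum_sub_distrib, ← Finset.sum_div, ← sum_sq_coord x]
    simp [dlt, pow_two]
  rw [this]
  unfold Gk
  field_simp
  ring

lemma G1_r {N : ℕ} (j : Fin N) {r : ℝ} (hr : 0 < r) (x : Evec N) :
    HasDerivAt (fun r => G1 j r x) ((1 / 2) * ∑ i, G3 i j r x) r := by
  have h0 := Gk_r hr x
  have h1 : HasDerivAt (fun r : ℝ => -(x j / r)) (x j / r ^ 2) r := by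
    refine ((hasDerivAt_const r (x j)).div (hasDerivAt_id r) hr.ne').neg.congr_deriv ?_
    simp; ring
  refine (h1.mul h0).congr_deriv ?_
  have e2 : ∑ i, G2 i i r x = (‖x‖ ^ 2 / r ^ 2 - N / r) * Gk r x := by
    simp only [G2, ← Finset.sum_mul, Finset.sum_sub_distrib, ← Finset.sum_div, ← sum_sq_coord x]
    simp [dlt, pow_two]
  have e3 : ∑ i, G3 i j r x = ((N + 2) * x j / r ^ 2 - ‖x‖ ^ 2 * x j / r ^ 3) * Gk r x := by
    simp only [G3, ← Finset.sum_mul, Finset.sum_sub_distrib, ← Finset.sum_div, ← sum_sq_coord x,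
      Finset.sum_add_distrib]
    have : ∑ i, 2 * dlt i j * x i = 2 * x j := by simp [dlt]
    rw [this]; simp; left; ring
  rw [e2, e3]
  field_simp
  ring

/-- Gaussian-bounded kernels -/
def KB {N : ℕ} (K : ℝ → Evec N → ℝ) : Prop :=
  Measurable (Function.uncurry K) ∧ ∀ ε R : ℝ, 0 < ε → ε ≤ R → ∃ C : ℝ, 0 ≤ C ∧
    ∀ r ∈ Set.Icc ε R, ∀ x, |K r x| ≤ C * exp (-‖x‖ ^ 2 / (4 * R))

lemma KB.add {N : ℕ} {K L : ℝ → Evec N → ℝ} (hK : KB K) (hL : KB L) :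
    KB (fun r x => K r x + L r x) := by
  refine ⟨hK.1.add hL.1, fun ε R h1 h2 => ?_⟩
  obtain ⟨C, hC0, hC⟩ := hK.2 ε R h1 h2
  obtain ⟨C', hC0', hC'⟩ := hL.2 ε R h1 h2
  refine ⟨C + C', by positivity, fun r hr x => ?_⟩
  rw [add_mul]
  exact (abs_add_le _ _).trans (add_le_add (hC r hr x) (hC' r hr x))

lemma KB.const_mul {N : ℕ} {K : ℝ → Evec N → ℝ} (c : ℝ) (hK : KB K) :
    KB (fun r x => c * K r x) := by
  refine ⟨hK.1.const_mul c, fun ε R h1 h2 => ?_⟩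
  obtain ⟨C, hC0, hC⟩ := hK.2 ε R h1 h2
  refine ⟨|c| * C, by positivity, fun r hr x => ?_⟩
  rw [abs_mul, mul_assoc]
  exact mul_le_mul_of_nonneg_left (hC r hr x) (abs_nonneg _)

lemma KB.sum {N : ℕ} {ι : Type*} (S : Finset ι) {K : ι → ℝ → Evec N → ℝ} (hK : ∀ i, KB (K i)) :
    KB (fun r x => ∑ i ∈ S, K i r x) := by
  classical
  induction S using Finset.induction_on with
  | empty =>
    refine ⟨by simp [Function.uncurry_def], fun ε R _ _ => ⟨0, le_rfl, by simp⟩⟩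
  | insert a S ha ih =>
    simp only [Finset.sum_insert ha]
    exact (hK a).add ih

lemma poly_exp_bound {R a : ℝ} (hR : 0 < R) (ha : 0 ≤ a) :
    (1 + a) ^ 3 * exp (-a ^ 2 / (2 * R)) ≤ (8 * (1 + 32 * R ^ 2)) * exp (-a ^ 2 / (4 * R)) := by
  have h1 : exp (-a ^ 2 / (2 * R)) = exp (-a ^ 2 / (4 * R)) / exp (a ^ 2 / (4 * R)) := by
    rw [← Real.exp_sub]; congr 1; field_simp; ring
  have h2 := Real.quadratic_le_exp_of_nonneg (x := a ^ 2 / (4 * R)) (by positivity)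
  have h3 : 1 + a ^ 4 / (32 * R ^ 2) ≤ exp (a ^ 2 / (4 * R)) := by
    refine le_trans ?_ h2
    have : 0 ≤ a ^ 2 / (4 * R) := by positivity
    have e : (a ^ 2 / (4 * R)) ^ 2 / 2 = a ^ 4 / (32 * R ^ 2) := by field_simp; ring
    rw [e]; linarith
  have h4 : (1 + a) ^ 3 ≤ 8 * (1 + a ^ 4) := by
    nlinarith [sq_nonneg (a - 1), sq_nonneg (a ^ 2 - 1), mul_nonneg ha (sq_nonneg (a-1)), sq_nonneg (a*(a-1)), sq_nonneg (a^2 - a)]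
  have h5 : 1 + a ^ 4 ≤ (1 + 32 * R ^ 2) * (1 + a ^ 4 / (32 * R ^ 2)) := by
    have : (1 + 32 * R ^ 2) * (1 + a ^ 4 / (32 * R ^ 2)) = 1 + a ^ 4 + (32 * R ^ 2 + a ^ 4 / (32 * R ^ 2)) := by
      field_simp; ring
    rw [this]
    have : 0 ≤ 32 * R ^ 2 + a ^ 4 / (32 * R ^ 2) := by positivity
    linarith
  have h6 : (1 + a) ^ 3 ≤ 8 * (1 + 32 * R ^ 2) * exp (a ^ 2 / (4 * R)) := by
    have := mul_le_mul_of_nonneg_left h3 (by positivity : (0:ℝ) ≤ 1 + 32 * R ^ 2)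
    nlinarith
  rw [h1, mul_div_assoc', div_le_iff₀ (exp_pos _)]
  have := mul_le_mul_of_nonneg_right h6 (exp_pos (-a ^ 2 / (4 * R))).le
  nlinarith

lemma Gk_le {N : ℕ} {ε R r : ℝ} (hε : 0 < ε) (h1 : ε ≤ r) (h2 : r ≤ R) (x : Evec N) :
    Gk r x ≤ (2 * π * ε) ^ (-(N : ℝ) / 2) * exp (-‖x‖ ^ 2 / (2 * R)) := by
  unfold Gk
  have hr : 0 < r := by linarith
  apply mul_le_mul
  · apply Real.rpow_le_rpow_of_nonpos (by positivity) (by gcongr)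
    have : (0:ℝ) ≤ N := by positivity
    linarith
  · apply exp_le_exp.2
    rw [neg_div, neg_div]; gcongr
  · positivity
  · positivity

lemma measurable_Gk {N : ℕ} : Measurable (Function.uncurry (Gk (N := N))) := by
  unfold Gk Function.uncurry; fun_prop

lemma KB_of {N : ℕ} (P : ℝ → Evec N → ℝ) (hP : Measurable (Function.uncurry P))
    (h : ∀ ε : ℝ, 0 < ε → ∃ C : ℝ, 0 ≤ C ∧ ∀ r, ε ≤ r → ∀ x, |P r x| ≤ C * (1 + ‖x‖) ^ 3) :
    KB (fun r x => P r x * Gk r x) := by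
  refine ⟨hP.mul measurable_Gk, fun ε R h1 h2 => ?_⟩
  obtain ⟨C, hC0, hC⟩ := h ε h1
  have hR : 0 < R := by linarith
  refine ⟨C * (2 * π * ε) ^ (-(N : ℝ) / 2) * (8 * (1 + 32 * R ^ 2)), by positivity, fun r hr x => ?_⟩
  rw [abs_mul, abs_of_nonneg (Gk_nonneg (h1.le.trans hr.1) x)]
  calc |P r x| * Gk r x ≤ (C * (1 + ‖x‖) ^ 3) * ((2 * π * ε) ^ (-(N : ℝ) / 2) * exp (-‖x‖ ^ 2 / (2 * R))) :=
        mul_le_mul (hC r hr.1 x) (Gk_le h1 hr.1 hr.2 x) (Gk_nonneg (h1.le.trans hr.1) x) (by positivity)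
    _ = C * (2 * π * ε) ^ (-(N : ℝ) / 2) * ((1 + ‖x‖) ^ 3 * exp (-‖x‖ ^ 2 / (2 * R))) := by ring
    _ ≤ C * (2 * π * ε) ^ (-(N : ℝ) / 2) * ((8 * (1 + 32 * R ^ 2)) * exp (-‖x‖ ^ 2 / (4 * R))) := by
        gcongr ?_ * ?_
        exact poly_exp_bound hR (norm_nonneg x)
    _ = _ := by ring

lemma abs_coord_le {N : ℕ} (x : Evec N) (i : Fin N) : |x i| ≤ ‖x‖ := by
  simpa using PiLp.norm_apply_le x i

lemma KB_Gk {N : ℕ} : KB (Gk (N := N)) := by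
  have := KB_of (N := N) (fun _ _ => 1) (by simp [Function.uncurry_def])
    (fun ε h => ⟨1, zero_le_one, fun r _ x => by
      simp only [abs_one, one_mul]
      exact one_le_pow₀ (by linarith [norm_nonneg x])⟩)
  simpa using this

lemma KB_G1 {N : ℕ} (i : Fin N) : KB (G1 i) := by
  refine KB_of (N := N) (fun r x => -(x i / r)) (by unfold Function.uncurry; fun_prop)
    (fun ε h => ⟨1 / ε, by positivity, fun r hr x => ?_⟩)
  have hr0 : 0 < r := by linarith
  rw [abs_neg, abs_div, abs_of_pos hr0, div_eq_mul_one_div, mul_comm]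
  have hx := norm_nonneg x
  gcongr
  refine (abs_coord_le x i).trans ?_
  nlinarith [pow_nonneg hx 3, pow_nonneg hx 2]

lemma KB_G2 {N : ℕ} (i j : Fin N) : KB (G2 i j) := by
  refine KB_of (N := N) (fun r x => x i * x j / r ^ 2 - dlt i j / r) (by unfold Function.uncurry; fun_prop)
    (fun ε h => ⟨1 / ε ^ 2 + 1 / ε, by positivity, fun r hr x => ?_⟩)
  have hr0 : 0 < r := by linarith
  have hx := norm_nonneg x
  have e1 : |x i * x j / r ^ 2| ≤ 1 / ε ^ 2 * (1 + ‖x‖) ^ 3 := by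
    rw [abs_div, abs_of_pos (by positivity : 0 < r ^ 2), div_eq_mul_one_div, mul_comm, abs_mul]
    gcongr
    have := mul_le_mul (abs_coord_le x i) (abs_coord_le x j) (abs_nonneg _) hx
    nlinarith [pow_nonneg hx 3, pow_nonneg hx 2]
  have e2 : |dlt i j / r| ≤ 1 / ε * (1 + ‖x‖) ^ 3 := by
    rw [abs_div, abs_of_pos hr0, div_eq_mul_one_div, mul_comm]
    gcongr
    refine (abs_dlt_le i j).trans (one_le_pow₀ (by linarith))
  calc _ ≤ |x i * x j / r ^ 2| + |dlt i j / r| := abs_sub _ _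
    _ ≤ _ := by rw [add_mul]; exact add_le_add e1 e2

lemma KB_G3 {N : ℕ} (i j : Fin N) : KB (G3 i j) := by
  refine KB_of (N := N) (fun r x => (x j + 2 * dlt i j * x i) / r ^ 2 - x i ^ 2 * x j / r ^ 3)
    (by unfold Function.uncurry; fun_prop)
    (fun ε h => ⟨1 / ε ^ 2 + 1 / ε ^ 3, by positivity, fun r hr x => ?_⟩)
  have hr0 : 0 < r := by linarith
  have hx := norm_nonneg x
  have e1 : |(x j + 2 * dlt i j * x i) / r ^ 2| ≤ 1 / ε ^ 2 * (1 + ‖x‖) ^ 3 := by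
    rw [abs_div, abs_of_pos (by positivity : 0 < r ^ 2), div_eq_mul_one_div, mul_comm]
    gcongr
    have h1 : |2 * dlt i j * x i| ≤ 2 * ‖x‖ := by
      rw [abs_mul, abs_mul, abs_two]
      have := mul_le_mul (abs_dlt_le i j) (abs_coord_le x i) (abs_nonneg _) zero_le_one
      nlinarith
    have h2 := abs_add_le (x j) (2 * dlt i j * x i)
    have h3 := abs_coord_le x j
    nlinarith [pow_nonneg hx 3, pow_nonneg hx 2]
  have e2 : |x i ^ 2 * x j / r ^ 3| ≤ 1 / ε ^ 3 * (1 + ‖x‖) ^ 3 := by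
    rw [abs_div, abs_of_pos (by positivity : 0 < r ^ 3), div_eq_mul_one_div, mul_comm, abs_mul, abs_pow]
    gcongr
    have h1 := pow_le_pow_left₀ (abs_nonneg _) (abs_coord_le x i) 2
    have := mul_le_mul h1 (abs_coord_le x j) (abs_nonneg _) (by positivity)
    nlinarith [pow_nonneg hx 3, pow_nonneg hx 2]
  calc _ ≤ |(x j + 2 * dlt i j * x i) / r ^ 2| + |x i ^ 2 * x j / r ^ 3| := abs_sub _ _
    _ ≤ _ := by rw [add_mul]; exact add_le_add e1 e2

lemma integrable_gauss {N : ℕ} {b : ℝ} (hb : 0 < b) : Integrable (fun x : Evec N => exp (-‖x‖ ^ 2 / b)) := by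
  by_contra h
  have h1 := integral_undef h
  have h2 := GaussianFourier.integral_rexp_neg_mul_sq_norm (V := Evec N) (b := 1 / b) (by positivity)
  have : (fun x : Evec N => exp (-(1 / b) * ‖x‖ ^ 2)) = fun x : Evec N => exp (-‖x‖ ^ 2 / b) := by
    ext x; congr 1; ring
  rw [this, h1] at h2
  have : 0 < (π / (1 / b)) ^ ((Module.finrank ℝ (Evec N) : ℝ) / 2) := by positivity
  linarith

lemma integrable_KB {N : ℕ} {K : ℝ → Evec N → ℝ} (hK : KB K) {r : ℝ} (hr : 0 < r) :
    Integrable (K r) := by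
  obtain ⟨C, hC0, hC⟩ := hK.2 r r hr le_rfl
  exact ((integrable_gauss (by positivity : 0 < 4 * r)).const_mul C).mono'
    (hK.1.comp measurable_prodMk_left).aestronglyMeasurable
    (ae_of_all _ fun x => hC r ⟨le_rfl, le_rfl⟩ x)

lemma integral_Gk {N : ℕ} {r : ℝ} (hr : 0 < r) : ∫ x : Evec N, Gk r x = 1 := by
  unfold Gk
  rw [integral_const_mul]
  have h2 := GaussianFourier.integral_rexp_neg_mul_sq_norm (V := Evec N) (b := 1 / (2 * r)) (by positivity)
  have : (fun x : Evec N => exp (-(1 / (2 * r)) * ‖x‖ ^ 2)) = fun x : Evec N => exp (-‖x‖ ^ 2 / (2 * r)) := by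
    ext x; congr 1; ring
  rw [this] at h2
  rw [h2]
  have e : π / (1 / (2 * r)) = 2 * π * r := by field_simp
  rw [e, finrank_euclideanSpace_fin, ← Real.rpow_add (by positivity)]
  have : -(N:ℝ) / 2 + N / 2 = 0 := by ring
  rw [this, Real.rpow_zero]

lemma Gk_sqrt {N : ℕ} {r : ℝ} (hr : 0 < r) (x : Evec N) :
    Gk r (√r • x) = (√r ^ N)⁻¹ * Gk 1 x := by
  unfold Gk
  have hs : 0 < √r := Real.sqrt_pos.2 hr
  rw [norm_smul, mul_pow, Real.norm_of_nonneg hs.le, Real.sq_sqrt hr.le]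
  have e1 : -(r * ‖x‖ ^ 2) / (2 * r) = -‖x‖ ^ 2 / (2 * 1) := by field_simp
  rw [e1, Real.mul_rpow (by positivity) hr.le, mul_one]
  have e2 : r ^ (-(N:ℝ) / 2) = (√r ^ N)⁻¹ := by
    rw [Real.sqrt_eq_rpow, ← Real.rpow_natCast, ← Real.rpow_mul hr.le, ← Real.rpow_neg hr.le]
    congr 1; ring
  rw [e2]; ring

lemma integral_Gk_scale {N : ℕ} {r : ℝ} (hr : 0 < r) (h : Evec N → ℝ) :
    ∫ x, Gk r x * h x = ∫ x, Gk 1 x * h (√r • x) := by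
  have hs : 0 < √r := Real.sqrt_pos.2 hr
  have := Measure.integral_comp_smul (volume : Measure (Evec N)) (fun x => Gk r x * h x) (√r)
  simp only [Gk_sqrt hr, finrank_euclideanSpace_fin, mul_assoc] at this
  rw [integral_const_mul, abs_of_pos (by positivity), smul_eq_mul] at this
  exact (mul_left_cancel₀ (by positivity) this).symm

section Pot
set_option linter.unusedSectionVars false
variable {N : ℕ} {α : Type*} [MeasurableSpace α]

def PotI (K : ℝ → Evec N → ℝ) (ε : ℝ) (s : α → ℝ) (z : α → Evec N) (ρ : α → ℝ)
    (t : ℝ) (y : Evec N) (a : α) : ℝ :=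
  if s a ≤ t then K (ε + exp (2 * t) - exp (2 * s a)) (y - z a) * ρ a else 0

def Pot (K : ℝ → Evec N → ℝ) (ε : ℝ) (μ : Measure α) (s : α → ℝ) (z : α → Evec N) (ρ : α → ℝ)
    (t : ℝ) (y : Evec N) : ℝ := ∫ a, PotI K ε s z ρ t y a ∂μ

variable {K K' : ℝ → Evec N → ℝ} {ε T : ℝ} {μ : Measure α} {s : α → ℝ}
  {z : α → Evec N} {ρ : α → ℝ}

lemma PotI_meas {β : Type*} [MeasurableSpace β] (hK : KB K) (hs : Measurable s) (hz : Measurable z) (hρ : Measurable ρ)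
    {f : β → ℝ} {g : β → Evec N} {h : β → α} (hf : Measurable f) (hg : Measurable g) (hh : Measurable h) :
    Measurable (fun b => PotI K ε s z ρ (f b) (g b) (h b)) := by
  unfold PotI
  refine Measurable.ite (measurableSet_le (hs.comp hh) hf) ?_ measurable_const
  refine Measurable.mul ?_ (hρ.comp hh)
  have : Measurable (fun b => (ε + exp (2 * f b) - exp (2 * s (h b)), g b - z (h b))) := by
    refine Measurable.prodMk ?_ (hg.sub (hz.comp hh))
    have := hs.comp hh
    simp only [Function.comp_def] at this
    fun_prop
  exact hK.1.comp this

lemma PotI_bound (hK : KB K) (hε : 0 < ε) (T : ℝ) :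
    ∃ C, 0 ≤ C ∧ ∀ t ∈ Set.Icc 0 T, ∀ y, ∀ a, |PotI K ε s z ρ t y a| ≤
      C * exp (-‖y - z a‖ ^ 2 / (4 * (ε + exp (2 * T)))) * |ρ a| := by
  obtain ⟨C, hC0, hC⟩ := hK.2 ε (ε + exp (2 * T)) hε (by linarith [exp_pos (2 * T)])
  refine ⟨C, hC0, fun t ht y a => ?_⟩
  unfold PotI
  split_ifs with h
  · rw [abs_mul]
    refine mul_le_mul_of_nonneg_right (hC _ ⟨?_, ?_⟩ _) (abs_nonneg _)
    · have := exp_le_exp.2 (by linarith : 2 * s a ≤ 2 * t); linarith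
    · have := exp_le_exp.2 (by linarith [ht.2] : 2 * t ≤ 2 * T)
      linarith [exp_pos (2 * s a)]
  · simp only [abs_zero]; positivity

lemma PotI_bound' (hK : KB K) (hε : 0 < ε) (T : ℝ) :
    ∃ C, 0 ≤ C ∧ ∀ t ∈ Set.Icc 0 T, ∀ y, ∀ a, |PotI K ε s z ρ t y a| ≤ C * |ρ a| := by
  obtain ⟨C, hC0, hC⟩ := PotI_bound (s := s) (z := z) (ρ := ρ) hK hε T
  refine ⟨C, hC0, fun t ht y a => (hC t ht y a).trans ?_⟩
  have : exp (-‖y - z a‖ ^ 2 / (4 * (ε + exp (2 * T)))) ≤ 1 := by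
    rw [exp_le_one_iff, neg_div]
    have : 0 ≤ ‖y - z a‖ ^ 2 / (4 * (ε + exp (2 * T))) := by positivity
    linarith
  have h2 := mul_le_mul_of_nonneg_left this hC0
  rw [mul_one] at h2
  exact mul_le_mul_of_nonneg_right h2 (abs_nonneg _)

lemma PotI_integrable (hK : KB K) (hε : 0 < ε) (hs : Measurable s) (hz : Measurable z) (hρ : Measurable ρ)
    (hi : Integrable ρ μ) {t : ℝ} (ht : 0 ≤ t) (y : Evec N) :
    Integrable (PotI K ε s z ρ t y) μ := by
  obtain ⟨C, hC0, hC⟩ := PotI_bound' (s := s) (z := z) (ρ := ρ) hK hε t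
  exact (hi.abs.const_mul C).mono' (PotI_meas hK hs hz hρ measurable_const measurable_const measurable_id).aestronglyMeasurable
    (ae_of_all _ fun a => hC t ⟨ht, le_rfl⟩ y a)

lemma Pot_nice [SFinite μ] (hK : KB K) (hε : 0 < ε) (hs : Measurable s) (hz : Measurable z) (hρ : Measurable ρ)
    (hi : Integrable ρ μ) : Nice T (Pot K ε μ s z ρ) := by
  obtain ⟨C, hC0, hC⟩ := PotI_bound (s := s) (z := z) (ρ := ρ) hK hε T
  obtain ⟨C', hC0', hC'⟩ := PotI_bound' (s := s) (z := z) (ρ := ρ) hK hε T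
  set b := 4 * (ε + exp (2 * T)) with hb
  have hb0 : 0 < b := by positivity
  have hg := integrable_gauss (N := N) hb0
  set A := ∫ x : Evec N, exp (-‖x‖ ^ 2 / b) with hA
  have hA0 : 0 ≤ A := integral_nonneg fun x => (exp_pos _).le
  have hρ0 : 0 ≤ ∫ a, |ρ a| ∂μ := integral_nonneg fun x => abs_nonneg _
  refine ⟨?_, C' * (∫ a, |ρ a| ∂μ) + C * A * ∫ a, |ρ a| ∂μ, by positivity, fun t ht => ⟨fun y => ?_, ?_⟩⟩
  · have hm : Measurable (fun p : (ℝ × Evec N) × α => PotI K ε s z ρ p.1.1 p.1.2 p.2) :=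
      PotI_meas hK hs hz hρ (by fun_prop) (by fun_prop) (by fun_prop)
    exact (hm.stronglyMeasurable.integral_prod_right (ν := μ)).measurable
  · have h1 : |Pot K ε μ s z ρ t y| ≤ ∫ a, C' * |ρ a| ∂μ := by
      rw [← Real.norm_eq_abs]
      exact norm_integral_le_of_norm_le (hi.abs.const_mul C') (ae_of_all _ fun a => hC' t ht y a)
    rw [integral_const_mul] at h1
    have : 0 ≤ C * A * ∫ a, |ρ a| ∂μ := by positivity
    linarith
  · have hmaj : Integrable (fun p : α × Evec N => |ρ p.1| * (C * exp (-‖p.2 - z p.1‖ ^ 2 / b))) (μ.prod volume) := by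
      rw [integrable_prod_iff]
      · constructor
        · refine ae_of_all _ fun a => ?_
          exact ((hg.comp_sub_right (z a)).const_mul C).const_mul (|ρ a|)
        · have : (fun a => ∫ y, ‖|ρ a| * (C * exp (-‖y - z a‖ ^ 2 / b))‖) = fun a => |ρ a| * (C * A) := by
            ext a
            have : ∀ y, ‖|ρ a| * (C * exp (-‖y - z a‖ ^ 2 / b))‖ = |ρ a| * (C * exp (-‖y - z a‖ ^ 2 / b)) :=
              fun y => Real.norm_of_nonneg (by positivity)
            simp_rw [this]
            rw [integral_const_mul, integral_const_mul,
              integral_sub_right_eq_self (fun x : Evec N => exp (-‖x‖ ^ 2 / b))]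
          simp only [this]
          exact hi.abs.mul_const _
      · apply Measurable.aestronglyMeasurable
        have h1 : Measurable (fun p : α × Evec N => z p.1) := hz.comp measurable_fst
        have h2 : Measurable (fun p : α × Evec N => ρ p.1) := hρ.comp measurable_fst
        fun_prop
    have hint : Integrable (fun p : α × Evec N => PotI K ε s z ρ t p.2 p.1) (μ.prod volume) := by
      refine hmaj.mono' (PotI_meas hK hs hz hρ measurable_const measurable_snd measurable_fst).aestronglyMeasurable
        (ae_of_all _ fun p => ?_)
      refine (hC t ht p.2 p.1).trans (le_of_eq ?_)
      ring
    have hPi : Integrable (Pot K ε μ s z ρ t) := hint.integral_prod_right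
    refine ⟨hPi, ?_⟩
    have h1 : ∫ y, |Pot K ε μ s z ρ t y| ≤ ∫ y, ∫ a, |ρ a| * (C * exp (-‖y - z a‖ ^ 2 / b)) ∂μ := by
      refine integral_mono_ae hPi.abs hmaj.integral_prod_right ?_
      filter_upwards [hmaj.prod_left_ae] with y hy
      rw [← Real.norm_eq_abs]
      refine norm_integral_le_of_norm_le (g := fun a => |ρ a| * (C * exp (-‖y - z a‖ ^ 2 / b))) hy
        (ae_of_all _ fun a => ?_)
      refine (hC t ht y a).trans (le_of_eq ?_)
      ring
    rw [← integral_integral_swap hmaj] at h1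
    have h2 : ∀ a, ∫ y, |ρ a| * (C * exp (-‖y - z a‖ ^ 2 / b)) = |ρ a| * (C * A) := fun a => by
      rw [integral_const_mul, integral_const_mul,
        integral_sub_right_eq_self (fun x : Evec N => exp (-‖x‖ ^ 2 / b))]
    simp_rw [h2] at h1
    rw [integral_mul_const] at h1
    have : 0 ≤ C' * (∫ a, |ρ a| ∂μ) := by positivity
    linarith

lemma Pot_line (v : Evec N) (hK : KB K) (hK' : KB K') (hε : 0 < ε) (hs : Measurable s)
    (hz : Measurable z) (hρ : Measurable ρ) (hi : Integrable ρ μ)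
    (h : ∀ r x, HasLineDerivAt ℝ (K r) (K' r x) x v) {t : ℝ} (ht : 0 ≤ t) (y : Evec N) :
    HasLineDerivAt ℝ (Pot K ε μ s z ρ t) (Pot K' ε μ s z ρ t y) y v := by
  obtain ⟨C, hC0, hC⟩ := PotI_bound' (s := s) (z := z) (ρ := ρ) hK' hε t
  unfold HasLineDerivAt Pot
  have := hasDerivAt_integral_of_dominated_loc_of_deriv_le (μ := μ) (x₀ := (0:ℝ)) (s := Set.univ)
    (F := fun x a => PotI K ε s z ρ t (y + x • v) a) (F' := fun x a => PotI K' ε s z ρ t (y + x • v) a)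
    (bound := fun a => C * |ρ a|) Filter.univ_mem
    (Eventually.of_forall fun x => (PotI_integrable hK hε hs hz hρ hi ht _).aestronglyMeasurable)
    (PotI_integrable hK hε hs hz hρ hi ht _) (PotI_integrable hK' hε hs hz hρ hi ht _).aestronglyMeasurable
    (ae_of_all _ fun a x _ => hC t ⟨ht, le_rfl⟩ _ a) (hi.abs.const_mul C)
    (ae_of_all _ fun a x _ => ?_)
  · simpa using this.2
  · unfold PotI
    split_ifs with hsa
    · have h1 := h (ε + exp (2 * t) - exp (2 * s a)) (y + x • v - z a)
      unfold HasLineDerivAt at h1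
      have h2 := HasDerivAt.scomp_of_eq x h1 ((hasDerivAt_id x).sub_const x) (by simp)
      rw [one_smul] at h2
      refine HasDerivAt.mul_const ?_ _
      have e : (fun x' : ℝ => K (ε + exp (2 * t) - exp (2 * s a)) (y + x' • v - z a)) =
          ((fun τ : ℝ => K (ε + exp (2 * t) - exp (2 * s a)) (y + x • v - z a + τ • v)) ∘ fun x' => id x' - x) := by
        ext τ
        simp only [Function.comp, id]
        congr 1
        module
      rw [e]
      exact h2
    · exact hasDerivAt_const _ _

lemma Pot_time [SFinite μ] (hK : KB K) (hK' : KB K') (hε : 0 < ε) (hs : Measurable s)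
    (hs0 : ∀ᵐ a ∂μ, 0 ≤ s a)
    (hz : Measurable z) (hρ : Measurable ρ) (hi : Integrable ρ μ)
    (h : ∀ r, 0 < r → ∀ x, HasDerivAt (fun r => K r x) (K' r x) r) {t : ℝ} (ht : 0 ≤ t) (y : Evec N) :
    Pot K ε μ s z ρ t y = (∫ a, (if s a ≤ t then K ε (y - z a) * ρ a else 0) ∂μ) +
      ∫ σ in (0:ℝ)..t, 2 * exp (2 * σ) * Pot K' ε μ s z ρ σ y := by
  obtain ⟨C, hC0, hC⟩ := PotI_bound' (s := s) (z := z) (ρ := ρ) hK' hε t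
  set H : α → ℝ → ℝ := fun a σ => 2 * exp (2 * σ) * PotI K' ε s z ρ σ y a with hH
  have hHm : Measurable (Function.uncurry H) := by
    have := PotI_meas (ε := ε) hK' hs hz hρ (f := fun p : α × ℝ => p.2) (g := fun _ => y) (h := fun p => p.1)
      measurable_snd measurable_const measurable_fst
    simp only [hH, Function.uncurry_def]
    fun_prop
  have hHb : ∀ σ ∈ Set.Icc 0 t, ∀ a, |H a σ| ≤ 2 * exp (2 * t) * C * |ρ a| := by
    intro σ hσ a
    simp only [hH]
    rw [abs_mul, abs_of_pos (by positivity : 0 < 2 * exp (2 * σ)), mul_assoc (2 * exp (2 * t))]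
    refine mul_le_mul ?_ (hC σ hσ y a) (abs_nonneg _) (by positivity)
    have := exp_le_exp.2 (by linarith [hσ.2] : 2 * σ ≤ 2 * t)
    linarith
  have hHi : Integrable (Function.uncurry H) (μ.prod (volume.restrict (Set.Ioc 0 t))) := by
    have hmaj : Integrable (fun p : α × ℝ => (2 * exp (2 * t) * C * |ρ p.1|) * (1:ℝ)) (μ.prod (volume.restrict (Set.Ioc 0 t))) := by
      exact (hi.abs.const_mul _).mul_prod (integrable_const (1:ℝ))
    refine hmaj.mono' hHm.aestronglyMeasurable ?_
    have h1 : ∀ᵐ p : α × ℝ ∂(μ.prod (volume.restrict (Set.Ioc 0 t))), p.2 ∈ Set.Ioc 0 t := by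
      have h3 : ∀ᵐ σ ∂(volume.restrict (Set.Ioc 0 t)), σ ∈ Set.Ioc 0 t := ae_restrict_mem measurableSet_Ioc
      exact Measure.quasiMeasurePreserving_snd.ae h3
    filter_upwards [h1] with p hp
    rw [mul_one]
    exact hHb p.2 ⟨hp.1.le, hp.2⟩ p.1
  have e1 : ∫ σ in (0:ℝ)..t, 2 * exp (2 * σ) * Pot K' ε μ s z ρ σ y = ∫ a, (∫ σ in Set.Ioc 0 t, H a σ) ∂μ := by
    rw [intervalIntegral.integral_of_le ht, integral_integral_swap hHi]
    simp only [hH, Pot]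
    congr 1; ext σ; rw [integral_const_mul]
  have hm0 : Measurable (fun a => K ε (y - z a)) := by
    exact hK.1.comp (measurable_const.prodMk (measurable_const.sub hz))
  have hi0 : Integrable (fun a => if s a ≤ t then K ε (y - z a) * ρ a else 0) μ := by
    obtain ⟨C2, hC02, hC2⟩ := hK.2 ε ε hε le_rfl
    refine (hi.abs.const_mul C2).mono' (Measurable.ite (measurableSet_le hs measurable_const) (hm0.mul hρ) measurable_const).aestronglyMeasurable (ae_of_all _ fun a => ?_)
    split_ifs
    · rw [Real.norm_eq_abs, abs_mul]
      refine mul_le_mul_of_nonneg_right ((hC2 ε ⟨le_rfl, le_rfl⟩ _).trans ?_) (abs_nonneg _)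
      have : exp (-‖y - z a‖ ^ 2 / (4 * ε)) ≤ 1 := by
        rw [exp_le_one_iff, neg_div]
        have : 0 ≤ ‖y - z a‖ ^ 2 / (4 * ε) := by positivity
        linarith
      nlinarith
    · simp only [norm_zero]; positivity
  have hHi2 : Integrable (fun a => ∫ σ in Set.Ioc 0 t, H a σ) μ := hHi.integral_prod_left
  rw [e1, ← integral_add hi0 hHi2]
  unfold Pot
  apply integral_congr_ae
  filter_upwards [hs0] with a ha
  by_cases hsa : s a ≤ t
  · have e2 : ∫ σ in Set.Ioc 0 t, H a σ = ∫ σ in (s a)..t, 2 * exp (2 * σ) * (K' (ε + exp (2 * σ) - exp (2 * s a)) (y - z a) * ρ a) := by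
      rw [intervalIntegral.integral_of_le hsa]
      have : Set.Ioc (s a) t ⊆ Set.Ioc 0 t := Set.Ioc_subset_Ioc_left ha
      rw [← integral_Icc_eq_integral_Ioc, ← integral_Icc_eq_integral_Ioc,
        ← integral_indicator measurableSet_Icc, ← integral_indicator measurableSet_Icc]
      congr 1; ext σ
      simp only [Set.indicator, hH, PotI, Set.mem_Icc]
      by_cases h1 : s a ≤ σ
      · have h2 : 0 ≤ σ := ha.trans h1
        simp [h1, h2]
      · simp [h1]
    have hd : ∀ σ ∈ Set.uIcc (s a) t, HasDerivAt (fun σ => K (ε + exp (2 * σ) - exp (2 * s a)) (y - z a) * ρ a)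
        (2 * exp (2 * σ) * (K' (ε + exp (2 * σ) - exp (2 * s a)) (y - z a) * ρ a)) σ := by
      intro σ hσ
      rw [Set.uIcc_of_le hsa] at hσ
      have hpos : 0 < ε + exp (2 * σ) - exp (2 * s a) := by
        have := exp_le_exp.2 (by linarith [hσ.1] : 2 * s a ≤ 2 * σ); linarith
      have h1 : HasDerivAt (fun σ : ℝ => ε + exp (2 * σ) - exp (2 * s a)) (2 * exp (2 * σ)) σ := by
        have := (((hasDerivAt_id σ).const_mul 2).exp.const_add ε).sub_const (exp (2 * s a))
        refine this.congr_deriv ?_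
        simp; ring
      have := (HasDerivAt.comp σ (h _ hpos (y - z a)) h1).mul_const (ρ a)
      refine this.congr_deriv (by ring)
    have e3 := intervalIntegral.integral_eq_sub_of_hasDerivAt hd ?_
    · rw [e2, e3]
      simp only [PotI, if_pos hsa]
      ring_nf
    · rw [intervalIntegrable_iff_integrableOn_Ioc_of_le hsa]
      refine Measure.integrableOn_of_bounded (M := 2 * exp (2 * t) * C * |ρ a|) (by simp) ?_ ?_
      · apply Measurable.aestronglyMeasurable
        have : Measurable (fun σ : ℝ => K' (ε + exp (2 * σ) - exp (2 * s a)) (y - z a)) :=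
          hK'.1.comp ((by fun_prop : Measurable fun σ : ℝ => ε + exp (2 * σ) - exp (2 * s a)).prodMk measurable_const)
        exact (by fun_prop : Measurable fun x : ℝ => 2 * exp (2 * x)).mul (this.mul_const _)
      · filter_upwards [ae_restrict_mem measurableSet_Ioc] with σ hσ
        have := hHb σ ⟨ha.trans hσ.1.le, hσ.2⟩ a
        simpa [hH, PotI, hσ.1.le] using this
  · have : ∀ σ ∈ Set.Ioc 0 t, H a σ = 0 := by
      intro σ hσ
      have : ¬ s a ≤ σ := fun h => hsa (h.trans hσ.2)
      simp [hH, PotI, this]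
    rw [setIntegral_congr_fun measurableSet_Ioc this]
    simp [PotI, hsa]

end Pot

section Conv
variable {N : ℕ}

lemma conv_L1 {K0 ρ : Evec N → ℝ} (hK : Integrable K0) (hρ : Integrable ρ) :
    Integrable (fun y => ∫ z, K0 (y - z) * ρ z) ∧
    ∫ y, |∫ z, K0 (y - z) * ρ z| ≤ (∫ x, |K0 x|) * ∫ z, |ρ z| := by
  have h1 := hρ.integrable_convolution (ContinuousLinearMap.mul ℝ ℝ) hK
  have h2 := hρ.abs.integrable_convolution (ContinuousLinearMap.mul ℝ ℝ) hK.abs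
  have h3 := integral_convolution (ContinuousLinearMap.mul ℝ ℝ) hρ.abs hK.abs (μ := volume) (ν := volume)
  have e1 : (convolution ρ K0 (ContinuousLinearMap.mul ℝ ℝ) volume) = fun y => ∫ z, K0 (y - z) * ρ z := by
    ext y; simp only [convolution, ContinuousLinearMap.mul_apply']; congr 1; ext z; ring
  rw [e1] at h1
  refine ⟨h1, ?_⟩
  simp only [ContinuousLinearMap.mul_apply'] at h3
  rw [mul_comm, ← h3]
  refine integral_mono h1.abs h2 fun y => ?_
  simp only [convolution, ContinuousLinearMap.mul_apply']
  refine (abs_integral_le_integral_abs).trans (le_of_eq ?_)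
  congr 1; ext z; rw [abs_mul, mul_comm]

def Cv (K0 : Evec N → ℝ) (ρ : ℝ → Evec N → ℝ) (t : ℝ) (y : Evec N) : ℝ := ∫ z, K0 (y - z) * ρ t z

lemma Cv_eq_Pot (K : ℝ → Evec N → ℝ) (ε : ℝ) (ρ : ℝ → Evec N → ℝ) (t : ℝ) :
    Cv (K ε) ρ t = Pot K ε volume (fun _ => t) id (ρ t) t := by
  ext y; simp [Cv, Pot, PotI]

lemma Cv_nice {K : ℝ → Evec N → ℝ} (hK : KB K) {ε T C1 : ℝ} (hε : 0 < ε) {ρ : ℝ → Evec N → ℝ}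
    (hρ : Measurable (Function.uncurry ρ)) (hi : ∀ t, Integrable (ρ t)) (hC1 : ∀ t, ∫ z, |ρ t z| ≤ C1) :
    Nice T (Cv (K ε) ρ) := by
  obtain ⟨C, hC0, hC⟩ := hK.2 ε ε hε le_rfl
  have hKb : ∀ x, |K ε x| ≤ C := fun x => by
    refine (hC ε ⟨le_rfl, le_rfl⟩ x).trans ?_
    have : exp (-‖x‖ ^ 2 / (4 * ε)) ≤ 1 := by
      rw [exp_le_one_iff, neg_div]
      have : 0 ≤ ‖x‖ ^ 2 / (4 * ε) := by positivity
      linarith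
    nlinarith
  have hC10 : 0 ≤ C1 := (integral_nonneg fun x => abs_nonneg _).trans (hC1 0)
  have hKi := integrable_KB hK hε
  have hA0 : 0 ≤ ∫ x, |K ε x| := integral_nonneg fun x => abs_nonneg _
  refine ⟨?_, C * C1 + (∫ x, |K ε x|) * C1, by positivity, fun t _ => ⟨fun y => ?_, ?_⟩⟩
  · have hm : Measurable (fun p : (ℝ × Evec N) × Evec N => K ε (p.1.2 - p.2) * ρ p.1.1 p.2) := by
      refine Measurable.mul ?_ ?_
      · exact hK.1.comp (measurable_const.prodMk (by fun_prop))
      · exact hρ.comp (by fun_prop : Measurable fun p : (ℝ × Evec N) × Evec N => (p.1.1, p.2))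
    exact (hm.stronglyMeasurable.integral_prod_right (ν := volume)).measurable
  · have h1 : |Cv (K ε) ρ t y| ≤ ∫ a, C * |ρ t a| := by
      rw [← Real.norm_eq_abs]
      refine norm_integral_le_of_norm_le ((hi t).abs.const_mul C) (ae_of_all _ fun a => ?_)
      rw [Real.norm_eq_abs, abs_mul]
      exact mul_le_mul_of_nonneg_right (hKb _) (abs_nonneg _)
    rw [integral_const_mul] at h1
    have := mul_le_mul_of_nonneg_left (hC1 t) hC0
    have : 0 ≤ (∫ x, |K ε x|) * C1 := by positivity
    linarith
  · obtain ⟨h1, h2⟩ := conv_L1 hKi (hi t)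
    refine ⟨h1, h2.trans ?_⟩
    have := mul_le_mul_of_nonneg_left (hC1 t) hA0
    have : 0 ≤ C * C1 := by positivity
    linarith

end Conv

section Assemble
variable {N : ℕ}

def rho (q : ℝ → Evec N → ℝ) (j : Fin N) (s : ℝ) (z : Evec N) : ℝ := z j * q s z

def PA (K : ℝ → Evec N → ℝ) (ε : ℝ) (u0 : Evec N → ℝ) : ℝ → Evec N → ℝ :=
  Pot K ε volume (fun _ => 0) id u0

def PB (T : ℝ) (K : ℝ → Evec N → ℝ) (ε : ℝ) (q : ℝ → Evec N → ℝ) (j : Fin N) : ℝ → Evec N → ℝ :=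
  Pot K ε ((volume.restrict (Set.Ioc 0 T)).prod volume) Prod.fst Prod.snd (fun p => rho q j p.1 p.2)

def Um (T ε : ℝ) (u0 : Evec N → ℝ) (q : ℝ → Evec N → ℝ) (t : ℝ) (y : Evec N) : ℝ :=
  PA Gk ε u0 t y + ∑ j, PB T (G1 j) ε q j t y

lemma rho_meas {q : ℝ → Evec N → ℝ} (hq : Measurable (Function.uncurry q)) (j : Fin N) :
    Measurable (Function.uncurry (rho q j)) := by
  have h1 : Measurable (fun p : ℝ × Evec N => p.2 j) := by fun_prop
  exact h1.mul hq

lemma rho_le (q : ℝ → Evec N → ℝ) (j : Fin N) (s : ℝ) (z : Evec N) : |rho q j s z| ≤ ‖z‖ * |q s z| := by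
  unfold rho; rw [abs_mul]; exact mul_le_mul_of_nonneg_right (abs_coord_le z j) (abs_nonneg _)

lemma rho_int {q : ℝ → Evec N → ℝ} (hq : Measurable (Function.uncurry q)) {C1 : ℝ}
    (hi : ∀ s, Integrable (fun z => ‖z‖ * |q s z|)) (hC : ∀ s, ∫ z, ‖z‖ * |q s z| ≤ C1) (j : Fin N) (s : ℝ) :
    Integrable (rho q j s) ∧ ∫ z, |rho q j s z| ≤ C1 := by
  have h1 : Integrable (rho q j s) := (hi s).mono' ((rho_meas hq j).comp measurable_prodMk_left).aestronglyMeasurable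
    (ae_of_all _ fun z => rho_le q j s z)
  exact ⟨h1, (integral_mono h1.abs (hi s) fun z => rho_le q j s z).trans (hC s)⟩

lemma rho_int2 {q : ℝ → Evec N → ℝ} (hq : Measurable (Function.uncurry q)) {C1 : ℝ}
    (hi : ∀ s, Integrable (fun z => ‖z‖ * |q s z|)) (hC : ∀ s, ∫ z, ‖z‖ * |q s z| ≤ C1) (j : Fin N) (T : ℝ) :
    Integrable (fun p : ℝ × Evec N => rho q j p.1 p.2) ((volume.restrict (Set.Ioc 0 T)).prod volume) := by
  have hm : Measurable (fun p : ℝ × Evec N => rho q j p.1 p.2) := rho_meas hq j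
  rw [integrable_prod_iff hm.aestronglyMeasurable]
  refine ⟨ae_of_all _ fun s => (rho_int hq hi hC j s).1, ?_⟩
  refine Measure.integrableOn_of_bounded (M := C1) (by simp) ?_ (ae_of_all _ fun s => ?_)
  · exact ((rho_meas hq j).norm.stronglyMeasurable.integral_prod_right (ν := volume)).aestronglyMeasurable
  · rw [Real.norm_of_nonneg (integral_nonneg fun y => norm_nonneg _)]
    exact (rho_int hq hi hC j s).2

lemma Nice.ii {T : ℝ} {V : ℝ → Evec N → ℝ} (hV : Nice T V) (y : Evec N) {t : ℝ} (ht : t ∈ Set.Icc 0 T) :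
    IntervalIntegrable (fun σ => V σ y) volume 0 t := by
  obtain ⟨hm, C, hC0, hC⟩ := hV
  rw [intervalIntegrable_iff_integrableOn_Ioc_of_le ht.1]
  refine Measure.integrableOn_of_bounded (M := C) (by simp)
    (hm.comp measurable_prodMk_right).aestronglyMeasurable ?_
  filter_upwards [ae_restrict_mem measurableSet_Ioc] with s hs
  exact (hC s ⟨hs.1.le, hs.2.trans ht.2⟩).1 y

lemma Pot_half_sum {α : Type*} [MeasurableSpace α] {μ : Measure α} {ε : ℝ} {s : α → ℝ} {z : α → Evec N} {ρ : α → ℝ}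
    (K : Fin N → ℝ → Evec N → ℝ) (hK : ∀ i, KB (K i)) (hε : 0 < ε) (hs : Measurable s)
    (hz : Measurable z) (hρ : Measurable ρ) (hi : Integrable ρ μ) {t : ℝ} (ht : 0 ≤ t) (y : Evec N) :
    Pot (fun r x => (1 / 2) * ∑ i, K i r x) ε μ s z ρ t y = (1 / 2) * ∑ i, Pot (K i) ε μ s z ρ t y := by
  unfold Pot
  rw [← integral_finsetSum _ fun i _ => PotI_integrable (hK i) hε hs hz hρ hi ht y, ← integral_const_mul]
  congr 1; ext a
  simp only [PotI]
  split_ifs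
  · rw [← Finset.sum_mul]; ring
  · simp

lemma PB_zero {T ε : ℝ} {q : ℝ → Evec N → ℝ} {K : ℝ → Evec N → ℝ} (j : Fin N) (y : Evec N) :
    PB T K ε q j 0 y = 0 := by
  unfold PB Pot
  apply integral_eq_zero_of_ae
  have h3 : ∀ᵐ σ ∂(volume.restrict (Set.Ioc 0 T)), σ ∈ Set.Ioc 0 T := ae_restrict_mem measurableSet_Ioc
  have h4 := (Measure.quasiMeasurePreserving_fst (μ := volume.restrict (Set.Ioc 0 T)) (ν := (volume : Measure (Evec N)))).ae h3
  filter_upwards [h4] with p hp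
  simp [PotI, not_le.2 hp.1]

lemma Um_energy {T ε δ C1 : ℝ} (hT : 0 < T) (hε : 0 < ε) (hδ : 0 < δ)
    {u0 : Evec N → ℝ} {q : ℝ → Evec N → ℝ} (hu0m : Measurable u0) (hu0 : Integrable u0)
    (hq : Measurable (Function.uncurry q))
    (hi : ∀ s, Integrable (fun z => ‖z‖ * |q s z|)) (hC : ∀ s, ∫ z, ‖z‖ * |q s z| ≤ C1) :
    Nice T (Um T ε u0 q) ∧ (∀ i, Nice T (Cv (Gk ε) (rho q i))) ∧
    ∫ y, bt δ (Um T ε u0 q T y) ≤ (∫ y, |u0 y|) +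
      ∫ s in Set.Ioc 0 T, ∫ y, bt2 δ (Um T ε u0 q s y) * ((∑ i, Cv (Gk ε) (rho q i) s y ^ 2) / 4) := by
  have hAn : ∀ {K}, KB K → Nice T (PA K ε u0) := fun hK =>
    Pot_nice hK hε measurable_const measurable_id hu0m hu0
  have hρ := fun j => rho_int2 hq hi hC j T
  have hBn : ∀ {K}, KB K → ∀ j, Nice T (PB T K ε q j) := fun hK j =>
    Pot_nice hK hε measurable_fst measurable_snd (rho_meas hq j) (hρ j)
  have hCn : ∀ {K}, KB K → ∀ j, Nice T (Cv (K ε) (rho q j)) := fun hK j =>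
    Cv_nice hK hε (rho_meas hq j) (fun t => (rho_int hq hi hC j t).1) (fun t => (rho_int hq hi hC j t).2)
  have hUn : Nice T (Um T ε u0 q) := (hAn KB_Gk).add (Nice.sum _ fun j => hBn (KB_G1 j) j)
  refine ⟨hUn, hCn KB_Gk, ?_⟩
  have hAl : ∀ {K K'} (v : Evec N), KB K → KB K' → (∀ r x, HasLineDerivAt ℝ (K r) (K' r x) x v) →
      ∀ t ∈ Set.Icc 0 T, ∀ y, HasLineDerivAt ℝ (PA K ε u0 t) (PA K' ε u0 t y) y v :=
    fun v h1 h2 h3 t ht y => Pot_line v h1 h2 hε measurable_const measurable_id hu0m hu0 h3 ht.1 y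
  have hBl : ∀ {K K'} (v : Evec N) (j : Fin N), KB K → KB K' → (∀ r x, HasLineDerivAt ℝ (K r) (K' r x) x v) →
      ∀ t ∈ Set.Icc 0 T, ∀ y, HasLineDerivAt ℝ (PB T K ε q j t) (PB T K' ε q j t y) y v :=
    fun v j h1 h2 h3 t ht y => Pot_line v h1 h2 hε measurable_fst measurable_snd (rho_meas hq j) (hρ j) h3 ht.1 y
  have hadd : ∀ {f : Evec N → ℝ} {f' : ℝ} {g : Fin N → Evec N → ℝ} {g' : Fin N → ℝ} {y v : Evec N},
      HasLineDerivAt ℝ f f' y v → (∀ j, HasLineDerivAt ℝ (g j) (g' j) y v) →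
      HasLineDerivAt ℝ (fun y => f y + ∑ j, g j y) (f' + ∑ j, g' j) y v := by
    intro f f' g g' y v h1 h2
    unfold HasLineDerivAt at *
    exact h1.add (HasDerivAt.fun_sum fun j _ => h2 j)
  have key := energy hT hδ (Um T ε u0 q)
    (fun i t y => PA (G1 i) ε u0 t y + ∑ j, PB T (G2 i j) ε q j t y)
    (fun i t y => PA (G2 i i) ε u0 t y + ∑ j, PB T (G3 i j) ε q j t y)
    (fun i => Cv (Gk ε) (rho q i)) (fun i => Cv (G1 i ε) (rho q i)) hUn
    (fun i => (hAn (KB_G1 i)).add (Nice.sum _ fun j => hBn (KB_G2 i j) j))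
    (fun i => (hAn (KB_G2 i i)).add (Nice.sum _ fun j => hBn (KB_G3 i j) j))
    (hCn KB_Gk) (fun i => hCn (KB_G1 i) i)
    (fun i t ht y => hadd (hAl _ KB_Gk (KB_G1 i) (fun r x => Gk_line i x) t ht y)
      (fun j => hBl _ j (KB_G1 j) (KB_G2 i j) (fun r x => G1_line i j x) t ht y))
    (fun i t ht y => hadd (hAl _ (KB_G1 i) (KB_G2 i i) (fun r x => G1_line i i x) t ht y)
      (fun j => hBl _ j (KB_G2 i j) (KB_G3 i j) (fun r x => G2_line i j x) t ht y))
    (fun i t ht y => by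
      rw [Cv_eq_Pot, Cv_eq_Pot]
      exact Pot_line _ KB_Gk (KB_G1 i) hε measurable_const measurable_id
        ((rho_meas hq i).comp measurable_prodMk_left) (rho_int hq hi hC i t).1 (fun r x => Gk_line i x) ht.1 y)
    ?_
  · refine key.trans (add_le_add_left ?_ _)
    obtain ⟨hm, CU, hCU0, hCU⟩ := hUn
    have hU0 := hCU 0 ⟨le_rfl, hT.le⟩
    have hbti : Integrable (fun y => bt δ (Um T ε u0 q 0 y)) := by
      refine hU0.2.1.abs.mono' ((continuous_bt δ).measurable.comp (hm.comp measurable_prodMk_left)).aestronglyMeasurable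
        (ae_of_all _ fun y => ?_)
      rw [Real.norm_of_nonneg (bt_nonneg hδ _)]
      exact bt_le hδ _
    refine (integral_mono hbti hU0.2.1.abs fun y => bt_le hδ _).trans ?_
    have e : ∀ y, Um T ε u0 q 0 y = ∫ z, Gk ε (y - z) * u0 z := by
      intro y
      have e1 : PA Gk ε u0 0 y = ∫ z, Gk ε (y - z) * u0 z := by simp [PA, Pot, PotI]
      have e2 : ∀ j, PB T (G1 j) ε q j 0 y = 0 := fun j => PB_zero j y
      simp [Um, e1, e2]
    simp only [e]
    have := (conv_L1 (integrable_KB KB_Gk hε) hu0).2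
    have e2 : ∫ x : Evec N, |Gk ε x| = 1 := by
      rw [← integral_Gk hε (N := N)]
      congr 1; ext x; exact abs_of_nonneg (Gk_nonneg hε.le x)
    rwa [e2, one_mul] at this
  · intro t ht y
    have hP0 : ∀ j, PB T (G1 j) ε q j 0 y = 0 := fun j => PB_zero j y
    have hexpm : Measurable (Function.uncurry (fun (s:ℝ) (_:Evec N) => exp (2 * s))) := by
      simp only [Function.uncurry_def]; fun_prop
    have hexpb : ∀ t ∈ Set.Icc 0 T, ∀ _y : Evec N, |exp (2 * t)| ≤ exp (2 * T) := fun t ht y => by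
      rw [abs_of_pos (exp_pos _)]; exact exp_le_exp.2 (by linarith [ht.2])
    have hnA : Nice T (fun s y => exp (2 * s) * ∑ i, PA (G2 i i) ε u0 s y) :=
      Nice.mul_left (Nice.sum _ fun i => hAn (KB_G2 i i)) hexpm (exp_pos _).le hexpb
    have hnB : ∀ j, Nice T (fun s y => exp (2 * s) * ∑ i, PB T (G3 i j) ε q j s y) := fun j =>
      Nice.mul_left (Nice.sum _ fun i => hBn (KB_G3 i j) j) hexpm (exp_pos _).le hexpb
    have hA : PA Gk ε u0 t y = PA Gk ε u0 0 y + ∫ s in (0:ℝ)..t, exp (2 * s) * ∑ i, PA (G2 i i) ε u0 s y := by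
      have h1 := Pot_time (K := Gk (N := N)) (K' := fun r x => (1 / 2) * ∑ i, G2 i i r x) (μ := volume) (s := fun _ => 0) (z := id) (ρ := u0)
        KB_Gk (KB.const_mul _ (KB.sum _ fun i => KB_G2 i i)) hε measurable_const (ae_of_all _ fun _ => le_rfl) measurable_id hu0m hu0
        (fun r hr x => Gk_r hr x) ht.1 y
      have h2 : PA Gk ε u0 0 y = ∫ a, (if (0:ℝ) ≤ t then Gk ε (y - id a) * u0 a else 0) := by
        simp [PA, Pot, PotI, ht.1]
      rw [h2]
      refine h1.trans ?_
      congr 1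
      refine intervalIntegral.integral_congr fun σ hσ => ?_
      rw [Set.uIcc_of_le ht.1] at hσ
      rw [Pot_half_sum _ (fun i => KB_G2 i i) hε measurable_const measurable_id hu0m hu0 hσ.1]
      unfold PA
      ring
    have hB : ∀ j, PB T (G1 j) ε q j t y = (∫ s in (0:ℝ)..t, Cv (G1 j ε) (rho q j) s y) +
        ∫ s in (0:ℝ)..t, exp (2 * s) * ∑ i, PB T (G3 i j) ε q j s y := by
      intro j
      have h3 : ∀ᵐ σ ∂(volume.restrict (Set.Ioc 0 T)), σ ∈ Set.Ioc 0 T := ae_restrict_mem measurableSet_Ioc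
      have h4 := (Measure.quasiMeasurePreserving_fst (μ := volume.restrict (Set.Ioc 0 T)) (ν := (volume : Measure (Evec N)))).ae h3
      have h1 := Pot_time (K := G1 j) (K' := fun r x => (1 / 2) * ∑ i, G3 i j r x)
        (μ := (volume.restrict (Set.Ioc 0 T)).prod volume) (s := Prod.fst) (z := Prod.snd) (ρ := fun p => rho q j p.1 p.2)
        (KB_G1 j) (KB.const_mul _ (KB.sum _ fun i => KB_G3 i j)) hε measurable_fst
        (by filter_upwards [h4] with p hp using hp.1.le) measurable_snd (rho_meas hq j) (hρ j)
        (fun r hr x => G1_r j hr x) ht.1 y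
      refine h1.trans ?_
      congr 1
      · obtain ⟨C, hC0, hC⟩ := PotI_bound' (s := fun p : ℝ × Evec N => p.1) (z := fun p => p.2) (ρ := fun p => rho q j p.1 p.2) (KB_G1 j) hε 0
        have hii : Integrable (fun a : ℝ × Evec N => if a.1 ≤ t then G1 j ε (y - a.2) * rho q j a.1 a.2 else 0)
            ((volume.restrict (Set.Ioc 0 T)).prod volume) := by
          have hb := PotI_integrable (s := fun p : ℝ × Evec N => 0) (z := fun p => p.2)
            (ρ := fun p => if p.1 ≤ t then rho q j p.1 p.2 else 0) (μ := (volume.restrict (Set.Ioc 0 T)).prod volume) (KB_G1 j) hε measurable_const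
            measurable_snd (Measurable.ite (measurableSet_le measurable_fst measurable_const) (rho_meas hq j) measurable_const)
            ((hρ j).mono (Measurable.ite (measurableSet_le measurable_fst measurable_const) (rho_meas hq j) measurable_const).aestronglyMeasurable
              (ae_of_all _ fun p => by split_ifs <;> simp)) le_rfl y
          refine hb.congr (ae_of_all _ fun p => ?_)
          simp only [PotI]
          split_ifs <;> simp_all
        rw [integral_prod _ hii, intervalIntegral.integral_of_le ht.1]
        have hsub : Set.Ioc 0 t = Set.Ioc 0 T ∩ Set.Iic t := by
          rw [Set.Ioc_inter_Iic, min_eq_right ht.2]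
        rw [hsub, ← setIntegral_indicator measurableSet_Iic]
        congr 1; ext σ
        simp only [Set.indicator, Set.mem_Iic]
        split_ifs with h
        · rfl
        · simp
      · refine intervalIntegral.integral_congr fun σ hσ => ?_
        rw [Set.uIcc_of_le ht.1] at hσ
        rw [Pot_half_sum (ρ := fun p : ℝ × Evec N => rho q j p.1 p.2) _ (fun i => KB_G3 i j) hε measurable_fst measurable_snd (rho_meas hq j) (hρ j) hσ.1]
        unfold PB
        ring
    have e0 : ∀ s, ∑ i, (exp (2 * s) * (PA (G2 i i) ε u0 s y + ∑ j, PB T (G3 i j) ε q j s y) + Cv (G1 i ε) (rho q i) s y)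
        = exp (2 * s) * (∑ i, PA (G2 i i) ε u0 s y) + ∑ j, (Cv (G1 j ε) (rho q j) s y + exp (2 * s) * ∑ i, PB T (G3 i j) ε q j s y) := by
      intro s
      simp only [Finset.sum_add_distrib, ← Finset.mul_sum, mul_add]
      rw [Finset.sum_comm]
      ring
    simp only [e0]
    rw [intervalIntegral.integral_add (hnA.ii y ht)
        ((Nice.sum Finset.univ fun j => (hCn (KB_G1 j) j).add (hnB j)).ii y ht),
      intervalIntegral.integral_finsetSum (fun j _ => ((hCn (KB_G1 j) j).add (hnB j)).ii y ht)]
    unfold Um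
    rw [hA]
    simp only [hP0]
    simp only [hB]
    simp only [fun j => intervalIntegral.integral_add ((hCn (KB_G1 j) j).ii y ht) ((hnB j).ii y ht)]
    simp
    ring

end Assemble

section Lim
variable {N : ℕ}

lemma Gk_contAt {r : ℝ} (hr : 0 < r) (x : Evec N) : ContinuousAt (Function.uncurry (Gk (N := N))) (r, x) := by
  unfold Function.uncurry Gk
  refine ContinuousAt.mul ?_ ?_
  · refine ContinuousAt.rpow_const (by fun_prop) (Or.inl ?_)
    simp only []; positivity
  · refine Real.continuous_exp.continuousAt.comp ?_
    refine ContinuousAt.div (by fun_prop) (by fun_prop) ?_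
    simp only []; positivity

lemma G1_contAt (j : Fin N) {r : ℝ} (hr : 0 < r) (x : Evec N) :
    ContinuousAt (Function.uncurry (G1 j)) (r, x) := by
  have h := Gk_contAt hr x
  refine ContinuousAt.mul (ContinuousAt.neg (ContinuousAt.div ?_ (by fun_prop) hr.ne')) h
  fun_prop

lemma conv_tendsto {K : ℝ → Evec N → ℝ} (hK : KB K)
    (hc : ∀ r, 0 < r → ∀ x, ContinuousAt (Function.uncurry K) (r, x))
    {r : ℝ} (hr : 0 < r) {y : Evec N} {rn : ℕ → ℝ} {yn : ℕ → Evec N}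
    (h1 : Tendsto rn atTop (𝓝 r)) (h2 : Tendsto yn atTop (𝓝 y)) {ρ : Evec N → ℝ} (hρ : Integrable ρ) :
    Tendsto (fun n => ∫ z, K (rn n) (yn n - z) * ρ z) atTop (𝓝 (∫ z, K r (y - z) * ρ z)) := by
  obtain ⟨C, hC0, hC⟩ := hK.2 (r / 2) (2 * r) (by positivity) (by linarith)
  have hKm : ∀ r, Measurable (K r) := fun r => hK.1.comp measurable_prodMk_left
  refine tendsto_integral_filter_of_dominated_convergence (fun z => C * |ρ z|) ?_ ?_ (hρ.abs.const_mul C) ?_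
  · refine Eventually.of_forall fun n => AEStronglyMeasurable.mul ?_ hρ.1
    exact ((hKm _).comp (by fun_prop : Measurable fun z => yn n - z)).aestronglyMeasurable
  · filter_upwards [h1.eventually (Icc_mem_nhds (by linarith : r / 2 < r) (by linarith : r < 2 * r))] with n hn
    refine ae_of_all _ fun z => ?_
    rw [norm_mul]
    refine mul_le_mul_of_nonneg_right ((hC _ hn _).trans ?_) (abs_nonneg _)
    have : exp (-‖yn n - z‖ ^ 2 / (4 * (2 * r))) ≤ 1 := by
      rw [exp_le_one_iff, neg_div]
      have : 0 ≤ ‖yn n - z‖ ^ 2 / (4 * (2 * r)) := by positivity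
      linarith
    nlinarith
  · refine ae_of_all _ fun z => ?_
    refine Tendsto.mul_const _ ?_
    exact (hc r hr (y - z)).tendsto.comp (h1.prodMk_nhds (h2.sub_const z))

lemma int_norm_Gk (k : ℕ) (hk : k ≤ 3) : Integrable (fun x : Evec N => ‖x‖ ^ k * Gk 1 x) := by
  refine integrable_KB (K := fun r x => ‖x‖ ^ k * Gk r x) ?_ one_pos
  refine KB_of (fun _ x => ‖x‖ ^ k) (by unfold Function.uncurry; fun_prop) fun ε _ => ⟨1, zero_le_one, fun r _ x => ?_⟩
  rw [abs_of_nonneg (by positivity), one_mul]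
  calc ‖x‖ ^ k ≤ (1 + ‖x‖) ^ k := by gcongr; linarith
    _ ≤ _ := pow_le_pow_right₀ (by linarith [norm_nonneg x]) hk

lemma G1_conv_bound (N : ℕ) (C : ℝ) (hC : 0 ≤ C) : ∃ M : ℝ, 0 ≤ M ∧ ∀ (j : Fin N) (ρ : Evec N → ℝ),
    (∀ z, |ρ z| ≤ C * ‖z‖) → ∀ r, 0 < r → ∀ y, |∫ z, G1 j r (y - z) * ρ z| ≤ M * (‖y‖ / √r + 1) := by
  set M1 := ∫ x : Evec N, ‖x‖ ^ 1 * Gk 1 x with hM1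
  set M2 := ∫ x : Evec N, ‖x‖ ^ 2 * Gk 1 x with hM2
  have hM10 : 0 ≤ M1 := integral_nonneg fun x => mul_nonneg (by positivity) (Gk_nonneg zero_le_one x)
  have hM20 : 0 ≤ M2 := integral_nonneg fun x => mul_nonneg (by positivity) (Gk_nonneg zero_le_one x)
  refine ⟨C * (M1 + M2), by positivity, fun j ρ hρ r hr y => ?_⟩
  have hs : 0 < √r := Real.sqrt_pos.2 hr
  set h : Evec N → ℝ := fun x => (‖x‖ / r) * (C * (‖y‖ + ‖x‖)) with hh
  have hi : Integrable (fun x => h x * Gk r x) := by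
    refine integrable_KB (K := fun r' x => h x * Gk r' x) ?_ hr
    refine KB_of (fun _ x => h x) (by simp only [hh]; unfold Function.uncurry; fun_prop)
      fun ε _ => ⟨C / r * (1 + ‖y‖), by positivity, fun r' _ x => ?_⟩
    rw [abs_of_nonneg (by simp only [hh]; positivity)]
    have hx := norm_nonneg x
    have hy := norm_nonneg y
    have : ‖x‖ * (‖y‖ + ‖x‖) ≤ (1 + ‖y‖) * (1 + ‖x‖) ^ 3 := by
      nlinarith [pow_nonneg hx 3, pow_nonneg hx 2, mul_nonneg hy hx, mul_nonneg hy (pow_nonneg hx 2), mul_nonneg hy (pow_nonneg hx 3)]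
    calc h x = C / r * (‖x‖ * (‖y‖ + ‖x‖)) := by simp only [hh]; ring
      _ ≤ C / r * ((1 + ‖y‖) * (1 + ‖x‖) ^ 3) := by gcongr
      _ = _ := by ring
  have h1 : |∫ z, G1 j r (y - z) * ρ z| ≤ ∫ z, (fun x => h x * Gk r x) (y - z) := by
    rw [← Real.norm_eq_abs]
    refine norm_integral_le_of_norm_le (hi.comp_sub_left y) (ae_of_all _ fun z => ?_)
    simp only [hh, G1, norm_mul, norm_neg, norm_div, Real.norm_eq_abs, abs_of_pos hr,
      abs_of_nonneg (Gk_nonneg hr.le _)]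
    have a1 := abs_coord_le (y - z) j
    have a2 : |ρ z| ≤ C * (‖y‖ + ‖y - z‖) := by
      refine (hρ z).trans (mul_le_mul_of_nonneg_left ?_ hC)
      have : z = y - (y - z) := by abel
      calc ‖z‖ = ‖y - (y - z)‖ := by rw [← this]
        _ ≤ _ := norm_sub_le _ _
    have a3 := Gk_nonneg hr.le (y - z)
    calc |(y - z) j| / r * Gk r (y - z) * |ρ z| ≤ ‖y - z‖ / r * Gk r (y - z) * (C * (‖y‖ + ‖y - z‖)) := by gcongr
      _ = _ := by ring
  refine h1.trans ?_
  rw [integral_sub_left_eq_self (fun x => h x * Gk r x)]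
  have e1 : ∫ x, h x * Gk r x = ∫ x, Gk 1 x * h (√r • x) := by
    rw [← integral_Gk_scale hr]; congr 1; ext x; ring
  have e2 : ∀ x, Gk 1 x * h (√r • x) = (C * ‖y‖ / √r) * (‖x‖ ^ 1 * Gk 1 x) + C * (‖x‖ ^ 2 * Gk 1 x) := by
    intro x
    simp only [hh, norm_smul, Real.norm_of_nonneg hs.le]
    have : r = √r ^ 2 := (Real.sq_sqrt hr.le).symm
    rw [show √r * ‖x‖ / r = ‖x‖ / √r by rw [div_eq_div_iff hr.ne' hs.ne']; nth_rewrite 3 [this]; ring]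
    field_simp
  rw [e1]
  simp only [e2]
  rw [integral_add ((int_norm_Gk 1 (by norm_num)).const_mul _) ((int_norm_Gk 2 (by norm_num)).const_mul _),
    integral_const_mul, integral_const_mul]
  have : 0 ≤ ‖y‖ / √r := by positivity
  have e3 : C * ‖y‖ / √r * M1 = C * M1 * (‖y‖ / √r) := by ring
  rw [e3]
  nlinarith [mul_nonneg hC hM10, mul_nonneg hC hM20, mul_nonneg (mul_nonneg hC hM20) this]

def Ulim (u0 : Evec N → ℝ) (q : ℝ → Evec N → ℝ) (t : ℝ) (y : Evec N) : ℝ :=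
  (∫ w, Gk (exp (2 * t) - 1) (y - w) * u0 w) +
    ∑ j, ∫ s in Set.Ioc 0 t, ∫ z, G1 j (exp (2 * t) - exp (2 * s)) (y - z) * rho q j s z

lemma exp_gap {s t : ℝ} (hs : 0 ≤ s) (h : s ≤ t) : t - s ≤ exp (2 * t) - exp (2 * s) := by
  have h1 : exp (2 * t) = exp (2 * s) * exp (2 * (t - s)) := by rw [← Real.exp_add]; congr 1; ring
  have h2 := Real.add_one_le_exp (2 * (t - s))
  have h3 : 1 ≤ exp (2 * s) := Real.one_le_exp (by linarith)
  rw [h1]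
  nlinarith

lemma int_majorant (t M R : ℝ) (ht : 0 ≤ t) :
    IntegrableOn (fun s => M * (R / √(t - s) + 1)) (Set.Ioc 0 t) := by
  rw [← intervalIntegrable_iff_integrableOn_Ioc_of_le ht]
  have h := (intervalIntegral.intervalIntegrable_rpow' (r := -1/2) (a := t) (b := 0) (by norm_num)).comp_sub_left t
  simp only [sub_self, sub_zero] at h
  have h2 : IntervalIntegrable (fun s => R / √(t - s) + 1) volume 0 t := by
    refine IntervalIntegrable.add ?_ (by simp)
    refine (h.const_mul R).congr fun s hs => ?_
    rw [Set.uIoc_of_le ht] at hs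
    show R * (t - s) ^ (-1/2 : ℝ) = R / √(t - s)
    rw [Real.sqrt_eq_rpow, show (-1/2:ℝ) = -(1/2) by norm_num, Real.rpow_neg (by linarith [hs.2])]; exact (div_eq_mul_inv _ _).symm
  exact h2.const_mul M

lemma inner_meas {q : ℝ → Evec N → ℝ} (hq : Measurable (Function.uncurry q)) (j : Fin N) (g : ℝ → ℝ) (hg : Measurable g)
    (y : Evec N) : Measurable (fun s => ∫ z, G1 j (g s) (y - z) * rho q j s z) := by
  have : Measurable (fun p : ℝ × Evec N => G1 j (g p.1) (y - p.2) * rho q j p.1 p.2) := by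
    refine Measurable.mul ?_ (rho_meas hq j)
    exact (KB_G1 j).1.comp ((hg.comp measurable_fst).prodMk (by fun_prop))
  exact (this.stronglyMeasurable.integral_prod_right (ν := volume)).measurable

lemma Um_tendsto {T C C1 : ℝ} (hC0 : 0 ≤ C)
    {u0 : Evec N → ℝ} {q : ℝ → Evec N → ℝ} (hu0m : Measurable u0) (hu0 : Integrable u0)
    (hq : Measurable (Function.uncurry q)) (hqb : ∀ s z, |q s z| ≤ C)
    (hi : ∀ s, Integrable (fun z => ‖z‖ * |q s z|)) (hC : ∀ s, ∫ z, ‖z‖ * |q s z| ≤ C1)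
    {t : ℝ} (ht : t ∈ Set.Ioc 0 T) {εn : ℕ → ℝ} (hε : ∀ n, 0 < εn n) (hεl : Tendsto εn atTop (𝓝 0))
    {yn : ℕ → Evec N} {y : Evec N} (hy : Tendsto yn atTop (𝓝 y)) :
    Tendsto (fun n => Um T (εn n) u0 q t (yn n)) atTop (𝓝 (Ulim u0 q t y)) := by
  unfold Um Ulim
  refine Tendsto.add ?_ (tendsto_finsetSum _ fun j _ => ?_)
  · have h1 : ∀ n, PA Gk (εn n) u0 t (yn n) = ∫ w, Gk (εn n + exp (2 * t) - 1) (yn n - w) * u0 w := by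
      intro n; simp [PA, Pot, PotI, ht.1.le]
    simp only [h1]
    have h2 : 1 < exp (2 * t) := Real.one_lt_exp_iff.2 (by linarith [ht.1])
    refine conv_tendsto KB_Gk (fun r hr x => Gk_contAt hr x) (by linarith) ?_ hy hu0
    simpa using (hεl.add_const (exp (2 * t))).sub_const 1
  · have h1 : ∀ n, PB T (G1 j) (εn n) q j t (yn n) = ∫ s in Set.Ioc 0 t, ∫ z, G1 j (εn n + exp (2 * t) - exp (2 * s)) (yn n - z) * rho q j s z := by
      intro n
      unfold PB Pot
      rw [integral_prod _ (PotI_integrable (ρ := fun p : ℝ × Evec N => rho q j p.1 p.2) (KB_G1 j) (hε n) measurable_fst measurable_snd (rho_meas hq j) (rho_int2 hq hi hC j T) ht.1.le _)]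
      have hsub : Set.Ioc 0 t = Set.Ioc 0 T ∩ Set.Iic t := by
        rw [Set.Ioc_inter_Iic, min_eq_right ht.2]
      rw [hsub, ← setIntegral_indicator measurableSet_Iic]
      congr 1; ext σ
      simp only [Set.indicator, Set.mem_Iic, PotI]
      split_ifs with h
      · rfl
      · simp
    simp only [h1]
    obtain ⟨M, hM0, hM⟩ := G1_conv_bound N C hC0
    have hρ : ∀ s z, |rho q j s z| ≤ C * ‖z‖ := fun s z => by
      refine (rho_le q j s z).trans ?_
      rw [mul_comm]; exact mul_le_mul_of_nonneg_right (hqb s z) (norm_nonneg _)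
    refine tendsto_integral_filter_of_dominated_convergence (fun s => M * ((‖y‖ + 1) / √(t - s) + 1)) ?_ ?_
      (int_majorant t M _ ht.1.le) ?_
    · exact Eventually.of_forall fun n => (inner_meas hq j _ (by fun_prop) _).aestronglyMeasurable
    · have hyb : ∀ᶠ n in atTop, ‖yn n‖ ≤ ‖y‖ + 1 :=
        (hy.norm.eventually (gt_mem_nhds (by linarith : ‖y‖ < ‖y‖ + 1))).mono fun n hn => le_of_lt hn
      filter_upwards [hyb] with n hn
      have hne : ∀ᵐ s : ℝ ∂(volume.restrict (Set.Ioc 0 t)), s ≠ t := ae_restrict_of_ae (Measure.ae_ne volume t)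
      filter_upwards [ae_restrict_mem measurableSet_Ioc, hne] with s hs hst
      have hlt : 0 < t - s := by have := lt_of_le_of_ne hs.2 hst; linarith
      have hg := exp_gap hs.1.le hs.2
      have hr : t - s ≤ εn n + exp (2 * t) - exp (2 * s) := by linarith [hε n]
      refine (hM j _ (hρ s) _ (by linarith) _).trans ?_
      have : 0 < √(t - s) := Real.sqrt_pos.2 hlt
      gcongr
    · have hne : ∀ᵐ s : ℝ ∂(volume.restrict (Set.Ioc 0 t)), s ≠ t := ae_restrict_of_ae (Measure.ae_ne volume t)
      filter_upwards [ae_restrict_mem measurableSet_Ioc, hne] with s hs hst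
      have hlt : 0 < t - s := by have := lt_of_le_of_ne hs.2 hst; linarith
      have hg := exp_gap hs.1.le hs.2
      refine conv_tendsto (KB_G1 j) (fun r hr x => G1_contAt j hr x) (by linarith) ?_ hy (rho_int hq hi hC j s).1
      simpa using (hεl.add_const (exp (2 * t))).sub_const (exp (2 * s))

end Lim

section Core
variable {N : ℕ}

lemma jens {ε : ℝ} (hε : 0 < ε) {p : Evec N → ℝ} (hp : Integrable p) (hp2 : Integrable (fun z => p z ^ 2)) (y : Evec N) :
    (∫ z, Gk ε (y - z) * p z) ^ 2 ≤ ∫ z, Gk ε (y - z) * p z ^ 2 := by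
  set m := ∫ z, Gk ε (y - z) * p z with hm
  have hGi : Integrable (fun z => Gk ε (y - z)) := (integrable_KB KB_Gk hε).comp_sub_left y
  have hGm : AEStronglyMeasurable (fun z => Gk ε (y - z)) := hGi.1
  have hb : ∃ C, ∀ z, ‖Gk ε (y - z)‖ ≤ C := by
    refine ⟨(2 * π * ε) ^ (-(N : ℝ) / 2), fun z => ?_⟩
    rw [Real.norm_of_nonneg (Gk_nonneg hε.le _)]
    refine (Gk_le hε le_rfl le_rfl (y - z)).trans ?_
    have : exp (-‖y - z‖ ^ 2 / (2 * ε)) ≤ 1 := by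
      rw [exp_le_one_iff, neg_div]
      have : 0 ≤ ‖y - z‖ ^ 2 / (2 * ε) := by positivity
      linarith
    have h2 : 0 ≤ (2 * π * ε) ^ (-(N : ℝ) / 2) := by positivity
    nlinarith
  obtain ⟨C, hC⟩ := hb
  have i1 : Integrable (fun z => Gk ε (y - z) * p z) := hp.bdd_mul hGm (ae_of_all _ hC)
  have i2 : Integrable (fun z => Gk ε (y - z) * p z ^ 2) := hp2.bdd_mul hGm (ae_of_all _ hC)
  have h0 : 0 ≤ ∫ z, Gk ε (y - z) * (p z - m) ^ 2 :=
    integral_nonneg fun z => mul_nonneg (Gk_nonneg hε.le _) (sq_nonneg _)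
  have e : ∀ z, Gk ε (y - z) * (p z - m) ^ 2 = Gk ε (y - z) * p z ^ 2 - 2 * m * (Gk ε (y - z) * p z) + m ^ 2 * Gk ε (y - z) := fun z => by ring
  simp only [e] at h0
  have i3 : Integrable (fun z => Gk ε (y - z) * p z ^ 2 - 2 * m * (Gk ε (y - z) * p z)) := i2.sub (i1.const_mul _)
  rw [integral_add i3 (hGi.const_mul _), integral_sub i2 (i1.const_mul _),
    integral_const_mul, integral_const_mul, ← hm, integral_sub_left_eq_self (fun x : Evec N => Gk ε x), integral_Gk hε] at h0
  nlinarith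

lemma smooth_bound {ε B : ℝ} (hε : 0 < ε) {b : Evec N → ℝ} (hb : Measurable b) (hb0 : ∀ y, 0 ≤ b y)
    (hbB : ∀ y, b y ≤ B) {p : Fin N → Evec N → ℝ} (hp : ∀ i, Integrable (p i))
    (hp2 : ∀ i, Integrable (fun z => p i z ^ 2)) :
    ∫ y, b y * ((∑ i, (∫ z, Gk ε (y - z) * p i z) ^ 2) / 4) ≤
      (1 / 4) * ∫ z, ∫ ξ, (∑ i, p i z ^ 2) * (Gk 1 ξ * b (z + √ε • ξ)) := by
  set P : Evec N → ℝ := fun z => ∑ i, p i z ^ 2 with hP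
  have hPi : Integrable P := integrable_finsetSum _ fun i _ => hp2 i
  have hP0 : ∀ z, 0 ≤ P z := fun z => Finset.sum_nonneg fun i _ => sq_nonneg _
  have hci := (conv_L1 (integrable_KB KB_Gk hε) hPi).1
  have hGb : ∀ y : Evec N, Integrable (fun z => Gk ε (y - z)) := fun y => (integrable_KB KB_Gk hε).comp_sub_left y
  have hGC : ∃ C, ∀ x : Evec N, ‖Gk ε x‖ ≤ C := by
    refine ⟨(2 * π * ε) ^ (-(N : ℝ) / 2), fun z => ?_⟩
    rw [Real.norm_of_nonneg (Gk_nonneg hε.le _)]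
    refine (Gk_le hε le_rfl le_rfl z).trans ?_
    have : exp (-‖z‖ ^ 2 / (2 * ε)) ≤ 1 := by
      rw [exp_le_one_iff, neg_div]
      have : 0 ≤ ‖z‖ ^ 2 / (2 * ε) := by positivity
      linarith
    have h2 : 0 ≤ (2 * π * ε) ^ (-(N : ℝ) / 2) := by positivity
    nlinarith
  obtain ⟨C, hC⟩ := hGC
  have hbn : ∀ y, ‖b y‖ ≤ B := fun y => by rw [Real.norm_of_nonneg (hb0 y)]; exact hbB y
  have s1 : ∫ y, b y * ((∑ i, (∫ z, Gk ε (y - z) * p i z) ^ 2) / 4) ≤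
      ∫ y, (1 / 4) * (b y * ∫ z, Gk ε (y - z) * P z) := by
    refine integral_mono_of_nonneg (ae_of_all _ fun y => ?_) ((hci.bdd_mul hb.aestronglyMeasurable (ae_of_all _ hbn)).const_mul _)
      (ae_of_all _ fun y => ?_)
    · exact mul_nonneg (hb0 y) (div_nonneg (Finset.sum_nonneg fun i _ => sq_nonneg _) (by norm_num))
    · have h1 : ∑ i, (∫ z, Gk ε (y - z) * p i z) ^ 2 ≤ ∫ z, Gk ε (y - z) * P z := by
        simp only [hP, Finset.mul_sum]
        rw [integral_finsetSum _ fun i _ => (hp2 i).bdd_mul (hGb y).1 (ae_of_all _ fun z => hC _)]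
        exact Finset.sum_le_sum fun i _ => jens hε (hp i) (hp2 i) y
      have := mul_le_mul_of_nonneg_left h1 (hb0 y)
      linarith
  refine s1.trans (le_of_eq ?_)
  rw [integral_const_mul]
  congr 1
  have hpi : Integrable (Function.uncurry fun y z => b y * (Gk ε (y - z) * P z)) (volume.prod volume) := by
    have h := hPi.convolution_integrand (ContinuousLinearMap.mul ℝ ℝ) (integrable_KB (KB_Gk (N := N)) hε) (μ := volume) (ν := volume)
    have h2 := h.bdd_mul (c := B) (f := fun p : Evec N × Evec N => b p.1) (hb.comp measurable_fst).aestronglyMeasurable (ae_of_all _ fun p => hbn _)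
    refine h2.congr (ae_of_all _ fun p => ?_)
    simp [Function.uncurry, mul_comm]
  calc ∫ y, b y * ∫ z, Gk ε (y - z) * P z = ∫ y, ∫ z, b y * (Gk ε (y - z) * P z) := by
        congr 1; ext y; rw [integral_const_mul]
    _ = ∫ z, ∫ y, b y * (Gk ε (y - z) * P z) := integral_integral_swap hpi
    _ = _ := by
      congr 1; ext z
      rw [integral_const_mul, ← integral_Gk_scale hε (fun x => b (z + x)), ← integral_const_mul]
      rw [← integral_sub_right_eq_self (fun x => P z * (Gk ε x * b (z + x))) z]
      congr 1; ext y
      rw [add_sub_cancel]; ring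

lemma sum_rho_sq (q : ℝ → Evec N → ℝ) (s : ℝ) (z : Evec N) : ∑ i, rho q i s z ^ 2 = ‖z‖ ^ 2 * q s z ^ 2 := by
  simp only [rho, mul_pow, ← Finset.sum_mul, sum_sq_coord]

lemma core_eps {T C C1 δ : ℝ} (hT : 0 < T) (hδ : 0 < δ) (hC0 : 0 ≤ C)
    {u0 : Evec N → ℝ} {q u : ℝ → Evec N → ℝ} (hu0m : Measurable u0) (hu0 : Integrable u0)
    (hq : Measurable (Function.uncurry q)) (hqb : ∀ s z, |q s z| ≤ C)
    (hi : ∀ s, Integrable (fun z => ‖z‖ * |q s z|)) (hC : ∀ s, ∫ z, ‖z‖ * |q s z| ≤ C1)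
    (hi2 : ∀ s, Integrable (fun z => ‖z‖ ^ 2 * q s z ^ 2))
    (hi2' : Integrable (fun p : ℝ × Evec N => ‖p.2‖ ^ 2 * q p.1 p.2 ^ 2) ((volume.restrict (Set.Ioc 0 T)).prod volume))
    (hum : Measurable (Function.uncurry u))
    (hu : ∀ t ∈ Set.Ioc 0 T, ∀ᵐ y, u t y = Ulim u0 q t y) :
    ∫⁻ y, ENNReal.ofReal (bt δ (u T y)) ≤ ENNReal.ofReal ((∫ y, |u0 y|) +
      (1 / 4) * ∫ p, (‖p.2‖ ^ 2 * q p.1 p.2 ^ 2) * bt2 δ (u p.1 p.2) ∂((volume.restrict (Set.Ioc 0 T)).prod volume)) := by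
  set μ := (volume.restrict (Set.Ioc 0 T)).prod (volume : Measure (Evec N)) with hμ
  set εn : ℕ → ℝ := fun n => 1 / ((n:ℝ) + 1) with hεn
  have hε : ∀ n, 0 < εn n := fun n => by simp only [hεn]; positivity
  have hεl : Tendsto εn atTop (𝓝 0) := tendsto_one_div_add_atTop_nhds_zero_nat
  have hεs : Tendsto (fun n => √(εn n)) atTop (𝓝 0) := by
    have := (Real.continuous_sqrt.tendsto 0).comp hεl
    rw [Real.sqrt_zero] at this
    exact this
  have hE := fun n => Um_energy hT (hε n) hδ hu0m hu0 hq hi hC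
  set U : ℕ → ℝ → Evec N → ℝ := fun n => Um T (εn n) u0 q with hU
  have hUm : ∀ n, Measurable (Function.uncurry (U n)) := fun n => (hE n).1.1
  set A : ℝ × Evec N → ℝ := fun p => ‖p.2‖ ^ 2 * q p.1 p.2 ^ 2 with hA
  have hA0 : ∀ p, 0 ≤ A p := fun p => by simp only [hA]; positivity
  have hAm : Measurable A := by
    have : Measurable (fun p : ℝ × Evec N => q p.1 p.2) := hq
    simp only [hA]; fun_prop
  set H : ℕ → (ℝ × Evec N) × Evec N → ℝ := fun n p => A p.1 * (Gk 1 p.2 * bt2 δ (U n p.1.1 (p.1.2 + √(εn n) • p.2))) with hH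
  set L : ℝ × Evec N → ℝ := fun p => A p * bt2 δ (Ulim u0 q p.1 p.2) with hL
  have hbm := (continuous_bt2 hδ).measurable
  have hGm : Measurable (Gk (N := N) 1) := measurable_Gk.comp measurable_prodMk_left
  have hHm : ∀ n, Measurable (H n) := fun n => by
    have h1 : Measurable (fun p : (ℝ × Evec N) × Evec N => U n p.1.1 (p.1.2 + √(εn n) • p.2)) :=
      (hUm n).comp (by fun_prop : Measurable fun p : (ℝ × Evec N) × Evec N => (p.1.1, p.1.2 + √(εn n) • p.2))
    exact (hAm.comp measurable_fst).mul ((hGm.comp measurable_snd).mul (hbm.comp h1))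
  have hD : Integrable (fun p : (ℝ × Evec N) × Evec N => A p.1 * (Gk 1 p.2 * (1 / δ))) (μ.prod volume) :=
    hi2'.mul_prod ((integrable_KB KB_Gk one_pos).mul_const _)
  have hHb : ∀ n p, ‖H n p‖ ≤ A p.1 * (Gk 1 p.2 * (1 / δ)) := fun n p => by
    have g0 := Gk_nonneg zero_le_one p.2
    rw [Real.norm_of_nonneg (mul_nonneg (hA0 _) (mul_nonneg g0 (bt2_nonneg _ _)))]
    exact mul_le_mul_of_nonneg_left (mul_le_mul_of_nonneg_left (bt2_le hδ _) g0) (hA0 _)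
  have hHi : ∀ n, Integrable (H n) (μ.prod volume) := fun n =>
    hD.mono' (hHm n).aestronglyMeasurable (ae_of_all _ (hHb n))
  have hmem : ∀ᵐ p : ℝ × Evec N ∂μ, p.1 ∈ Set.Ioc 0 T := by
    have h3 : ∀ᵐ σ ∂(volume.restrict (Set.Ioc 0 T)), σ ∈ Set.Ioc 0 T := ae_restrict_mem measurableSet_Ioc
    exact Measure.quasiMeasurePreserving_fst.ae h3
  have hmem2 : ∀ᵐ p : (ℝ × Evec N) × Evec N ∂(μ.prod volume), p.1.1 ∈ Set.Ioc 0 T :=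
    Measure.quasiMeasurePreserving_fst.ae hmem
  have hlim : ∀ᵐ p ∂(μ.prod volume), Tendsto (fun n => H n p) atTop (𝓝 (L p.1 * Gk 1 p.2)) := by
    filter_upwards [hmem2] with p hp
    have hy : Tendsto (fun n => p.1.2 + √(εn n) • p.2) atTop (𝓝 p.1.2) := by
      simpa using (hεs.smul_const p.2).const_add p.1.2
    have h1 := Um_tendsto hC0 hu0m hu0 hq hqb hi hC hp hε hεl hy
    have h2 := ((continuous_bt2 hδ).tendsto _).comp h1
    have h3 := (h2.const_mul (Gk 1 p.2)).const_mul (A p.1)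
    have e : L p.1 * Gk 1 p.2 = A p.1 * (Gk 1 p.2 * bt2 δ (Ulim u0 q p.1.1 p.1.2)) := by
      simp only [hL]; ring
    rw [e]
    exact h3
  have hDCT := tendsto_integral_of_dominated_convergence _ (fun n => (hHm n).aestronglyMeasurable) hD
    (fun n => ae_of_all _ (hHb n)) hlim
  rw [integral_prod_mul (μ := μ) (ν := volume) L (Gk 1), integral_Gk one_pos, mul_one] at hDCT
  have hLi : Integrable L μ := by
    refine (hi2'.mul_const (1 / δ)).mono' ?_ ?_
    · refine aestronglyMeasurable_of_tendsto_ae atTop (f := fun n p => A p * bt2 δ (U n p.1 p.2)) (fun n => ?_) ?_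
      · exact (hAm.mul (hbm.comp (hUm n))).aestronglyMeasurable
      · filter_upwards [hmem] with p hp
        have h1 := Um_tendsto hC0 hu0m hu0 hq hqb hi hC hp hε hεl (tendsto_const_nhds (x := p.2))
        exact (((continuous_bt2 hδ).tendsto _).comp h1).const_mul (A p)
    · refine ae_of_all _ fun p => ?_
      rw [Real.norm_of_nonneg (mul_nonneg (hA0 _) (bt2_nonneg _ _))]
      exact mul_le_mul_of_nonneg_left (bt2_le hδ _) (hA0 _)
  have hLu : ∫ p, L p ∂μ = ∫ p, A p * bt2 δ (u p.1 p.2) ∂μ := by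
    have hLi2 : Integrable (fun p : ℝ × Evec N => A p * bt2 δ (u p.1 p.2)) μ := by
      refine (hi2'.mul_const (1 / δ)).mono' (hAm.mul (hbm.comp hum)).aestronglyMeasurable (ae_of_all _ fun p => ?_)
      rw [Real.norm_of_nonneg (mul_nonneg (hA0 _) (bt2_nonneg _ _))]
      exact mul_le_mul_of_nonneg_left (bt2_le hδ _) (hA0 _)
    rw [hμ, integral_prod _ hLi, integral_prod _ hLi2]
    refine setIntegral_congr_fun measurableSet_Ioc fun s hs => ?_
    refine integral_congr_ae ?_
    filter_upwards [hu s hs] with y hy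
    simp only [hL, hy]
  have hR : ∀ n, ∫ y, bt δ (U n T y) ≤ (∫ y, |u0 y|) + (1 / 4) * ∫ p, H n p ∂(μ.prod volume) := by
    intro n
    refine (hE n).2.2.trans (add_le_add_right ?_ _)
    have hHi' := (hHi n).integral_prod_left
    rw [integral_prod _ (hHi n), hμ, integral_prod _ hHi', ← integral_const_mul]
    refine integral_mono_of_nonneg (ae_of_all _ fun s => integral_nonneg fun y => ?_) (hHi'.integral_prod_left.const_mul _)
      (ae_of_all _ fun s => ?_)
    · exact mul_nonneg (bt2_nonneg _ _) (div_nonneg (Finset.sum_nonneg fun i _ => sq_nonneg _) (by norm_num))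
    · have := smooth_bound (hε n) (b := fun y => bt2 δ (U n s y)) (B := 1 / δ) (p := fun i => rho q i s)
        (hbm.comp ((hUm n).comp measurable_prodMk_left)) (fun y => bt2_nonneg _ _) (fun y => bt2_le hδ _)
        (fun i => (rho_int hq hi hC i s).1) (fun i => ?_)
      · simp only [sum_rho_sq] at this
        exact this
      · refine (hi2 s).mono' (((rho_meas hq i).comp measurable_prodMk_left).pow_const 2).aestronglyMeasurable (ae_of_all _ fun z => ?_)
        rw [Real.norm_of_nonneg (sq_nonneg _), ← sum_rho_sq]
        exact Finset.single_le_sum (f := fun i => rho q i s z ^ 2) (fun i _ => sq_nonneg _) (Finset.mem_univ i)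
  have hTm : T ∈ Set.Ioc 0 T := ⟨hT, le_rfl⟩
  have hbtm := (continuous_bt δ).measurable
  calc ∫⁻ y, ENNReal.ofReal (bt δ (u T y)) = ∫⁻ y, liminf (fun n => ENNReal.ofReal (bt δ (U n T y))) atTop := by
        refine lintegral_congr_ae ?_
        filter_upwards [hu T hTm] with y hy
        have h1 := Um_tendsto hC0 hu0m hu0 hq hqb hi hC hTm hε hεl (tendsto_const_nhds (x := y))
        have h2 := (ENNReal.continuous_ofReal.tendsto _).comp (((continuous_bt δ).tendsto _).comp h1)
        rw [hy]
        exact h2.liminf_eq.symm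
    _ ≤ liminf (fun n => ∫⁻ y, ENNReal.ofReal (bt δ (U n T y))) atTop :=
        lintegral_liminf_le fun n => (hbtm.comp ((hUm n).comp measurable_prodMk_left)).ennreal_ofReal
    _ ≤ liminf (fun n => ENNReal.ofReal ((∫ y, |u0 y|) + (1 / 4) * ∫ p, H n p ∂(μ.prod volume))) atTop := by
        refine liminf_le_liminf (Eventually.of_forall fun n => ?_)
        obtain ⟨_, CU, hCU0, hCU⟩ := (hE n).1
        have hUT := (hCU T ⟨hT.le, le_rfl⟩).2.1
        have hbi : Integrable (fun y => bt δ (U n T y)) := by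
          refine hUT.abs.mono' (hbtm.comp ((hUm n).comp measurable_prodMk_left)).aestronglyMeasurable (ae_of_all _ fun y => ?_)
          rw [Real.norm_of_nonneg (bt_nonneg hδ _)]
          exact bt_le hδ _
        rw [← ofReal_integral_eq_lintegral_ofReal hbi (ae_of_all _ fun y => bt_nonneg hδ _)]
        exact ENNReal.ofReal_le_ofReal (hR n)
    _ = _ := by
        have := (ENNReal.continuous_ofReal.tendsto _).comp ((hDCT.const_mul (1 / 4)).const_add (∫ y, |u0 y|))
        rw [← hLu]
        exact this.liminf_eq

end Core

section Core2
variable {N : ℕ}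

lemma core {T C C1 : ℝ} (hT : 0 < T) (hC0 : 0 ≤ C)
    {u0 : Evec N → ℝ} {q u b : ℝ → Evec N → ℝ} (hu0m : Measurable u0) (hu0 : Integrable u0)
    (hq : Measurable (Function.uncurry q)) (hqb : ∀ s z, |q s z| ≤ C)
    (hi : ∀ s, Integrable (fun z => ‖z‖ * |q s z|)) (hC : ∀ s, ∫ z, ‖z‖ * |q s z| ≤ C1)
    (hi2 : ∀ s, Integrable (fun z => ‖z‖ ^ 2 * q s z ^ 2))
    (hi2' : Integrable (fun p : ℝ × Evec N => ‖p.2‖ ^ 2 * q p.1 p.2 ^ 2) ((volume.restrict (Set.Ioc 0 T)).prod volume))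
    (hum : Measurable (Function.uncurry u))
    (hu : ∀ t ∈ Set.Ioc 0 T, ∀ᵐ y, u t y = Ulim u0 q t y)
    (hqu : ∀ s z, |q s z| ≤ b s z * |u s z|)
    (hbi : Integrable (fun p : ℝ × Evec N => ‖p.2‖ ^ 2 * (b p.1 p.2 ^ 2 * |u p.1 p.2|)) ((volume.restrict (Set.Ioc 0 T)).prod volume)) :
    ∫⁻ y, ENNReal.ofReal |u T y| ≤ ENNReal.ofReal (∫ y, |u0 y|) := by
  set μ := (volume.restrict (Set.Ioc 0 T)).prod (volume : Measure (Evec N)) with hμ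
  set δn : ℕ → ℝ := fun n => 1 / ((n:ℝ) + 1) with hδn
  have hδ : ∀ n, 0 < δn n := fun n => by simp only [hδn]; positivity
  have hδl : Tendsto δn atTop (𝓝 0) := tendsto_one_div_add_atTop_nhds_zero_nat
  have hE := fun n => core_eps hT (hδ n) hC0 hu0m hu0 hq hqb hi hC hi2 hi2' hum hu
  have hq' : Measurable (fun p : ℝ × Evec N => q p.1 p.2) := hq
  have hu' : Measurable (fun p : ℝ × Evec N => u p.1 p.2) := hum
  have key : Tendsto (fun n => ∫ p, (‖p.2‖ ^ 2 * q p.1 p.2 ^ 2) * bt2 (δn n) (u p.1 p.2) ∂μ) atTop (𝓝 (∫ p, 0 ∂μ)) := by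
    refine tendsto_integral_of_dominated_convergence _ (fun n => ?_) hbi (fun n => ae_of_all _ fun p => ?_) (ae_of_all _ fun p => ?_)
    · have h1 : Measurable (fun p : ℝ × Evec N => ‖p.2‖ ^ 2 * q p.1 p.2 ^ 2) := by fun_prop
      exact (h1.mul ((continuous_bt2 (hδ n)).measurable.comp hu')).aestronglyMeasurable
    · rw [Real.norm_of_nonneg (mul_nonneg (by positivity) (bt2_nonneg _ _)), mul_assoc]
      refine mul_le_mul_of_nonneg_left ?_ (by positivity)
      have h1 : q p.1 p.2 ^ 2 ≤ b p.1 p.2 ^ 2 * u p.1 p.2 ^ 2 := by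
        have h := pow_le_pow_left₀ (abs_nonneg _) (hqu p.1 p.2) 2
        rwa [sq_abs, mul_pow, sq_abs] at h
      calc q p.1 p.2 ^ 2 * bt2 (δn n) (u p.1 p.2) ≤ b p.1 p.2 ^ 2 * u p.1 p.2 ^ 2 * bt2 (δn n) (u p.1 p.2) :=
            mul_le_mul_of_nonneg_right h1 (bt2_nonneg _ _)
        _ = b p.1 p.2 ^ 2 * (bt2 (δn n) (u p.1 p.2) * u p.1 p.2 ^ 2) := by ring
        _ ≤ _ := mul_le_mul_of_nonneg_left (bt2_mul_sq_le (hδ n) _) (sq_nonneg _)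
    · by_cases h0 : u p.1 p.2 = 0
      · have h1 := hqu p.1 p.2
        rw [h0, abs_zero, mul_zero] at h1
        have h2 : q p.1 p.2 = 0 := abs_eq_zero.1 (le_antisymm h1 (abs_nonneg _))
        simp [h2]
      · have := ((bt2_tendsto _ h0).comp hδl).const_mul (‖p.2‖ ^ 2 * q p.1 p.2 ^ 2)
        rw [mul_zero] at this
        exact this
  rw [integral_zero] at key
  have hbt : ∀ x : ℝ, Tendsto (fun n => bt (δn n) x) atTop (𝓝 |x|) := fun x => by
    have h1 : Tendsto (fun n => |x| - δn n) atTop (𝓝 |x|) := by simpa using hδl.const_sub |x|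
    exact tendsto_of_tendsto_of_tendsto_of_le_of_le h1 tendsto_const_nhds (fun n => le_bt x) (fun n => bt_le (hδ n) x)
  calc ∫⁻ y, ENNReal.ofReal |u T y| = ∫⁻ y, liminf (fun n => ENNReal.ofReal (bt (δn n) (u T y))) atTop := by
        congr 1; ext y
        exact ((ENNReal.continuous_ofReal.tendsto _).comp (hbt (u T y))).liminf_eq.symm
    _ ≤ liminf (fun n => ∫⁻ y, ENNReal.ofReal (bt (δn n) (u T y))) atTop :=
        lintegral_liminf_le fun n => ((continuous_bt _).measurable.comp (hum.comp measurable_prodMk_left)).ennreal_ofReal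
    _ ≤ liminf (fun n => ENNReal.ofReal ((∫ y, |u0 y|) +
      (1 / 4) * ∫ p, (‖p.2‖ ^ 2 * q p.1 p.2 ^ 2) * bt2 (δn n) (u p.1 p.2) ∂μ)) atTop :=
        liminf_le_liminf (Eventually.of_forall hE)
    _ = _ := by
        have := (ENNReal.continuous_ofReal.tendsto _).comp ((key.const_mul (1 / 4)).const_add (∫ y, |u0 y|))
        rw [mul_zero, add_zero] at this
        exact this.liminf_eq

end Core2

section Rep
variable {N : ℕ}

lemma ups_bounds {p m M : ℝ} (hm : 1 ≤ m) (hp : 2 ≤ p) (hM : 0 ≤ M) {f : Evec N → ℝ}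
    (hf : AEStronglyMeasurable f volume) (h : UpsilonNorm N p m f ≤ ENNReal.ofReal M) :
    (∀ᵐ v, |f v| ≤ M) ∧ Integrable f ∧ Integrable (fun v => ‖v‖ * |f v|) ∧ (∫ v, ‖v‖ * |f v| ≤ M) ∧
    Integrable (fun v => ‖v‖ ^ 2 * f v ^ 2) ∧ ∫ v, ‖v‖ ^ 2 * f v ^ 2 ≤ M + M ^ p := by
  unfold UpsilonNorm at h
  have h1 := (le_max_left _ _).trans h
  have h2 := ((le_max_left _ _).trans (le_max_right _ _)).trans h
  have h3 := ((le_max_right _ _).trans (le_max_right _ _)).trans h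
  unfold wLpNorm at h2 h3
  have a1 : ∀ᵐ v, |f v| ≤ M := by
    rw [eLpNorm_exponent_top] at h1
    filter_upwards [ae_le_eLpNormEssSup (f := f) (μ := volume)] with v hv
    have := hv.trans h1
    rw [← ofReal_norm, ENNReal.ofReal_le_ofReal_iff hM] at this
    exact this
  have m1 : AEStronglyMeasurable (fun v : Evec N => (1 + ‖v‖ ^ (1:ℝ)) * f v) volume := by
    refine AEStronglyMeasurable.mul ?_ hf
    exact (by fun_prop : Measurable fun v : Evec N => 1 + ‖v‖ ^ (1:ℝ)).aestronglyMeasurable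
  have m2 : AEStronglyMeasurable (fun v : Evec N => (1 + ‖v‖ ^ m) * f v) volume := by
    refine AEStronglyMeasurable.mul ?_ hf
    exact (by fun_prop : Measurable fun v : Evec N => 1 + ‖v‖ ^ m).aestronglyMeasurable
  have i1 : Integrable (fun v : Evec N => (1 + ‖v‖ ^ (1:ℝ)) * f v) :=
    memLp_one_iff_integrable.1 ⟨m1, h2.trans_lt ENNReal.ofReal_lt_top⟩
  have b1 : ∫ v : Evec N, |(1 + ‖v‖ ^ (1:ℝ)) * f v| ≤ M := by
    rw [eLpNorm_one_eq_lintegral_enorm] at h2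
    have := integral_norm_eq_lintegral_enorm m1
    simp only [Real.norm_eq_abs] at this
    rw [this]
    exact ENNReal.toReal_le_of_le_ofReal hM h2
  have hnm : AEStronglyMeasurable (fun v : Evec N => ‖v‖ * |f v|) volume :=
    (by fun_prop : Measurable fun v : Evec N => ‖v‖).aestronglyMeasurable.mul hf.norm
  have c1 : ∀ v : Evec N, ‖v‖ * |f v| ≤ |(1 + ‖v‖ ^ (1:ℝ)) * f v| := fun v => by
    rw [Real.rpow_one, abs_mul, abs_of_nonneg (by positivity : 0 ≤ 1 + ‖v‖)]
    nlinarith [abs_nonneg (f v)]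
  have i2 : Integrable (fun v => ‖v‖ * |f v|) :=
    i1.abs.mono' hnm (ae_of_all _ fun v => by rw [Real.norm_of_nonneg (by positivity)]; exact c1 v)
  have i3 : Integrable f := i1.abs.mono' hf (ae_of_all _ fun v => by
    rw [Real.rpow_one, abs_mul, abs_of_nonneg (by positivity : 0 ≤ 1 + ‖v‖), Real.norm_eq_abs]
    nlinarith [mul_nonneg (norm_nonneg v) (abs_nonneg (f v))])
  have b2 : ∫ v, ‖v‖ * |f v| ≤ M := (integral_mono i2 i1.abs c1).trans b1
  -- the weighted p norm
  have hp0 : 0 < p := by linarith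
  have mem : MemLp (fun v : Evec N => (1 + ‖v‖ ^ m) * f v) (ENNReal.ofReal p) := ⟨m2, h3.trans_lt ENNReal.ofReal_lt_top⟩
  have i4 : Integrable (fun v : Evec N => |(1 + ‖v‖ ^ m) * f v| ^ p) := by
    have := mem.integrable_norm_rpow (by simpa using hp0) ENNReal.ofReal_ne_top
    rwa [ENNReal.toReal_ofReal hp0.le] at this
  have b4 : ∫ v : Evec N, |(1 + ‖v‖ ^ m) * f v| ^ p ≤ M ^ p := by
    rw [mem.eLpNorm_eq_integral_rpow_norm (by simpa using hp0) ENNReal.ofReal_ne_top,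
      ENNReal.toReal_ofReal hp0.le, ENNReal.ofReal_le_ofReal_iff hM] at h3
    have h0 : 0 ≤ ∫ v : Evec N, ‖(1 + ‖v‖ ^ m) * f v‖ ^ p := integral_nonneg fun v => by positivity
    have := Real.rpow_le_rpow (by positivity) h3 hp0.le
    rwa [← Real.rpow_mul h0, inv_mul_cancel₀ hp0.ne', Real.rpow_one] at this
  have c4 : ∀ v : Evec N, ‖v‖ ^ 2 * f v ^ 2 ≤ ‖v‖ * |f v| + |(1 + ‖v‖ ^ m) * f v| ^ p := fun v => by
    have hx0 : 0 ≤ ‖v‖ * |f v| := by positivity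
    have e : ‖v‖ ^ 2 * f v ^ 2 = (‖v‖ * |f v|) ^ 2 := by rw [mul_pow, sq_abs]
    rw [e]
    rcases le_total (‖v‖ * |f v|) 1 with h | h
    · have : 0 ≤ |(1 + ‖v‖ ^ m) * f v| ^ p := by positivity
      nlinarith
    · have hv : ‖v‖ ≤ 1 + ‖v‖ ^ m := by
        rcases le_total ‖v‖ 1 with h | h
        · have : 0 ≤ ‖v‖ ^ m := by positivity
          linarith
        · have := Real.rpow_le_rpow_of_exponent_le h hm
          rw [Real.rpow_one] at this
          linarith
      have : (‖v‖ * |f v|) ^ 2 ≤ |(1 + ‖v‖ ^ m) * f v| ^ p := by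
        calc (‖v‖ * |f v|) ^ 2 = (‖v‖ * |f v|) ^ (2:ℝ) := by norm_cast
          _ ≤ (‖v‖ * |f v|) ^ p := Real.rpow_le_rpow_of_exponent_le h hp
          _ ≤ _ := by
            refine Real.rpow_le_rpow hx0 ?_ hp0.le
            rw [abs_mul, abs_of_nonneg (by positivity : 0 ≤ 1 + ‖v‖ ^ m)]
            exact mul_le_mul_of_nonneg_right hv (abs_nonneg _)
      linarith
  have hm4 : AEStronglyMeasurable (fun v : Evec N => ‖v‖ ^ 2 * f v ^ 2) volume :=
    (by fun_prop : Measurable fun v : Evec N => ‖v‖ ^ 2).aestronglyMeasurable.mul (hf.pow 2)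
  have i5 : Integrable (fun v => ‖v‖ ^ 2 * f v ^ 2) :=
    (i2.add i4).mono' hm4 (ae_of_all _ fun v => by rw [Real.norm_of_nonneg (by positivity)]; exact c4 v)
  refine ⟨a1, i3, i2, b2, i5, (integral_mono i5 (i2.add i4) c4).trans ?_⟩
  have : ∫ v : Evec N, ((fun v => ‖v‖ * |f v|) + fun v : Evec N => |(1 + ‖v‖ ^ m) * f v| ^ p) v
      = (∫ v, ‖v‖ * |f v|) + ∫ v : Evec N, |(1 + ‖v‖ ^ m) * f v| ^ p := integral_add i2 i4
  rw [this]
  linarith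

lemma ups_add {p m : ℝ} (hp : 2 ≤ p) {f g : Evec N → ℝ}
    (hf : AEStronglyMeasurable f volume) (hg : AEStronglyMeasurable g volume) :
    UpsilonNorm N p m f ≤ UpsilonNorm N p m (fun v => f v - g v) + UpsilonNorm N p m g := by
  have hw : ∀ r : ℝ, AEStronglyMeasurable (fun v : Evec N => 1 + ‖v‖ ^ r) volume := fun r =>
    (by fun_prop : Measurable fun v : Evec N => 1 + ‖v‖ ^ r).aestronglyMeasurable
  have key : ∀ (P : ℝ≥0∞) (r : ℝ), 1 ≤ P → wLpNorm N P r f ≤ wLpNorm N P r (fun v => f v - g v) + wLpNorm N P r g := by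
    intro P r hP
    unfold wLpNorm
    have := eLpNorm_add_le (p := P) ((hw r).mul (hf.sub hg)) ((hw r).mul hg) hP
    refine le_trans (le_of_eq ?_) this
    congr 1; ext v
    simp only [Pi.add_apply, Pi.mul_apply, Pi.sub_apply]; ring
  have k1 : eLpNorm f ⊤ volume ≤ eLpNorm (fun v => f v - g v) ⊤ volume + eLpNorm g ⊤ volume := by
    have := eLpNorm_add_le (p := ⊤) (hf.sub hg) hg le_top
    refine le_trans (le_of_eq ?_) this
    congr 1; ext v
    simp
  have hP : 1 ≤ ENNReal.ofReal p := by
    rw [← ENNReal.ofReal_one]; exact ENNReal.ofReal_le_ofReal (by linarith)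
  unfold UpsilonNorm
  refine max_le ?_ (max_le ?_ ?_)
  · exact k1.trans (add_le_add (le_max_left _ _) (le_max_left _ _))
  · exact (key 1 1 le_rfl).trans (add_le_add ((le_max_left _ _).trans (le_max_right _ _)) ((le_max_left _ _).trans (le_max_right _ _)))
  · exact (key _ m hP).trans (add_le_add ((le_max_right _ _).trans (le_max_right _ _)) ((le_max_right _ _).trans (le_max_right _ _)))

lemma ups_unif {p m T : ℝ} (hp : 2 ≤ p) {f : ℝ → Evec N → ℝ}
    (hf : ∀ t ∈ Set.Icc (0:ℝ) T, MemUpsilon N p m (f t)) (hc : ContinuousInUpsilon N p m T f) :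
    ∃ M : ℝ, 0 ≤ M ∧ ∀ t ∈ Set.Icc (0:ℝ) T, UpsilonNorm N p m (f t) ≤ ENNReal.ofReal M := by
  have : ∃ M : ℝ≥0∞, M ≠ ⊤ ∧ ∀ t ∈ Set.Icc (0:ℝ) T, UpsilonNorm N p m (f t) ≤ M := by
    refine (isCompact_Icc (a := (0:ℝ)) (b := T)).induction_on
      (p := fun s => ∃ M : ℝ≥0∞, M ≠ ⊤ ∧ ∀ t ∈ s, UpsilonNorm N p m (f t) ≤ M) ⟨0, by simp, by simp⟩ ?_ ?_ ?_
    · rintro s t hst ⟨M, h1, h2⟩; exact ⟨M, h1, fun x hx => h2 x (hst hx)⟩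
    · rintro s t ⟨M, h1, h2⟩ ⟨M', h1', h2'⟩
      refine ⟨max M M', (max_lt h1.lt_top h1'.lt_top).ne, ?_⟩
      rintro x (hx | hx)
      · exact (h2 x hx).trans (le_max_left _ _)
      · exact (h2' x hx).trans (le_max_right _ _)
    · intro t₀ ht₀
      obtain ⟨δ, hδ, h⟩ := hc t₀ ht₀ 1 one_pos
      refine ⟨Set.Icc 0 T ∩ Metric.ball t₀ δ, ?_, ENNReal.ofReal 1 + UpsilonNorm N p m (f t₀), ?_, ?_⟩
      · exact Filter.inter_mem self_mem_nhdsWithin (mem_nhdsWithin_of_mem_nhds (Metric.ball_mem_nhds _ hδ))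
      · obtain ⟨_, a, b, c⟩ := hf t₀ ht₀
        exact (ENNReal.add_lt_top.2 ⟨ENNReal.ofReal_lt_top, max_lt a (max_lt b c)⟩).ne
      · rintro t ⟨ht, ht'⟩
        refine (ups_add hp (hf t ht).1 (hf t₀ ht₀).1).trans (add_le_add_left (h t ht ?_).le _)
        simpa [Real.dist_eq] using ht'
  obtain ⟨M, h1, h2⟩ := this
  exact ⟨M.toReal, ENNReal.toReal_nonneg, by rwa [ENNReal.ofReal_toReal h1]⟩

lemma joint_rep {p m T : ℝ} (hp : 2 ≤ p) {f : ℝ → Evec N → ℝ}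
    (hf : ∀ t ∈ Set.Icc (0:ℝ) T, MemUpsilon N p m (f t)) (hc : ContinuousInUpsilon N p m T f) :
    ∃ F : ℝ → Evec N → ℝ, Measurable (Function.uncurry F) ∧ ∀ t ∈ Set.Icc (0:ℝ) T, F t =ᵐ[volume] f t := by
  classical
  have hd1 : ∀ h : Evec N → ℝ, AEStronglyMeasurable h volume → eLpNorm h 1 volume ≤ UpsilonNorm N p m h := by
    intro h hh
    refine le_trans ?_ ((le_max_left _ _).trans (le_max_right _ _))
    refine eLpNorm_mono fun v => ?_
    rw [norm_mul, Real.rpow_one, Real.norm_of_nonneg (by positivity : 0 ≤ 1 + ‖v‖)]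
    nlinarith [mul_nonneg (norm_nonneg v) (norm_nonneg (h v))]
  have hmem : ∀ t : Set.Icc (0:ℝ) T, MemLp (f t) 1 := fun t => by
    obtain ⟨h0, a, b, c⟩ := hf t t.2
    exact ⟨h0, (hd1 _ h0).trans_lt (max_lt a (max_lt b c))⟩
  set Φ : Set.Icc (0:ℝ) T → Lp ℝ 1 (volume : Measure (Evec N)) := fun t => (hmem t).toLp with hΦ
  have hdist : ∀ s t : Set.Icc (0:ℝ) T, edist (Φ s) (Φ t) = eLpNorm (fun v => f s v - f t v) 1 volume := fun s t => by
    simp only [hΦ, Lp.edist_toLp_toLp]; rfl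
  have hΦc : Continuous Φ := by
    rw [continuous_iff_continuousAt]
    intro t₀
    rw [ContinuousAt, EMetric.tendsto_nhds]
    intro ε hε
    obtain ⟨ε', hε', hεε⟩ := ENNReal.lt_iff_exists_nnreal_btwn.1 hε
    have he0 : (0:ℝ) < ε' := by exact_mod_cast hε'
    obtain ⟨δ, hδ, h⟩ := hc t₀ t₀.2 ε' he0
    filter_upwards [Metric.ball_mem_nhds t₀ hδ] with t ht
    rw [hdist]
    have h2 := h t t.2 (by simpa [Subtype.dist_eq, Real.dist_eq] using ht)
    rw [ENNReal.ofReal_coe_nnreal] at h2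
    exact ((hd1 _ ((hmem t).1.sub (hmem t₀).1)).trans_lt h2).trans hεε
  have hΦu := CompactSpace.uniformContinuous_of_continuous hΦc
  have hδ : ∀ n : ℕ, ∃ δ > 0, ∀ s t : Set.Icc (0:ℝ) T, dist s t < δ → edist (Φ s) (Φ t) < (2:ℝ≥0∞)⁻¹ ^ n := by
    intro n
    rw [Metric.uniformContinuous_iff] at hΦu
    obtain ⟨δ, hδ, h⟩ := hΦu ((2:ℝ)⁻¹ ^ n) (by positivity)
    refine ⟨δ, hδ, fun s t hst => ?_⟩
    have := h hst
    rw [edist_dist]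
    have e : (2:ℝ≥0∞)⁻¹ ^ n = ENNReal.ofReal ((2:ℝ)⁻¹ ^ n) := by
      rw [ENNReal.ofReal_pow (by norm_num), ENNReal.ofReal_inv_of_pos (by norm_num)]; norm_num
    rw [e]
    exact (ENNReal.ofReal_lt_ofReal_iff (by positivity)).2 this
  choose δ hδ0 hδ using hδ
  set fh : ℝ → Evec N → ℝ := fun t => if h : t ∈ Set.Icc (0:ℝ) T then (hf t h).1.mk (f t) else 0 with hfh
  have hfm : ∀ t, Measurable (fh t) := fun t => by
    simp only [hfh]
    split_ifs with h
    · exact (hf t h).1.stronglyMeasurable_mk.measurable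
    · exact measurable_const
  have hfe : ∀ t ∈ Set.Icc (0:ℝ) T, fh t =ᵐ[volume] f t := fun t h => by
    simp only [hfh, h, dif_pos]
    exact (hf t h).1.ae_eq_mk.symm
  set Fn : ℕ → ℝ × Evec N → ℝ := fun n x => fh ((⌊x.1 / (δ n / 2)⌋₊ : ℝ) * (δ n / 2)) x.2 with hFn
  have hFm : ∀ n, Measurable (Fn n) := fun n => by
    have h1 : Measurable (fun x : ℕ × Evec N => fh ((x.1 : ℝ) * (δ n / 2)) x.2) :=
      measurable_from_prod_countable_right fun k => hfm ((k : ℝ) * (δ n / 2))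
    have h2 : Measurable (fun x : ℝ × Evec N => ((⌊x.1 / (δ n / 2)⌋₊ : ℕ), x.2)) := by
      refine Measurable.prodMk ?_ measurable_snd
      exact Nat.measurable_floor.comp (measurable_fst.div_const _)
    exact h1.comp h2
  refine ⟨fun t v => limUnder atTop (fun n => Fn n (t, v)), ?_, fun t ht => ?_⟩
  · exact (StronglyMeasurable.limUnder (l := atTop) (fun n => (hFm n).stronglyMeasurable)).measurable
  · have hb : ∀ n, eLpNorm (fun v => Fn n (t, v) - f t v) 1 volume ≤ (2:ℝ≥0∞)⁻¹ ^ n := by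
      intro n
      have hh := hδ0 n
      have hfl := Nat.floor_le (div_nonneg ht.1 (by linarith : 0 ≤ δ n / 2))
      have hfl2 := Nat.lt_floor_add_one (t / (δ n / 2))
      set τ : ℝ := (⌊t / (δ n / 2)⌋₊ : ℝ) * (δ n / 2) with hτ
      have l1 : τ ≤ t := (le_div_iff₀ (by linarith)).1 hfl
      have l2 : t < τ + δ n / 2 := by
        have := (div_lt_iff₀ (by linarith : 0 < δ n / 2)).1 hfl2
        rw [hτ]; linarith
      have l0 : 0 ≤ τ := by positivity
      have hτm : τ ∈ Set.Icc (0:ℝ) T := ⟨l0, l1.trans ht.2⟩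
      have h3 := hδ n ⟨τ, hτm⟩ ⟨t, ht⟩ (by
        rw [Subtype.dist_eq, Real.dist_eq, abs_lt]; constructor <;> simp only <;> linarith)
      rw [hdist] at h3
      refine le_trans (le_of_eq ?_) h3.le
      refine eLpNorm_congr_ae ?_
      filter_upwards [hfe τ hτm] with v hv
      show fh τ v - _ = _
      rw [hv]
    have hmn : ∀ n, AEMeasurable (fun v => ‖Fn n (t, v) - f t v‖ₑ) volume := fun n =>
      ((((hFm n).comp measurable_prodMk_left).aestronglyMeasurable).sub (hf t ht).1).enorm
    have hsum : ∫⁻ v, ∑' n, ‖Fn n (t, v) - f t v‖ₑ ≠ ⊤ := by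
      rw [lintegral_tsum hmn]
      refine ne_top_of_le_ne_top (b := ∑' n : ℕ, (2:ℝ≥0∞)⁻¹ ^ n) ?_ (ENNReal.tsum_le_tsum fun n => ?_)
      · rw [ENNReal.tsum_geometric]; simp
      · rw [← eLpNorm_one_eq_lintegral_enorm]; exact hb n
    filter_upwards [ae_lt_top' (AEMeasurable.ennreal_tsum hmn) hsum] with v hv
    have h0 := ENNReal.tendsto_atTop_zero_of_tsum_ne_top hv.ne
    refine Tendsto.limUnder_eq ?_
    rw [tendsto_iff_edist_tendsto_0]
    simpa [edist_eq_enorm_sub] using h0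

end Rep

section Resc
variable {N : ℕ}

structure UProp (T M : ℝ) (U : ℝ → Evec N → ℝ) : Prop where
  M0 : 0 ≤ M
  meas : Measurable (Function.uncurry U)
  bd : ∀ s z, |U s z| ≤ M
  zero : ∀ s, s ∉ Set.Icc 0 T → ∀ z, U s z = 0
  i1 : ∀ s, Integrable (fun z => ‖z‖ * |U s z|)
  b1 : ∀ s, ∫ z, ‖z‖ * |U s z| ≤ M
  i2 : ∀ s, Integrable (fun z => ‖z‖ ^ 2 * U s z ^ 2)
  b2 : ∀ s, ∫ z, ‖z‖ ^ 2 * U s z ^ 2 ≤ M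

lemma UProp.mono {T M M' : ℝ} {U : ℝ → Evec N → ℝ} (h : UProp T M U) (hM : M ≤ M') : UProp T M' U :=
  ⟨h.M0.trans hM, h.meas, fun s z => (h.bd s z).trans hM, h.zero, h.i1, fun s => (h.b1 s).trans hM, h.i2, fun s => (h.b2 s).trans hM⟩

lemma prod_int {T M : ℝ} {U : ℝ → Evec N → ℝ} (h : UProp T M U) (T' : ℝ) :
    Integrable (fun p : ℝ × Evec N => ‖p.2‖ ^ 2 * U p.1 p.2 ^ 2) ((volume.restrict (Set.Ioc 0 T')).prod volume) := by
  have hm : Measurable (fun p : ℝ × Evec N => U p.1 p.2) := h.meas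
  have hm2 : Measurable (fun p : ℝ × Evec N => ‖p.2‖ ^ 2 * U p.1 p.2 ^ 2) := by fun_prop
  rw [integrable_prod_iff hm2.aestronglyMeasurable]
  refine ⟨ae_of_all _ fun s => h.i2 s, ?_⟩
  refine Integrable.of_bound (C := M) ?_ (ae_of_all _ fun s => ?_)
  · exact hm2.norm.stronglyMeasurable.integral_prod_right.aestronglyMeasurable
  · rw [Real.norm_of_nonneg (integral_nonneg fun _ => norm_nonneg _)]
    refine le_trans (le_of_eq ?_) (h.b2 s)
    congr 1; ext z
    rw [Real.norm_of_nonneg (by positivity)]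

lemma resc_int {s : ℝ} {φ : Evec N → ℝ} : ∫ z, φ (exp (-s) • z) = exp (N * s) * ∫ v, φ v := by
  rw [Measure.integral_comp_smul, finrank_euclideanSpace_fin, smul_eq_mul, ← Real.exp_nat_mul, ← Real.exp_neg,
    abs_of_pos (Real.exp_pos _)]
  congr 2; ring

lemma norm_resc (s : ℝ) (z : Evec N) : ‖z‖ = exp s * ‖exp (-s) • z‖ := by
  rw [norm_smul, Real.norm_of_nonneg (Real.exp_pos _).le, ← mul_assoc, ← Real.exp_add]; simp

lemma resc {p m T : ℝ} (hT : 0 < T) (hm : 1 ≤ m) (hp : 2 ≤ p) {f : ℝ → Evec N → ℝ}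
    (hf : ∀ t ∈ Set.Icc (0:ℝ) T, MemUpsilon N p m (f t)) (hc : ContinuousInUpsilon N p m T f) :
    ∃ M U, UProp T M U ∧ ∀ s ∈ Set.Icc (0:ℝ) T, U s =ᵐ[volume] fun z : Evec N => exp (-(N * s)) * f s (exp (-s) • z) := by
  classical
  obtain ⟨M, hM0, hM⟩ := ups_unif hp hf hc
  obtain ⟨F, hFm, hF⟩ := joint_rep hp hf hc
  set G : ℝ → Evec N → ℝ := fun t v => if t ∈ Set.Icc (0:ℝ) T then max (-M) (min M (F t v)) else 0 with hG
  have hGm : Measurable (Function.uncurry G) := by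
    refine Measurable.ite (measurable_fst measurableSet_Icc) ?_ measurable_const
    exact measurable_const.max (measurable_const.min hFm)
  have hGb : ∀ t v, |G t v| ≤ M := fun t v => by
    simp only [hG]
    split_ifs
    · rw [abs_le]; exact ⟨le_max_left _ _, max_le (by linarith) (min_le_left _ _)⟩
    · simpa using hM0
  have hB := fun t ht => ups_bounds hm hp hM0 (hf t ht).1 (hM t ht)
  have hGf : ∀ t ∈ Set.Icc (0:ℝ) T, G t =ᵐ[volume] f t := fun t ht => by
    filter_upwards [hF t ht, (hB t ht).1] with v h1 h2
    simp only [hG, ht, if_true, h1]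
    rw [abs_le] at h2
    rw [min_eq_right h2.2, max_eq_right h2.1]
  have hG0 : ∀ t, t ∉ Set.Icc (0:ℝ) T → ∀ v, G t v = 0 := fun t ht v => by simp only [hG, ht, if_false]
  set U : ℝ → Evec N → ℝ := fun s z => exp (-(N * s)) * G s (exp (-s) • z) with hU
  have hMp : 0 ≤ M ^ p := by positivity
  have hexp1 : ∀ s ∈ Set.Icc (0:ℝ) T, exp (-(N * s)) ≤ 1 := fun s hs => by
    rw [Real.exp_le_one_iff]; have := mul_nonneg (Nat.cast_nonneg (α := ℝ) N) hs.1; linarith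
  have hUz : ∀ s, s ∉ Set.Icc (0:ℝ) T → ∀ z, U s z = 0 := fun s hs z => by simp only [hU, hG0 s hs, mul_zero]
  have e1 : ∀ s z, ‖z‖ * |U s z| = exp s * exp (-(N * s)) * (fun v => ‖v‖ * |G s v|) (exp (-s) • z) := fun s z => by
    simp only [hU]
    rw [abs_mul, abs_of_pos (Real.exp_pos _), norm_resc s z]; ring
  have e2 : ∀ s z, ‖z‖ ^ 2 * U s z ^ 2 = exp s ^ 2 * exp (-(N * s)) ^ 2 * (fun v => ‖v‖ ^ 2 * G s v ^ 2) (exp (-s) • z) := fun s z => by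
    simp only [hU]
    rw [norm_resc s z]; ring
  have j1 : ∀ s ∈ Set.Icc (0:ℝ) T, Integrable (fun v => ‖v‖ * |G s v|) := fun s hs =>
    (hB s hs).2.2.1.congr (by filter_upwards [hGf s hs] with v hv; rw [hv])
  have j1' : ∀ s ∈ Set.Icc (0:ℝ) T, ∫ v, ‖v‖ * |G s v| ≤ M := fun s hs => by
    refine le_trans (le_of_eq (integral_congr_ae ?_)) (hB s hs).2.2.2.1
    filter_upwards [hGf s hs] with v hv; rw [hv]
  have j2 : ∀ s ∈ Set.Icc (0:ℝ) T, Integrable (fun v => ‖v‖ ^ 2 * G s v ^ 2) := fun s hs =>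
    (hB s hs).2.2.2.2.1.congr (by filter_upwards [hGf s hs] with v hv; rw [hv])
  have j2' : ∀ s ∈ Set.Icc (0:ℝ) T, ∫ v, ‖v‖ ^ 2 * G s v ^ 2 ≤ M + M ^ p := fun s hs => by
    refine le_trans (le_of_eq (integral_congr_ae ?_)) (hB s hs).2.2.2.2.2
    filter_upwards [hGf s hs] with v hv; rw [hv]
  have hne : ∀ s : ℝ, exp (-s) ≠ 0 := fun s => (Real.exp_pos _).ne'
  have hTb : ∀ s ∈ Set.Icc (0:ℝ) T, exp s ≤ exp T := fun s hs => Real.exp_le_exp.2 hs.2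
  have hEpos := Real.exp_pos T
  set M' := M + exp T * M + exp T ^ 2 * (M + M ^ p) with hM'
  have hp1 : 0 ≤ exp T * M := by positivity
  have hp2 : 0 ≤ exp T ^ 2 * (M + M ^ p) := by positivity
  have hM'0 : 0 ≤ M' := by positivity
  refine ⟨M', U, ⟨hM'0, ?_, ?_, hUz, ?_, ?_, ?_, ?_⟩, ?_⟩
  · have h1 : Measurable (fun x : ℝ × Evec N => G x.1 (exp (-x.1) • x.2)) :=
      hGm.comp (by fun_prop : Measurable fun x : ℝ × Evec N => (x.1, exp (-x.1) • x.2))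
    have h2 : Measurable (fun x : ℝ × Evec N => exp (-(N * x.1))) := by fun_prop
    exact h2.mul h1
  · intro s z
    by_cases hs : s ∈ Set.Icc (0:ℝ) T
    · simp only [hU]
      rw [abs_mul, abs_of_pos (Real.exp_pos _)]
      have := hGb s (exp (-s) • z)
      have h3 := hexp1 s hs
      nlinarith [abs_nonneg (G s (exp (-s) • z))]
    · rw [hUz s hs, abs_zero]; exact hM'0
  · intro s
    by_cases hs : s ∈ Set.Icc (0:ℝ) T
    · simp only [e1]
      exact ((j1 s hs).comp_smul (hne s)).const_mul _
    · simp [hUz s hs]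
  · intro s
    by_cases hs : s ∈ Set.Icc (0:ℝ) T
    · simp only [e1]
      rw [integral_const_mul, resc_int (φ := fun v => ‖v‖ * |G s v|)]
      have h0 : 0 ≤ ∫ v, ‖v‖ * |G s v| := integral_nonneg fun v => by positivity
      have h1 := j1' s hs
      have h2 := hTb s hs
      have e3 : exp s * exp (-(N * s)) * (exp (N * s) * ∫ v, ‖v‖ * |G s v|) = exp s * ∫ v, ‖v‖ * |G s v| := by
        rw [Real.exp_neg]; field_simp
      rw [e3]
      have := mul_le_mul h2 h1 h0 hEpos.le
      linarith
    · simp [hUz s hs, hM'0]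
  · intro s
    by_cases hs : s ∈ Set.Icc (0:ℝ) T
    · simp only [e2]
      exact ((j2 s hs).comp_smul (hne s)).const_mul _
    · simp [hUz s hs]
  · intro s
    by_cases hs : s ∈ Set.Icc (0:ℝ) T
    · simp only [e2]
      rw [integral_const_mul, resc_int (φ := fun v => ‖v‖ ^ 2 * G s v ^ 2)]
      have h0 : 0 ≤ ∫ v, ‖v‖ ^ 2 * G s v ^ 2 := integral_nonneg fun v => by positivity
      have h1 := j2' s hs
      have h2 := pow_le_pow_left₀ (Real.exp_pos s).le (hTb s hs) 2
      have h4 := hexp1 s hs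
      have e3 : exp s ^ 2 * exp (-(N * s)) ^ 2 * (exp (N * s) * ∫ v, ‖v‖ ^ 2 * G s v ^ 2) = exp (-(N * s)) * (exp s ^ 2 * ∫ v, ‖v‖ ^ 2 * G s v ^ 2) := by
        rw [Real.exp_neg]; field_simp
      rw [e3]
      have h5 := mul_le_mul h2 h1 h0 (by positivity : 0 ≤ exp T ^ 2)
      have h6 : 0 ≤ exp s ^ 2 * ∫ v, ‖v‖ ^ 2 * G s v ^ 2 := by positivity
      nlinarith
    · simp [hUz s hs, hM'0]
  · intro s hs
    have h1 := (Measure.quasiMeasurePreserving_smul (volume : Measure (Evec N)) (hne s)).ae (hGf s hs)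
    filter_upwards [h1] with z hz
    simp only [hU]
    rw [hz]

end Resc

section Mild
variable {N : ℕ}

lemma FP_eq (t : ℝ) (v w : Evec N) : FPkernel N t v w = exp (N * t) * Gk (exp (2 * t) - 1) (exp t • v - w) := by
  unfold FPkernel Gk; ring

lemma grad_FP (τ : ℝ) (v w : Evec N) :
    inner ℝ (gradient (fun u => FPkernel N τ u w) v) w =
      exp τ * exp (N * τ) * ∑ j, G1 j (exp (2 * τ) - 1) (exp τ • v - w) * w j := by
  unfold gradient
  rw [InnerProductSpace.toDual_symm_apply]
  set ν := exp (2 * τ) - 1 with hν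
  have h1 : HasFDerivAt (fun u : Evec N => exp τ • u - w) (exp τ • ContinuousLinearMap.id ℝ (Evec N)) v :=
    ((hasFDerivAt_id v).const_smul (exp τ)).sub_const w
  have h2 := (h1.norm_sq.const_mul (-(1 / (2 * ν)))).exp.const_mul (exp (N * τ) * (2 * π * ν) ^ (-(N : ℝ) / 2))
  have h3 : (fun u => FPkernel N τ u w) = fun u => exp (N * τ) * (2 * π * ν) ^ (-(N : ℝ) / 2) * exp (-(1 / (2 * ν)) * ‖exp τ • u - w‖ ^ 2) := by
    ext u; unfold FPkernel; congr 2; rw [← hν]; ring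
  rw [h3, h2.fderiv]
  have h4 : ∑ j, G1 j ν (exp τ • v - w) * w j = -(inner ℝ (exp τ • v - w) w / ν) * Gk ν (exp τ • v - w) := by
    unfold G1
    rw [PiLp.inner_apply, Finset.sum_div, ← Finset.sum_neg_distrib, Finset.sum_mul]
    refine Finset.sum_congr rfl fun j _ => ?_
    simp; ring
  rw [h4]
  unfold Gk
  have h5 : -(1 / (2 * ν)) * ‖exp τ • v - w‖ ^ 2 = -‖exp τ • v - w‖ ^ 2 / (2 * ν) := by ring
  rw [h5]
  simp [inner_sub_left, inner_smul_left]
  ring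

lemma Gk_scale {ν : ℝ} (hν : 0 < ν) (s : ℝ) (x : Evec N) :
    Gk ν (exp (-s) • x) = exp (N * s) * Gk (exp (2 * s) * ν) x := by
  unfold Gk
  have h1 : (2 * π * (exp (2 * s) * ν)) ^ (-(N : ℝ) / 2) = exp (-(N * s)) * (2 * π * ν) ^ (-(N : ℝ) / 2) := by
    rw [show 2 * π * (exp (2 * s) * ν) = exp (2 * s) * (2 * π * ν) by ring, Real.mul_rpow (Real.exp_pos _).le (by positivity),
      ← Real.exp_mul]
    congr 2; ring
  have h2 : -‖exp (-s) • x‖ ^ 2 / (2 * ν) = -‖x‖ ^ 2 / (2 * (exp (2 * s) * ν)) := by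
    rw [norm_smul, Real.norm_of_nonneg (Real.exp_pos _).le, mul_pow, ← Real.exp_nat_mul]
    have : exp ((2:ℕ) * -s) = (exp (2 * s))⁻¹ := by rw [← Real.exp_neg]; congr 1; push_cast; ring
    rw [this]; field_simp
  rw [h1, h2, Real.exp_neg]
  field_simp

lemma G1_scale (j : Fin N) {ν : ℝ} (hν : 0 < ν) (s : ℝ) (x : Evec N) :
    G1 j ν (exp (-s) • x) = exp s * exp (N * s) * G1 j (exp (2 * s) * ν) x := by
  unfold G1
  rw [Gk_scale hν]
  have : exp (2 * s) = exp s * exp s := by rw [← Real.exp_add]; congr 1; ring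
  rw [this]
  simp only [PiLp.smul_apply, smul_eq_mul, Real.exp_neg]
  field_simp

lemma inner_eq {s t : ℝ} (hst : s < t) (y : Evec N) (φ : Evec N → ℝ) :
    exp (-(N * t)) * (exp (-(t - s)) * ∫ w, inner ℝ (gradient (fun u => FPkernel N (t - s) u w) (exp (-t) • y)) w * φ w ^ 2) =
      ∫ z, ∑ j, G1 j (exp (2 * t) - exp (2 * s)) (y - z) * (z j * (exp (-(N * s)) * φ (exp (-s) • z) ^ 2)) := by
  have hν : 0 < exp (2 * (t - s)) - 1 := by
    have := Real.one_lt_exp_iff.2 (by linarith : 0 < 2 * (t - s)); linarith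
  have h1 := resc_int (s := s) (φ := fun w : Evec N => inner ℝ (gradient (fun u => FPkernel N (t - s) u w) (exp (-t) • y)) w * φ w ^ 2)
  have h2 : ∫ w, inner ℝ (gradient (fun u => FPkernel N (t - s) u w) (exp (-t) • y)) w * φ w ^ 2 =
    exp (-(N * s)) * ∫ z, (fun w : Evec N => inner ℝ (gradient (fun u => FPkernel N (t - s) u w) (exp (-t) • y)) w * φ w ^ 2) (exp (-s) • z) := by
    rw [h1, ← mul_assoc, ← Real.exp_add]; simp
  rw [h2, ← integral_const_mul, ← integral_const_mul, ← integral_const_mul]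
  congr 1; ext z
  beta_reduce
  rw [grad_FP]
  have h3 : exp (t - s) • exp (-t) • y - exp (-s) • z = exp (-s) • (y - z) := by
    rw [smul_smul, ← Real.exp_add, smul_sub]; congr 3; ring
  have h4 : exp (2 * s) * (exp (2 * (t - s)) - 1) = exp (2 * t) - exp (2 * s) := by
    rw [mul_sub, ← Real.exp_add, mul_one]; congr 2; ring
  simp only [h3, G1_scale _ hν, h4]
  rw [Finset.mul_sum, Finset.sum_mul, Finset.mul_sum, Finset.mul_sum, Finset.mul_sum]
  refine Finset.sum_congr rfl fun j _ => ?_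
  simp only [PiLp.smul_apply, smul_eq_mul]
  have h5 : exp (-(N * t)) * exp (-(t - s)) * exp (-(N * s)) * (exp (t - s) * exp (N * (t - s))) * (exp s * exp (N * s)) * exp (-s) = exp (-(N * s)) := by
    simp only [← Real.exp_add]; congr 1; ring
  linear_combination (G1 j (exp (2 * t) - exp (2 * s)) (y - z) * z j * φ (exp (-s) • z) ^ 2) * h5

lemma inner_int (j : Fin N) {r : ℝ} (hr : 0 < r) (y : Evec N) {ρ : Evec N → ℝ} (hρ : Integrable ρ) :
    Integrable (fun z => G1 j r (y - z) * ρ z) := by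
  obtain ⟨C, hC0, hC⟩ := (KB_G1 j).2 r r hr le_rfl
  refine hρ.bdd_mul (c := C) ((integrable_KB (KB_G1 j) hr).comp_sub_left y).1 (ae_of_all _ fun z => ?_)
  refine (hC r ⟨le_rfl, le_rfl⟩ _).trans ?_
  have : exp (-‖y - z‖ ^ 2 / (4 * r)) ≤ 1 := by
    rw [exp_le_one_iff, neg_div]
    have : 0 ≤ ‖y - z‖ ^ 2 / (4 * r) := by positivity
    linarith
  nlinarith

lemma innerG_int {r : ℝ} (hr : 0 < r) (y : Evec N) {ρ : Evec N → ℝ} (hρ : Integrable ρ) :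
    Integrable (fun z => Gk r (y - z) * ρ z) := by
  obtain ⟨C, hC0, hC⟩ := (KB_Gk (N := N)).2 r r hr le_rfl
  refine hρ.bdd_mul (c := C) ((integrable_KB KB_Gk hr).comp_sub_left y).1 (ae_of_all _ fun z => ?_)
  refine (hC r ⟨le_rfl, le_rfl⟩ _).trans ?_
  have : exp (-‖y - z‖ ^ 2 / (4 * r)) ≤ 1 := by
    rw [exp_le_one_iff, neg_div]
    have : 0 ≤ ‖y - z‖ ^ 2 / (4 * r) := by positivity
    linarith
  nlinarith

lemma ae_Ioo (t : ℝ) : ∀ᵐ s : ℝ ∂(volume.restrict (Set.Ioc 0 t)), 0 < s ∧ s < t := by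
  have hne : ∀ᵐ s : ℝ ∂(volume.restrict (Set.Ioc 0 t)), s ≠ t := ae_restrict_of_ae (Measure.ae_ne volume t)
  filter_upwards [ae_restrict_mem measurableSet_Ioc, hne] with s hs hst
  exact ⟨hs.1, lt_of_le_of_ne hs.2 hst⟩

lemma outer_int {C : ℝ} (hC0 : 0 ≤ C) {q : ℝ → Evec N → ℝ} (hq : Measurable (Function.uncurry q)) (hqb : ∀ s z, |q s z| ≤ C)
    (j : Fin N) {t : ℝ} (ht : 0 ≤ t) (y : Evec N) :
    IntegrableOn (fun s => ∫ z, G1 j (exp (2 * t) - exp (2 * s)) (y - z) * rho q j s z) (Set.Ioc 0 t) := by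
  obtain ⟨M, hM0, hM⟩ := G1_conv_bound N C hC0
  refine (int_majorant t M ‖y‖ ht).mono' (inner_meas hq j _ (by fun_prop) y).aestronglyMeasurable ?_
  filter_upwards [ae_Ioo t] with s hs
  have hg := exp_gap hs.1.le hs.2.le
  have hlt : 0 < t - s := by linarith [hs.2]
  refine (hM j _ (fun z => ?_) _ (by linarith) y).trans ?_
  · refine (rho_le q j s z).trans ?_
    rw [mul_comm]; exact mul_le_mul_of_nonneg_right (hqb s z) (norm_nonneg _)
  · have : 0 < √(t - s) := Real.sqrt_pos.2 hlt
    gcongr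

lemma Ulim_sub {C C1 : ℝ} (hC0 : 0 ≤ C) {a b : Evec N → ℝ} (ha : Integrable a) (hb : Integrable b)
    {q1 q2 : ℝ → Evec N → ℝ} (hq1 : Measurable (Function.uncurry q1)) (hqb1 : ∀ s z, |q1 s z| ≤ C)
    (hi1 : ∀ s, Integrable (fun z => ‖z‖ * |q1 s z|)) (hC1 : ∀ s, ∫ z, ‖z‖ * |q1 s z| ≤ C1)
    (hq2 : Measurable (Function.uncurry q2)) (hqb2 : ∀ s z, |q2 s z| ≤ C)
    (hi2 : ∀ s, Integrable (fun z => ‖z‖ * |q2 s z|)) (hC2 : ∀ s, ∫ z, ‖z‖ * |q2 s z| ≤ C1) {t : ℝ} (ht : 0 < t) (y : Evec N) :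
    Ulim (fun w => a w - b w) (fun s z => q1 s z - q2 s z) t y = Ulim a q1 t y - Ulim b q2 t y := by
  unfold Ulim
  have h2 : 0 < exp (2 * t) - 1 := by have := Real.one_lt_exp_iff.2 (by linarith : 0 < 2 * t); linarith
  have e1 : ∫ w, Gk (exp (2 * t) - 1) (y - w) * (a w - b w) =
      (∫ w, Gk (exp (2 * t) - 1) (y - w) * a w) - ∫ w, Gk (exp (2 * t) - 1) (y - w) * b w := by
    rw [← integral_sub (innerG_int h2 y ha) (innerG_int h2 y hb)]
    simp only [mul_sub]
  have e2 : ∀ j, ∫ s in Set.Ioc 0 t, ∫ z, G1 j (exp (2 * t) - exp (2 * s)) (y - z) * rho (fun s z => q1 s z - q2 s z) j s z =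
      (∫ s in Set.Ioc 0 t, ∫ z, G1 j (exp (2 * t) - exp (2 * s)) (y - z) * rho q1 j s z) -
        ∫ s in Set.Ioc 0 t, ∫ z, G1 j (exp (2 * t) - exp (2 * s)) (y - z) * rho q2 j s z := fun j => by
    rw [← integral_sub (outer_int hC0 hq1 hqb1 j ht.le y) (outer_int hC0 hq2 hqb2 j ht.le y)]
    refine integral_congr_ae ?_
    filter_upwards [ae_Ioo t] with s hs
    have hg := exp_gap hs.1.le hs.2.le
    rw [← integral_sub (inner_int j (by linarith [hs.2]) y (rho_int hq1 hi1 hC1 j s).1) (inner_int j (by linarith [hs.2]) y (rho_int hq2 hi2 hC2 j s).1)]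
    congr 1; ext z; unfold rho; ring
  rw [e1]; simp only [e2, Finset.sum_sub_distrib]; ring

def qf (U : ℝ → Evec N → ℝ) (s : ℝ) (z : Evec N) : ℝ := exp (N * s) * U s z ^ 2

lemma qf_le {T M : ℝ} {U : ℝ → Evec N → ℝ} (h : UProp T M U) (s : ℝ) (z : Evec N) :
    |qf U s z| ≤ exp (N * T) * M * |U s z| := by
  unfold qf
  by_cases hs : s ∈ Set.Icc 0 T
  · rw [abs_mul, abs_of_pos (Real.exp_pos _), abs_pow, sq, mul_assoc]
    have h1 : exp (N * s) ≤ exp (N * T) := Real.exp_le_exp.2 (mul_le_mul_of_nonneg_left hs.2 (Nat.cast_nonneg _))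
    exact mul_le_mul h1 (mul_le_mul_of_nonneg_right (h.bd s z) (abs_nonneg _)) (by positivity) (Real.exp_pos _).le
  · rw [h.zero s hs]; simp

lemma qf_props {T M : ℝ} {U : ℝ → Evec N → ℝ} (h : UProp T M U) :
    Measurable (Function.uncurry (qf U)) ∧ (∀ s z, |qf U s z| ≤ exp (N * T) * M * M) ∧
    (∀ s, Integrable (fun z => ‖z‖ * |qf U s z|)) ∧ (∀ s, ∫ z, ‖z‖ * |qf U s z| ≤ exp (N * T) * M * M) := by
  have hE : 0 ≤ exp (N * T) * M := mul_nonneg (Real.exp_pos _).le h.M0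
  have hm : Measurable (fun p : ℝ × Evec N => U p.1 p.2) := h.meas
  have hqm : Measurable (fun p : ℝ × Evec N => qf U p.1 p.2) := by unfold qf; fun_prop
  have c : ∀ s z, ‖z‖ * |qf U s z| ≤ exp (N * T) * M * (‖z‖ * |U s z|) := fun s z => by
    have := mul_le_mul_of_nonneg_left (qf_le h s z) (norm_nonneg z)
    linarith
  have i : ∀ s, Integrable (fun z => ‖z‖ * |qf U s z|) := fun s => by
    have hs : Measurable (fun z => qf U s z) := hqm.comp measurable_prodMk_left
    refine ((h.i1 s).const_mul (exp (N * T) * M)).mono' (measurable_norm.mul hs.norm).aestronglyMeasurable (ae_of_all _ fun z => ?_)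
    rw [Real.norm_of_nonneg (by positivity)]; exact c s z
  refine ⟨hqm, fun s z => (qf_le h s z).trans (mul_le_mul_of_nonneg_left (h.bd s z) hE), i, fun s => ?_⟩
  refine (integral_mono (i s) ((h.i1 s).const_mul (exp (N * T) * M)) (c s)).trans ?_
  rw [integral_const_mul]
  exact mul_le_mul_of_nonneg_left (h.b1 s) hE

lemma mild_Ulim {p m T M : ℝ} {f₀ f0m : Evec N → ℝ} {f U : ℝ → Evec N → ℝ} (hf : IsMildSolution N p m T f₀ f)
    (h : UProp T M U) (hU : ∀ s ∈ Set.Icc (0:ℝ) T, U s =ᵐ[volume] fun z : Evec N => exp (-(N * s)) * f s (exp (-s) • z))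
    (h0 : f0m =ᵐ[volume] f₀) :
    ∀ t ∈ Set.Ioc 0 T, ∀ᵐ y, U t y = Ulim f0m (qf U) t y := by
  intro t ht
  obtain ⟨hqm, hqb, hqi, hqC⟩ := qf_props h
  have hC0 : 0 ≤ exp (N * T) * M * M := mul_nonneg (mul_nonneg (Real.exp_pos _).le h.M0) h.M0
  have h1 := (Measure.quasiMeasurePreserving_smul (volume : Measure (Evec N)) (Real.exp_pos (-t)).ne').ae (hf.2.2.2 t ht)
  filter_upwards [h1, hU t ⟨ht.1.le, ht.2⟩] with y hy hy2
  rw [hy2, hy, mul_add]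
  unfold Ulim
  congr 1
  · rw [← integral_const_mul]
    refine integral_congr_ae ?_
    filter_upwards [h0] with w hw
    rw [FP_eq, hw, smul_smul, ← Real.exp_add, add_neg_cancel, Real.exp_zero, one_smul, ← mul_assoc, ← mul_assoc, ← Real.exp_add]
    simp
  · rw [← integral_finsetSum _ fun j _ => outer_int hC0 hqm hqb j ht.1.le y, ← integral_const_mul]
    refine integral_congr_ae ?_
    filter_upwards [ae_Ioo t] with s hs
    have hg := exp_gap hs.1.le hs.2.le
    have hsI : s ∈ Set.Icc 0 T := ⟨hs.1.le, hs.2.le.trans ht.2⟩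
    rw [inner_eq hs.2, ← integral_finsetSum _ fun j _ => inner_int j (by linarith [hs.2]) y (rho_int hqm hqi hqC j s).1]
    refine integral_congr_ae ?_
    filter_upwards [hU s hsI] with z hz
    refine Finset.sum_congr rfl fun j _ => ?_
    unfold rho qf
    rw [hz]
    have : exp (-(N * s)) * f s (exp (-s) • z) ^ 2 = exp (N * s) * (exp (-(N * s)) * f s (exp (-s) • z)) ^ 2 := by
      rw [Real.exp_neg]; field_simp
    rw [this]

end Mild

section Final
variable {N : ℕ}

lemma ups_integrable {p m : ℝ} (hm : 1 ≤ m) (hp : 2 ≤ p) {f : Evec N → ℝ} (hf : MemUpsilon N p m f) : Integrable f := by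
  have h : UpsilonNorm N p m f ≠ ⊤ := (max_lt hf.2.1 (max_lt hf.2.2.1 hf.2.2.2)).ne
  exact (ups_bounds hm hp ENNReal.toReal_nonneg hf.1 (ENNReal.ofReal_toReal h).ge).2.1

lemma contraction_aux {p m T M : ℝ} (hm : 1 ≤ m) (hp : 2 ≤ p) {t : ℝ} (ht : t ∈ Set.Ioc 0 T)
    {f₀ g₀ : Evec N → ℝ} {f g U V : ℝ → Evec N → ℝ}
    (hf₀ : MemUpsilon N p m f₀) (hg₀ : MemUpsilon N p m g₀)
    (hf : IsMildSolution N p m T f₀ f) (hg : IsMildSolution N p m T g₀ g)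
    (hU : UProp T M U) (hUf : ∀ s ∈ Set.Icc (0:ℝ) T, U s =ᵐ[volume] fun z : Evec N => exp (-(N * s)) * f s (exp (-s) • z))
    (hV : UProp T M V) (hVg : ∀ s ∈ Set.Icc (0:ℝ) T, V s =ᵐ[volume] fun z : Evec N => exp (-(N * s)) * g s (exp (-s) • z)) :
    eLpNorm (fun v => f t v - g t v) 1 volume ≤ eLpNorm (fun v => f₀ v - g₀ v) 1 volume := by
  have hM0 := hU.M0
  set E := exp (N * T) with hE
  have hE0 : 0 < E := Real.exp_pos _
  have fi := ups_integrable hm hp hf₀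
  have gi := ups_integrable hm hp hg₀
  set a := hf₀.1.mk f₀ with ha
  set b := hg₀.1.mk g₀ with hb
  have hae : a =ᵐ[volume] f₀ := hf₀.1.ae_eq_mk.symm
  have hbe : b =ᵐ[volume] g₀ := hg₀.1.ae_eq_mk.symm
  have ham : Measurable a := hf₀.1.stronglyMeasurable_mk.measurable
  have hbm : Measurable b := hg₀.1.stronglyMeasurable_mk.measurable
  have hai : Integrable a := fi.congr hae.symm
  have hbi : Integrable b := gi.congr hbe.symm
  obtain ⟨m1, c1, i1, k1⟩ := qf_props hU
  obtain ⟨m2, c2, i2, k2⟩ := qf_props hV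
  have hUm : Measurable (fun p : ℝ × Evec N => U p.1 p.2) := hU.meas
  have hVm : Measurable (fun p : ℝ × Evec N => V p.1 p.2) := hV.meas
  have m1' : Measurable (fun p : ℝ × Evec N => qf U p.1 p.2) := m1
  have m2' : Measurable (fun p : ℝ × Evec N => qf V p.1 p.2) := m2
  have hqm : Measurable (fun p : ℝ × Evec N => qf U p.1 p.2 - qf V p.1 p.2) := m1'.sub m2'
  have hC0 : 0 ≤ E * M * M := by positivity
  have ab : ∀ s (z : Evec N), ‖z‖ * |qf U s z - qf V s z| ≤ ‖z‖ * |qf U s z| + ‖z‖ * |qf V s z| := fun s z => by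
    rw [← mul_add]; exact mul_le_mul_of_nonneg_left (abs_sub _ _) (norm_nonneg _)
  have hi : ∀ s, Integrable (fun z : Evec N => ‖z‖ * |qf U s z - qf V s z|) := fun s => by
    have hs : Measurable (fun z : Evec N => qf U s z - qf V s z) := hqm.comp measurable_prodMk_left
    refine ((i1 s).add (i2 s)).mono' (measurable_norm.mul hs.norm).aestronglyMeasurable (ae_of_all _ fun z => ?_)
    rw [Real.norm_of_nonneg (by positivity)]; exact ab s z
  have sqb : ∀ s (z : Evec N), ‖z‖ ^ 2 * (qf U s z - qf V s z) ^ 2 ≤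
      (2 * (E * M) ^ 2) * (‖z‖ ^ 2 * U s z ^ 2 + ‖z‖ ^ 2 * V s z ^ 2) := fun s z => by
    have h1 := pow_le_pow_left₀ (abs_nonneg _) (qf_le hU s z) 2
    have h2 := pow_le_pow_left₀ (abs_nonneg _) (qf_le hV s z) 2
    rw [sq_abs, mul_pow, sq_abs] at h1 h2
    have h3 : (qf U s z - qf V s z) ^ 2 ≤ 2 * qf U s z ^ 2 + 2 * qf V s z ^ 2 := by nlinarith [sq_nonneg (qf U s z + qf V s z)]
    have h4 : (qf U s z - qf V s z) ^ 2 ≤ (2 * (E * M) ^ 2) * (U s z ^ 2 + V s z ^ 2) := by linarith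
    have := mul_le_mul_of_nonneg_left h4 (sq_nonneg ‖z‖)
    linarith
  have key := core (T := t) (C := 2 * (E * M * M)) (C1 := 2 * (E * M * M)) (u0 := fun w => a w - b w)
    (q := fun s z => qf U s z - qf V s z) (u := fun s z => U s z - V s z)
    (b := fun s z => exp (N * s) * (|U s z| + |V s z|)) ht.1 (by positivity) (ham.sub hbm) (hai.sub hbi) hqm
    (fun s z => (abs_sub _ _).trans (by linarith [c1 s z, c2 s z])) hi (fun s => ?_) (fun s => ?_) ?_ (hUm.sub hVm)
    (fun τ hτ => ?_) (fun s z => ?_) ?_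
  · -- conclusion
    have htI : t ∈ Set.Icc 0 T := ⟨ht.1.le, ht.2⟩
    have r0 : eLpNorm (fun v => f₀ v - g₀ v) 1 volume = ENNReal.ofReal (∫ y, |a y - b y|) := by
      have hab : Integrable (fun y => |a y - b y|) := (hai.sub hbi).abs
      rw [eLpNorm_one_eq_lintegral_enorm, ofReal_integral_eq_lintegral_ofReal hab (ae_of_all _ fun y => abs_nonneg _)]
      refine lintegral_congr_ae ?_
      filter_upwards [hae, hbe] with y h1 h2
      rw [h1, h2, ← Real.norm_eq_abs, ofReal_norm]
    have hd : Integrable (fun v => f t v - g t v) :=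
      (ups_integrable hm hp (hf.1 t htI)).sub (ups_integrable hm hp (hg.1 t htI))
    have r1 : eLpNorm (fun v => f t v - g t v) 1 volume = ∫⁻ y, ENNReal.ofReal |U t y - V t y| := by
      have hdt : Integrable (fun y => exp (-(N * t)) * (fun v => f t v - g t v) (exp (-t) • y)) :=
        (hd.comp_smul (Real.exp_pos _).ne').const_mul _
      have e1 : ∫⁻ y, ENNReal.ofReal |U t y - V t y| = ∫⁻ y, ENNReal.ofReal |exp (-(N * t)) * (fun v => f t v - g t v) (exp (-t) • y)| := by
        refine lintegral_congr_ae ?_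
        filter_upwards [hUf t htI, hVg t htI] with y h1 h2
        rw [h1, h2, mul_sub]
      rw [e1, ← ofReal_integral_eq_lintegral_ofReal hdt.abs (ae_of_all _ fun y => abs_nonneg _)]
      have e2 : ∫ y, |exp (-(N * t)) * (fun v => f t v - g t v) (exp (-t) • y)| = ∫ v, |f t v - g t v| := by
        simp only [abs_mul, abs_of_pos (Real.exp_pos _)]
        rw [integral_const_mul, resc_int (φ := fun v => |f t v - g t v|), ← mul_assoc, ← Real.exp_add]
        simp
      rw [e2, eLpNorm_one_eq_lintegral_enorm, ofReal_integral_eq_lintegral_ofReal hd.abs (ae_of_all _ fun y => abs_nonneg _)]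
      congr 1; ext v
      rw [← Real.norm_eq_abs, ofReal_norm]
    rw [r0, r1]
    exact key
  · have h1 := integral_mono (hi s) ((i1 s).add (i2 s)) (ab s)
    have h2 := integral_add (i1 s) (i2 s)
    have h3 := k1 s
    have h4 := k2 s
    calc _ ≤ _ := h1
      _ = _ := h2
      _ ≤ _ := by linarith
  · have hs : Measurable (fun z : Evec N => qf U s z - qf V s z) := hqm.comp measurable_prodMk_left
    refine (((hU.i2 s).add (hV.i2 s)).const_mul (2 * (E * M) ^ 2)).mono' ((measurable_norm.pow_const 2).mul (hs.pow_const 2)).aestronglyMeasurable (ae_of_all _ fun z => ?_)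
    rw [Real.norm_of_nonneg (by positivity)]; exact sqb s z
  · refine (((prod_int hU t).add (prod_int hV t)).const_mul (2 * (E * M) ^ 2)).mono' ?_ (ae_of_all _ fun z => ?_)
    · exact ((measurable_snd.norm.pow_const 2).mul (hqm.pow_const 2)).aestronglyMeasurable
    · rw [Real.norm_of_nonneg (by positivity)]; exact sqb z.1 z.2
  · have hτ' : τ ∈ Set.Ioc 0 T := ⟨hτ.1, hτ.2.trans ht.2⟩
    filter_upwards [mild_Ulim hf hU hUf hae τ hτ', mild_Ulim hg hV hVg hbe τ hτ'] with y h1 h2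
    rw [h1, h2]
    exact (Ulim_sub hC0 hai hbi m1 c1 i1 k1 m2 c2 i2 k2 hτ.1 y).symm
  · unfold qf
    have : exp (N * s) * U s z ^ 2 - exp (N * s) * V s z ^ 2 = exp (N * s) * ((U s z + V s z) * (U s z - V s z)) := by ring
    rw [this, abs_mul, abs_mul, abs_of_pos (Real.exp_pos _), ← mul_assoc]
    refine mul_le_mul_of_nonneg_right ?_ (abs_nonneg _)
    exact mul_le_mul_of_nonneg_left (abs_add_le _ _) (Real.exp_pos _).le
  · have hmm : Measurable (fun p : ℝ × Evec N => ‖p.2‖ ^ 2 * ((exp (N * p.1) * (|U p.1 p.2| + |V p.1 p.2|)) ^ 2 * |U p.1 p.2 - V p.1 p.2|)) := by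
      have h1 := hUm.norm
      have h2 := hVm.norm
      have h3 := (hUm.sub hVm).norm
      simp only [Real.norm_eq_abs] at h1 h2 h3
      have h4 : Measurable (fun p : ℝ × Evec N => exp (N * p.1)) := by fun_prop
      exact (measurable_snd.norm.pow_const 2).mul (((h4.mul (h1.add h2)).pow_const 2).mul h3)
    refine (((prod_int hU t).add (prod_int hV t)).const_mul (4 * E ^ 2 * M)).mono' hmm.aestronglyMeasurable (ae_of_all _ fun z => ?_)
    rw [Real.norm_of_nonneg (by positivity)]
    show _ ≤ 4 * E ^ 2 * M * (‖z.2‖ ^ 2 * U z.1 z.2 ^ 2 + ‖z.2‖ ^ 2 * V z.1 z.2 ^ 2)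
    have hb : (exp (N * z.1) * (|U z.1 z.2| + |V z.1 z.2|)) ^ 2 * |U z.1 z.2 - V z.1 z.2| ≤ 4 * E ^ 2 * M * (U z.1 z.2 ^ 2 + V z.1 z.2 ^ 2) := by
      by_cases hs : z.1 ∈ Set.Icc 0 T
      · have h1 : exp (N * z.1) ≤ E := Real.exp_le_exp.2 (mul_le_mul_of_nonneg_left hs.2 (Nat.cast_nonneg _))
        have h2 : |U z.1 z.2 - V z.1 z.2| ≤ 2 * M := (abs_sub _ _).trans (by linarith [hU.bd z.1 z.2, hV.bd z.1 z.2])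
        have h3 : (|U z.1 z.2| + |V z.1 z.2|) ^ 2 ≤ 2 * (U z.1 z.2 ^ 2 + V z.1 z.2 ^ 2) := by
          have e1 := sq_abs (U z.1 z.2)
          have e2 := sq_abs (V z.1 z.2)
          nlinarith [sq_nonneg (|U z.1 z.2| - |V z.1 z.2|)]
        rw [mul_pow]
        calc _ ≤ E ^ 2 * (2 * (U z.1 z.2 ^ 2 + V z.1 z.2 ^ 2)) * (2 * M) := by gcongr
          _ = _ := by ring
      · rw [hU.zero _ hs, hV.zero _ hs]; simp
    have := mul_le_mul_of_nonneg_left hb (sq_nonneg ‖z.2‖)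
    linarith

end Final

/-- **`L¹`-contraction (Lemma 2.9, first part).** If `f, g ∈ X_T` solve the Cauchy problem with
respective initial data `f₀, g₀ ∈ Υ`, then `‖f(t) - g(t)‖₁ ≤ ‖f₀ - g₀‖₁` for `0 < t ≤ T`. -/
theorem L1_contraction
    (N : ℕ) (hN : 1 ≤ N) (m p T : ℝ) (hm : 1 ≤ m) (hpN : (N : ℝ) < p) (hp2 : 2 ≤ p)
    (hT : 0 < T) (f₀ g₀ : Evec N → ℝ) (hf₀Ups : MemUpsilon N p m f₀)
    (hg₀Ups : MemUpsilon N p m g₀)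
    (f g : ℝ → Evec N → ℝ) (hf : MemXT N p m T f₀ f) (hg : MemXT N p m T g₀ g) :
    ∀ t ∈ Set.Ioc (0 : ℝ) T,
      eLpNorm (fun v => f t v - g t v) 1 volume ≤ eLpNorm (fun v => f₀ v - g₀ v) 1 volume := by
  intro t ht
  obtain ⟨M1, U, hU, hUf⟩ := resc hT hm hp2 hf.1.1 hf.1.2.1
  obtain ⟨M2, V, hV, hVg⟩ := resc hT hm hp2 hg.1.1 hg.1.2.1
  exact contraction_aux hm hp2 ht hf₀Ups hg₀Ups hf.1 hg.1 (hU.mono (le_max_left M1 M2)) hUf (hV.mono (le_max_right M1 M2)) hVg
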